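/- Let k ≥ 2 be an integer and for n ≥ 1 let I_k(n) be the number of isomorphism types among the groups given by the presentations ⟨a_1,...,a_k | u = 1⟩, where u varies over the set of all cyclically reduced words of length n. Then there exist constants A = A(k) > 0 and B = B(k) > 0 such that for all n ≥ 1, (B/n)(2k−1)^n ≤ I_k(n) ≤ (A/n)(2k−1)^n. -/

import Mathlib

/-! Common definitions: free group `FG k = F(a_1,…,a_k)`, reduced and cyclically
reduced words, Whitehead automorphisms, strict minimality, counting functions and
exponential genericity, following Kapovich–Schupp–Shpilrain. -/

/-- The free group of rank `k` on the basis `a_1,…,a_k`. -/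
abbrev FG (k : ℕ) := FreeGroup (Fin k)

/-- The alphabet `Σ = {a_1,…,a_k}^{±1}`: a letter is a basis index together with a sign. -/
abbrev Letter (k : ℕ) := Fin k × Bool

/-- The inverse of a letter. -/
def linv {k : ℕ} (x : Letter k) : Letter k := (x.1, !x.2)

/-- The length `|g|` of the reduced word representing `g`. -/
def wordLength {k : ℕ} (g : FG k) : ℕ := (FreeGroup.toWord g).length

/-- A word is (freely) reduced if it equals its free reduction. -/
def ReducedWord {k : ℕ} (w : List (Letter k)) : Prop := FreeGroup.reduce w = w

/-- A word is cyclically reduced if all of its cyclic permutations are reduced;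
equivalently, `w ++ w` is reduced. -/
def CyclicallyReducedWord {k : ℕ} (w : List (Letter k)) : Prop :=
  FreeGroup.reduce (w ++ w) = w ++ w

/-- An element of `FG k` is cyclically reduced if its reduced word is. -/
def IsCyclicallyReduced {k : ℕ} (g : FG k) : Prop :=
  CyclicallyReducedWord (FreeGroup.toWord g)

/-- `C`, the set of all cyclically reduced elements of `FG k`. -/
def Cset (k : ℕ) : Set (FG k) := {g | IsCyclicallyReduced g}

/-- The cyclic length `‖g‖`: the length of the cyclically reduced form of `g`
(the unique cyclically reduced `u` with `g = x u x⁻¹`). -/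
noncomputable def cyclicLength {k : ℕ} (g : FG k) : ℕ :=
  sInf {n | ∃ x u : FG k, IsCyclicallyReduced u ∧ g = x * u * x⁻¹ ∧ wordLength u = n}

/-- The set `Σ = {a_1,…,a_k}^{±1}` inside the free group. -/
def letterSet (k : ℕ) : Set (FG k) :=
  {g | ∃ i : Fin k, g = FreeGroup.of i ∨ g = (FreeGroup.of i)⁻¹}

/-- A Whitehead automorphism of the first kind: a relabeling automorphism,
i.e. one whose restriction to `Σ` is a permutation of `Σ`. -/
def IsRelabeling {k : ℕ} (τ : MulAut (FG k)) : Prop :=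
  (⇑τ) '' letterSet k = letterSet k

/-- A Whitehead automorphism of the second kind, with multiplier `a ∈ Σ`:
`τ a = a` and `τ x ∈ {x, xa, a⁻¹x, a⁻¹xa}` for all `x ∈ Σ`. -/
def IsWhitehead2 {k : ℕ} (τ : MulAut (FG k)) : Prop :=
  ∃ a ∈ letterSet k, τ a = a ∧
    ∀ x ∈ letterSet k, τ x = x ∨ τ x = x * a ∨ τ x = a⁻¹ * x ∨ τ x = a⁻¹ * x * a

/-- An automorphism is inner if it is conjugation by some element. -/
def IsInner {k : ℕ} (α : MulAut (FG k)) : Prop := ∃ g : FG k, α = MulAut.conj g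

/-- `SM`: the set of strictly minimal cyclically reduced elements, those `w` with
`‖τ w‖ > |w|` for every non-inner Whitehead automorphism `τ` of the second kind. -/
def SM (k : ℕ) : Set (FG k) :=
  {w | IsCyclicallyReduced w ∧
    ∀ τ : MulAut (FG k), IsWhitehead2 τ → ¬ IsInner τ → wordLength w < cyclicLength (τ w)}

/-- `SM'`: elements whose cyclically reduced form lies in `SM`. -/
def SM' (k : ℕ) : Set (FG k) := {g | ∃ x u : FG k, u ∈ SM k ∧ g = x * u * x⁻¹}

/-- `γ(n,S)`: the number of elements of `S` of length `n`. -/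
noncomputable def gammaC {k : ℕ} (S : Set (FG k)) (n : ℕ) : ℕ :=
  {g ∈ S | wordLength g = n}.ncard

/-- `ρ(n,S)`: the number of elements of `S` of length at most `n`. -/
noncomputable def rhoC {k : ℕ} (S : Set (FG k)) (n : ℕ) : ℕ :=
  {g ∈ S | wordLength g ≤ n}.ncard

/-- `B ⊆ S` is exponentially generic in `S` if `ρ(n,B)/ρ(n,S) → 1`
exponentially fast. -/
def ExpGenericIn {k : ℕ} (B S : Set (FG k)) : Prop :=
  B ⊆ S ∧ ∃ K : ℝ, 0 < K ∧ ∃ σ : ℝ, 0 < σ ∧ σ < 1 ∧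
    ∀ n : ℕ, |1 - (rhoC B n : ℝ) / (rhoC S n : ℝ)| ≤ K * σ ^ n

/-- `B` is exponentially negligible in `S` if `S \ B` is exponentially generic in `S`. -/
def ExpNegligibleIn {k : ℕ} (B S : Set (FG k)) : Prop := ExpGenericIn (S \ B) S

/-- The orbit `Aut(F_k) w`. -/
def autOrbit {k : ℕ} (w : FG k) : Set (FG k) := {g | ∃ α : MulAut (FG k), α w = g}

/-- `u` is a cyclic permutation of `v`: the reduced word of `u` is a rotation of
the reduced word of `v`. -/
def IsCyclicPerm {k : ℕ} (u v : FG k) : Prop :=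
  ∃ n : ℕ, FreeGroup.toWord u = (FreeGroup.toWord v).rotate n

/-- `w` is a proper power: `w = uⁿ` for some `n ≥ 2`. -/
def IsProperPower {k : ℕ} (w : FG k) : Prop := ∃ (u : FG k) (n : ℕ), 2 ≤ n ∧ w = u ^ n

/-- `TS`: strictly minimal cyclically reduced `w` which are not proper powers and
are not conjugate to `τ w` for any nontrivial relabeling automorphism `τ`. -/
def TS (k : ℕ) : Set (FG k) :=
  {w | w ∈ SM k ∧ ¬ IsProperPower w ∧
    ∀ τ : MulAut (FG k), IsRelabeling τ → τ ≠ 1 → ¬ IsConj (τ w) w}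

/-- `TS'`: elements whose cyclically reduced form lies in `TS`. -/
def TS' (k : ℕ) : Set (FG k) := {g | ∃ x u : FG k, u ∈ TS k ∧ g = x * u * x⁻¹}

/-- `Z`: elements of `TS` such that no relabeling automorphism sends `w` to a cyclic
permutation of `w⁻¹`. -/
def Zset (k : ℕ) : Set (FG k) :=
  {w | w ∈ TS k ∧ ¬ ∃ τ : MulAut (FG k), IsRelabeling τ ∧ IsCyclicPerm (τ w) w⁻¹}

/-- Growth entropy `H(S) = limsup ρ(n,S)^{1/n}`. -/
noncomputable def entropyH {k : ℕ} (S : Set (FG k)) : ℝ :=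
  Filter.limsup (fun n : ℕ => (rhoC S n : ℝ) ^ ((n : ℝ)⁻¹)) Filter.atTop

/-- Number of occurrences of the two-letter word `xy` as a subword of `w`. -/
def countPair {k : ℕ} (w : List (Letter k)) (x y : Letter k) : ℕ :=
  (w.zip w.tail).count (x, y)

/-- The label `ŵ_{xy}` of the edge `[x⁻¹, y]` in the weighted Whitehead graph of the
cyclically reduced word `w`: occurrences of `xy` and of `y⁻¹x⁻¹` in `wc`, where `c` is
the first letter of `w`. -/
def whLabel {k : ℕ} (w : List (Letter k)) (x y : Letter k) : ℕ :=
  countPair (w ++ w.take 1) x y + countPair (w ++ w.take 1) (linv y) (linv x)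

/-- The one-relator group `G_u = ⟨a_1,…,a_k ∣ u = 1⟩`. -/
abbrev OneRel (k : ℕ) (u : FG k) := FG k ⧸ Subgroup.normalClosure ({u} : Set (FG k))

/-- `u` is primitive: it belongs to some free basis of `FG k`, equivalently it is the
image of a basis element under an automorphism. -/
def IsPrimitive {k : ℕ} (u : FG k) : Prop :=
  ∃ (α : MulAut (FG k)) (i : Fin k), α (FreeGroup.of i) = u

/-- `I_k(n)`: the number of isomorphism types among the one-relator groups `G_u`
where `u` ranges over cyclically reduced words of length `n`, counted as the number
of equivalence classes for the relation `u ∼ v ↔ G_u ≅ G_v`. -/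
noncomputable def isoTypesCount (k n : ℕ) : ℕ :=
  {T : Set (FG k) | ∃ u, u ∈ Cset k ∧ wordLength u = n ∧
    T = {v | v ∈ Cset k ∧ wordLength v = n ∧
      Nonempty (OneRel k u ≃* OneRel k v)}}.ncard

notation "OM" => (by omega)
notation:max "LW" k:max => List (Letter k)
open Finset (subset_insert card_insert_le mem_insert card_insert_of_notMem univ card_image_le card_image_iff card_erase_of_mem card_pos mem_image mem_image_of_mem mem_erase card_eq_one card_sigma card_product card_le_card_of_injOn mem_sigma mem_product mem_univ sum_le_sum sum_add_distrib card_filter sum_const sum_congr mem_singleton Ico Ioo card_image_of_injOn mem_Ico mem_Ioo mem_sdiff card_sdiff_add_card_eq_card mem_biUnion disjoint_left card_eq_sum_ones card_univ card_le_card mem_filter filter_subset Icc mem_Icc card_filter_le card_le_mul_card_image coe_filter range mem_range mem_union card_union_le card_range card_biUnion_le_card_mul mem_of_mem_erase card_image_of_injective card_union_of_disjoint mem_coe card_le_one finite_toSet coe_range coe_product sum_ite_eq' card_biUnion_le mul_sum sum_range_succ' sum_sub_distrib sum_div)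
open FreeGroup (toWord reduce of norm_inv_eq invRev isReduced_iff_reduce_eq mk norm toWord_mk isReduced_toWord mk_toWord mul_mk inv_mk one_eq_mk toWord_injective lift ext_hom lift_apply_of reduceCyclically)
open List (length_append take_append_of_le_length take_append_drop length_take length_drop length_pos_iff range_succ head length_cons append_assoc length_eq_zero_iff cons_append replicate replicate_succ replicate_add take tail_cons take_succ_eq_append_getElem cons_prefix_cons)
open Set (mem_setOf_eq InjOn mem_ofPred_eq ncard_eq_toFinset_card finite_iUnion mem_iUnion finite_empty diff_subset ncard_le_ncard ncard_union_le ncard_coe_finset mem_Iio ncard_le_ncard_of_injOn ncard_image_of_injective mem_prod ncard_le_one)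
open Nat (le_mul_of_pos_right lt_succ_iff_lt_or_eq card_Ico cast_zero le_mul_of_pos_left find find_min' find_spec le_zero cast_add strong_induction_on one_le_iff_ne_zero pow_le_pow_right lt_two_pow_self cast_le log pow_log_le_self lt_pow_succ_log_self pow_le_pow_left cast_nonneg lt_mul_div_succ)
variable {k : ℕ}
set_option autoImplicit false
set_option linter.unusedSimpArgs false
def td (x y : FG k) : ℕ := (x⁻¹ * y).norm
lemma td_left (g x y : FG k) : td (g * x) (g * y) = td x y := by
  unfold td; congr 1; group
lemma td_comm (x y : FG k) : td x y = td y x := by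
  unfold td; rw [← norm_inv_eq]; congr 1; group
lemma td_self (x : FG k) : td x x = 0 := by simp [td]
lemma td_zero {x y : FG k} : td x y = 0 ↔ x = y := by
  unfold td; rw [FreeGroup.norm_eq_zero, inv_mul_eq_one]
lemma td_tri (x y z : FG k) : td x z ≤ td x y + td y z := by
  unfold td
  have := FreeGroup.norm_mul_le (x⁻¹ * y) (y⁻¹ * z)
  convert this using 2; group
lemma lcp_split {α : Type*} [DecidableEq α] : ∀ X Y : List α, ∃ p a b, X = p ++ a ∧ Y = p ++ b ∧
    (∀ c ∈ a.head?, ∀ e ∈ b.head?, c ≠ e)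
  | [], Y => ⟨[], [], Y, by simp⟩
  | X, [] => ⟨[], X, [], by simp⟩
  | x :: X, y :: Y => by
    by_cases h : x = y
    · obtain ⟨p, a, b, rfl, rfl, h3⟩ := lcp_split X Y
      exact ⟨x :: p, a, b, by simp, by simp [h], h3⟩
    · exact ⟨[], x :: X, y :: Y, by simp [h]⟩
lemma isReduced_append {a b : LW k} : FreeGroup.IsReduced (a ++ b) ↔
    FreeGroup.IsReduced a ∧ FreeGroup.IsReduced b ∧
    ∀ x ∈ a.getLast?, ∀ y ∈ b.head?, y ≠ linv x := by
  unfold FreeGroup.IsReduced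
  rw [List.isChain_append]
  refine and_congr Iff.rfl (and_congr Iff.rfl ?_)
  refine forall₂_congr fun x _ => forall₂_congr fun y _ => ?_
  rcases x with ⟨x, s⟩; rcases y with ⟨y, t⟩
  simp only [linv, ne_eq, Prod.mk.injEq, not_and]
  cases s <;> cases t <;> simp <;> tauto
lemma isReduced_invRev {a : LW k} (h : FreeGroup.IsReduced a) :
    FreeGroup.IsReduced (invRev a) := by
  rw [isReduced_iff_reduce_eq] at *
  rw [FreeGroup.reduce_invRev, h]
lemma norm_mk {a : LW k} (h : FreeGroup.IsReduced a) :
    (FreeGroup.mk a).norm = a.length := by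
  rw [FreeGroup.norm, FreeGroup.toWord_mk, h.reduce_eq]
lemma invRev_append_reduced {a b : LW k} (ha : FreeGroup.IsReduced a)
    (hb : FreeGroup.IsReduced b) (h : ∀ c ∈ a.head?, ∀ e ∈ b.head?, c ≠ e) :
    FreeGroup.IsReduced (invRev a ++ b) := by
  refine isReduced_append.2 ⟨isReduced_invRev ha, hb, fun x hx y hy hxy => ?_⟩
  refine h (linv x) ?_ y hy hxy.symm
  cases a with
  | nil => simp [invRev] at hx
  | cons c t => simp [invRev] at hx ⊢; subst hx; simp [linv]
lemma td_lcp (x y : FG k) : ∃ p a b, x.toWord = p ++ a ∧ y.toWord = p ++ b ∧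
    (∀ c ∈ a.head?, ∀ e ∈ b.head?, c ≠ e) ∧ td x y = a.length + b.length := by
  obtain ⟨p, a, b, h1, h2, h3⟩ := lcp_split x.toWord y.toWord
  refine ⟨p, a, b, h1, h2, h3, ?_⟩
  have hx := isReduced_toWord (x := x)
  have hy := isReduced_toWord (x := y)
  rw [h1] at hx; rw [h2] at hy
  have := invRev_append_reduced (isReduced_append.1 hx).2.1 (isReduced_append.1 hy).2.1 h3
  have e : x⁻¹ * y = mk (invRev a ++ b) := by
    rw [← mk_toWord (x := x), ← mk_toWord (x := y), h1, h2,
      ← FreeGroup.mul_mk, ← FreeGroup.mul_mk, ← FreeGroup.mul_mk, ← FreeGroup.inv_mk]; group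
  rw [td, e, norm_mk this]; simp
lemma take_of_td {x y : FG k} {c : ℕ} (h : 2 * c + td x y ≤ x.norm + y.norm) :
    x.toWord.take c = y.toWord.take c := by
  obtain ⟨p, a, b, h1, h2, h3, h4⟩ := td_lcp x y
  simp only [FreeGroup.norm, h1, h2, List.length_append] at *
  rw [List.take_append_of_le_length (by omega), List.take_append_of_le_length (by omega)]
lemma td_of_take {x y : FG k} {c : ℕ} (hx : c ≤ x.norm) (hy : c ≤ y.norm)
    (h : x.toWord.take c = y.toWord.take c) : 2 * c + td x y ≤ x.norm + y.norm := by
  obtain ⟨p, a, b, h1, h2, h3, h4⟩ := td_lcp x y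
  simp only [FreeGroup.norm, h1, h2, List.length_append] at *
  rw [h4]
  by_contra hc
  have hp : p.length < c := by omega
  rcases a with _ | ⟨a0, a⟩
  · simp at *; omega
  rcases b with _ | ⟨b0, b⟩
  · simp at *; omega
  have := congrArg (fun l => l[p.length]?) h
  simp [hp] at this
  exact h3 a0 (by simp) b0 (by simp) this
lemma td_one_left (x : FG k) : td 1 x = x.norm := by simp [td]
lemma td_parity (x y : FG k) : ∃ c, 2 * c + td x y = x.norm + y.norm ∧ c ≤ x.norm ∧
    c ≤ y.norm := by
  obtain ⟨p, a, b, h1, h2, h3, h4⟩ := td_lcp x y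
  refine ⟨p.length, ?_⟩
  simp only [FreeGroup.norm, h1, h2, List.length_append] at *
  omega
lemma four_pt1 (x y z : FG k) :
    td x y + z.norm ≤ td x z + y.norm ∨ td x y + z.norm ≤ td y z + x.norm := by
  obtain ⟨c, hc, c1, c2⟩ := td_parity x z
  obtain ⟨e, he, e1, e2⟩ := td_parity y z
  have h1 := take_of_td (x := x) (y := z) (c := min c e) OM
  have h2 := take_of_td (x := y) (y := z) (c := min c e) OM
  have := td_of_take (x := x) (y := y) (c := min c e) OM OM (h1.trans h2.symm)
  omega
lemma four_pt (x y z w : FG k) :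
    td x y + td z w ≤ td x z + td y w ∨ td x y + td z w ≤ td x w + td y z := by
  have := four_pt1 (w⁻¹ * x) (w⁻¹ * y) (w⁻¹ * z)
  rw [td_left, td_left, td_left] at this
  have e : ∀ t : FG k, (w⁻¹ * t).norm = td t w := fun t => td_comm t w ▸ rfl
  rw [e, e, e] at this
  omega
lemma td_even (x y z : FG k) : ∃ c, 2 * c + td x y = td x z + td y z := by
  obtain ⟨c, hc, _⟩ := td_parity (z⁻¹ * x) (z⁻¹ * y)
  rw [td_left] at hc
  exact ⟨c, by rw [td_comm x z, td_comm y z]; exact hc⟩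
lemma geo_exists (x y : FG k) (i : ℕ) (hi : i ≤ td x y) :
    ∃ z, td x z = i ∧ i + td z y = td x y := by
  have hr := isReduced_toWord (x := x⁻¹ * y)
  rw [← take_append_drop i (x⁻¹ * y).toWord] at hr
  have h1 := (isReduced_append.1 hr).1
  have h2 := (isReduced_append.1 hr).2.1
  have hl : td x y = (x⁻¹ * y).toWord.length := rfl
  refine ⟨x * mk ((x⁻¹ * y).toWord.take i), ?_, ?_⟩
  · rw [td, inv_mul_cancel_left, norm_mk h1, length_take]; omega
  · have e : (x * mk ((x⁻¹ * y).toWord.take i))⁻¹ * y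
        = mk ((x⁻¹ * y).toWord.drop i) := by
      rw [mul_inv_rev, mul_assoc, inv_mul_eq_iff_eq_mul, mul_mk, take_append_drop,
        mk_toWord]
    rw [td, e, norm_mk h2, length_drop]; omega
lemma geo_unique {x y z w : FG k} (hz : td x z + td z y = td x y)
    (hw : td x w + td w y = td x y) (h : td x z = td x w) : z = w := by
  have := four_pt x y z w
  rw [td_comm y w, td_comm y z] at this
  exact td_zero.1 OM
def bw (x z y : FG k) : Prop := td x z + td z y = td x y
lemma bw_left {g x z y : FG k} : bw (g * x) (g * z) (g * y) ↔ bw x z y := by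
  simp only [bw, td_left]
lemma bw_symm {x z y : FG k} (h : bw x z y) : bw y z x := by
  unfold bw at *; rw [td_comm y z, td_comm z x, td_comm y x]; omega
lemma bw_sub {x c p : FG k} (a : FG k) (h : bw x c p) : bw x c a ∨ bw a c p := by
  unfold bw at *
  have := four_pt x p a c
  have := td_tri x c a
  have := td_tri a c p
  rw [td_comm p c, td_comm p a, td_comm a c] at *
  omega
lemma bw_trans {x c p e : FG k} (h : bw x c p) (h' : bw x e c) : bw x e p := by
  unfold bw at *
  have := td_tri e c p
  have := td_tri x e p
  omega
lemma median (x y z : FG k) : ∃ c, bw x c y ∧ bw y c z ∧ bw x c z := by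
  obtain ⟨c, hc⟩ := td_even y z x
  rw [td_comm y x, td_comm z x] at hc
  have := td_tri x y z
  have := td_tri x z y
  rw [td_comm z y] at this
  obtain ⟨m, h1, h2⟩ := geo_exists x y c OM
  refine ⟨m, ?_⟩
  unfold bw
  have := four_pt x y m z
  have := td_tri x m z
  have := td_tri y m z
  rw [td_comm y m] at *
  omega
lemma fp (x y z w : FG k) :
    (td x y + td z w ≤ td x z + td y w ∨ td x y + td z w ≤ td x w + td y z) ∧
    (td x z + td y w ≤ td x y + td z w ∨ td x z + td y w ≤ td x w + td y z) ∧
    (td x w + td y z ≤ td x z + td y w ∨ td x w + td y z ≤ td x y + td z w) := by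
  have h1 := four_pt x y z w
  have h2 := four_pt x z y w
  have h3 := four_pt x w y z
  simp only [td_comm z y, td_comm w y, td_comm w z] at *
  omega
lemma tr (x y z : FG k) :
    td x y ≤ td x z + td y z ∧ td x z ≤ td x y + td y z ∧ td y z ≤ td x y + td x z := by
  have h1 := td_tri x y z
  have h2 := td_tri x z y
  have h3 := td_tri y x z
  simp only [td_comm z y, td_comm y x] at *
  omega
structure Ln (k n m : ℕ) (u : FG k) (p : ℤ → FG k) : Prop where
  dist : ∀ i j, td (p i) (p j) = (i - j).natAbs
  per : ∀ i, p (i + n) = u * p i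
  p0 : p 0 = 1
  sep : ∀ (g : FG k) (i j i' j' : ℤ), g * p i = p j → g * p i' = p j' → m ≤ (i - i').natAbs →
    ∃ t : ℤ, g = u ^ t
  cov : ∀ x y, td x y = 1 → ∃ (g : FG k) (i j : ℤ), x = g * p i ∧ y = g * p j
  hn : 20 * m ≤ n
  hm : 1 ≤ m
def Ax (p : ℤ → FG k) (g x : FG k) : Prop := ∃ i, x = g * p i
def Same (u g h : FG k) : Prop := ∃ t : ℤ, h = g * u ^ t
namespace Ln
variable {n m : ℕ} {u : FG k} {p : ℤ → FG k}
lemma perz (H : Ln k n m u p) (t i : ℤ) : p (i + n * t) = u ^ t * p i := by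
  induction t using Int.induction_on with
  | zero => simp
  | succ t ih =>
    have := H.per (i + n * t)
    rw [ih] at this
    rw [zpow_add, zpow_one, (Commute.zpow_self u _).eq, mul_assoc, ← this]; congr 1; ring
  | pred t ih =>
    have := H.per (i + n * (-t - 1))
    rw [show i + n * (-(t:ℤ) - 1) + n = i + n * (-t) by ring, ih] at this
    rw [zpow_sub, zpow_one, ← (Commute.inv_left (Commute.self_zpow u _)).eq, mul_assoc, this]; group
lemma ax_self (H : Ln k n m u p) (g : FG k) : Ax p g g := ⟨0, by rw [H.p0, mul_one]⟩
lemma ax_left {g h x : FG k} : Ax p (g * h) (g * x) ↔ Ax p h x := by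
  simp only [Ax, mul_assoc, mul_right_inj]
lemma ax_left' {g h x : FG k} : Ax p h (g * x) ↔ Ax p (g⁻¹ * h) x := by
  rw [← ax_left (g := g) (h := g⁻¹ * h), mul_inv_cancel_left]
lemma same_symm {g h : FG k} (hs : Same u g h) : Same u h g := by
  obtain ⟨t, rfl⟩ := hs; exact ⟨-t, by group⟩
lemma same_left {g h : FG k} (w : FG k) (hs : Same u g h) : Same u (w * g) (w * h) := by
  obtain ⟨t, rfl⟩ := hs; exact ⟨t, by group⟩
lemma same_ax (H : Ln k n m u p) {g h x : FG k} (hs : Same u g h) (hx : Ax p h x) : Ax p g x := by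
  obtain ⟨t, rfl⟩ := hs; obtain ⟨i, rfl⟩ := hx
  exact ⟨i + n * t, by rw [H.perz, mul_assoc]⟩
lemma same_conj {g h : FG k} (hs : Same u g h) : g * u * g⁻¹ = h * u * h⁻¹ := by
  obtain ⟨t, rfl⟩ := hs; group
lemma ax_pow (H : Ln k n m u p) {g x : FG k} (j : ℤ) (hx : Ax p g x) :
    Ax p g ((g * u * g⁻¹) ^ j * x) := by
  obtain ⟨i, rfl⟩ := hx
  exact ⟨i + n * j, by rw [H.perz, conj_zpow]; group⟩
lemma td_pow (H : Ln k n m u p) {g x : FG k} (j : ℤ) (hj : j ≠ 0) (hx : Ax p g x) :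
    n ≤ td x ((g * u * g⁻¹) ^ j * x) := by
  obtain ⟨i, rfl⟩ := hx
  rw [show (g * u * g⁻¹) ^ j * (g * p i) = g * p (i + n * j) by rw [H.perz, conj_zpow]; group,
    td_left, H.dist, show i - (i + n * j) = -(n * j) by ring, Int.natAbs_neg, Int.natAbs_mul]
  simp only [Int.natAbs_natCast]
  exact le_mul_of_pos_right n (Int.natAbs_pos.2 hj)
lemma ax_conv (H : Ln k n m u p) {g x y z : FG k} (hx : Ax p g x) (hy : Ax p g y)
    (hz : bw x z y) : Ax p g z := by
  obtain ⟨i, rfl⟩ := hx; obtain ⟨j, rfl⟩ := hy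
  unfold bw at hz
  rcases le_total i j with h | h
  · refine ⟨i + td (g * p i) z, geo_unique hz ?_ ?_⟩
    all_goals simp only [td_left, H.dist] at *; omega
  · refine ⟨i - td (g * p i) z, geo_unique hz ?_ ?_⟩
    all_goals simp only [td_left, H.dist] at *; omega
lemma ax_sep (H : Ln k n m u p) {g h x y : FG k} (hx : Ax p g x) (hy : Ax p g y) (hx' : Ax p h x)
    (hy' : Ax p h y) (hd : m ≤ td x y) : Same u h g := by
  obtain ⟨i, rfl⟩ := hx; obtain ⟨j, rfl⟩ := hy; obtain ⟨i', hi⟩ := hx'; obtain ⟨j', hj⟩ := hy'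
  obtain ⟨t, ht⟩ := H.sep (h⁻¹ * g) i i' j j' (by rw [mul_assoc, hi, inv_mul_cancel_left])
    (by rw [mul_assoc, hj, inv_mul_cancel_left]) (by rwa [td_left, H.dist] at hd)
  exact ⟨t, by rw [← ht]; group⟩
end Ln
structure St (n m : ℕ) (u : FG k) (p : ℤ → FG k) (W : Set (FG k))
    (M : Subgroup (FG k)) : Prop where
  conv : ∀ x y z, x ∈ W → y ∈ W → bw x z y → z ∈ W
  one : 1 ∈ W
  inv : ∀ g ∈ M, ∀ x ∈ W, g * x ∈ W
  a : ∀ g, ((∀ x, Ax p g x → x ∈ W) ∧ g * u * g⁻¹ ∈ M) ∨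
    (∀ x y, x ∈ W → y ∈ W → Ax p g x → Ax p g y → td x y ≤ 2 * m)
  b : ∀ g ∈ M, g ≠ 1 → ∃ y z h, Ax p h y ∧ Ax p h z ∧ bw 1 y g ∧ bw 1 z g ∧ n ≤ td y z + 8 * m
def Om (u : FG k) (p : ℤ → FG k) (W : Set (FG k)) (M : Subgroup (FG k)) (i : FG k) : Prop :=
  (∃ a ∈ W, Ax p i a) ∧ ¬ ((∀ x, Ax p i x → x ∈ W) ∧ i * u * i⁻¹ ∈ M)
def Sx (u : FG k) (p : ℤ → FG k) (W : Set (FG k)) (M : Subgroup (FG k)) (x i : FG k) :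
    Prop := x ∈ W ∨ ∃ i0, Om u p W M i0 ∧ Ax p i0 x ∧ ¬ Same u i0 i
inductive Ch (u : FG k) (p : ℤ → FG k) (W : Set (FG k)) (M : Subgroup (FG k)) (x : FG k) :
    FG k → FG k → Prop
  | one (i : FG k) (j : ℤ) : Om u p W M i → j ≠ 0 → Sx u p W M x i → Ch u p W M x
      ((i * u * i⁻¹) ^ j) i
  | cons (w i i' : FG k) (j : ℤ) : Ch u p W M x w i → Om u p W M i' → j ≠ 0 → ¬ Same u i i' →
      Ch u p W M x (w * (i' * u * i'⁻¹) ^ j) i'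
namespace St
variable {n m : ℕ} {u : FG k} {p : ℤ → FG k} {W : Set (FG k)} {M : Subgroup (FG k)}
lemma om_diam (S : St n m u p W M) {i x y : FG k} (hi : Om u p W M i) (hx : x ∈ W) (hy : y ∈ W)
    (hx' : Ax p i x) (hy' : Ax p i y) : td x y ≤ 2 * m :=
  (S.a i).resolve_left hi.2 x y hx hy hx' hy'
lemma keyK (S : St n m u p W M) (H : Ln k n m u p) {i x q r : FG k} (hi : Om u p W M i)
    (hx : Sx u p W M x i) (hq : q ∈ W) (hq' : Ax p i q) (hr : Ax p i r) :
    td x q + td q r ≤ td x r + 6 * m := by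
  obtain ⟨c, c1, c2, c3⟩ := median x q r
  have hc : Ax p i c := H.ax_conv hq' hr c2
  have key : td c q ≤ 3 * m := by
    have hW : c ∈ W → td c q ≤ 3 * m := fun h => by
      have := S.om_diam hi h hq hc hq'; omega
    rcases hx with hx | ⟨i0, ⟨⟨a, ha, ha'⟩, h0⟩, hx, hs⟩
    · exact hW (S.conv _ _ _ hx hq c1)
    · rcases bw_sub a c1 with h | h
      · obtain ⟨e, e1, e2, e3⟩ := median c a q
        have hc0 := H.ax_conv hx ha' h
        have he0 := H.ax_conv hc0 ha' e1
        have he : Ax p i e := H.ax_conv hc hq' e3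
        have h1 := S.om_diam hi (S.conv _ _ _ ha hq e2) hq he hq'
        have h2 : ¬ m ≤ td c e := fun hm => hs (H.ax_sep hc he hc0 he0 hm)
        unfold bw at *; omega
      · exact hW (S.conv _ _ _ ha hq h)
  unfold bw at *
  rw [td_comm q c] at *
  omega
lemma ch_om {x w i : FG k} (h : Ch u p W M x w i) : Om u p W M i := by cases h <;> assumption
lemma om_shift (S : St n m u p W M) (H : Ln k n m u p) {i a b : FG k} {j : ℤ} (hi : Om u p W M i)
    (hj : j ≠ 0) (ha : a ∈ W) (ha' : Ax p i a) (hb : b ∈ W) (hb' : Ax p i b) :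
    n ≤ td a ((i * u * i⁻¹) ^ j * b) + 2 * m := by
  have h1 := H.td_pow j hj hb'
  have h2 := td_tri b a ((i * u * i⁻¹) ^ j * b)
  have h3 := S.om_diam hi hb ha hb' ha'
  omega
lemma ch_inv (S : St n m u p W M) (H : Ln k n m u p) {x w i : FG k} (h : Ch u p W M x w i) :
    ∃ q, Ax p (w * i) q ∧ ∀ b ∈ W, Ax p i b → n ≤ td q (w * b) + 2 * m ∧
      td x q + td q (w * b) ≤ td x (w * b) + 6 * m := by
  have hn := H.hn; have hm := H.hm
  induction h with
  | one i j hi hj hx =>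
    obtain ⟨a, ha, ha'⟩ := hi.1
    refine ⟨a, ?_, fun b hb hb' => ⟨S.om_shift H hi hj ha ha' hb hb',
      S.keyK H hi hx ha ha' (H.ax_pow _ hb')⟩⟩
    refine H.same_ax ⟨-j, ?_⟩ ha'
    rw [conj_zpow]; group
  | cons w i i' j hw hi' hj hs ih =>
    obtain ⟨q, hq, hq'⟩ := ih
    obtain ⟨a, ha, ha'⟩ := hi'.1
    have hi := ch_om hw
    obtain ⟨b0, hb0, hb0'⟩ := hi.1
    obtain ⟨q1, q2⟩ := hq' b0 hb0 hb0'
    refine ⟨w * a, ?_, fun b hb hb' => ?_⟩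
    · rw [mul_assoc, Ln.ax_left]
      refine H.same_ax ⟨-j, ?_⟩ ha'
      rw [conj_zpow]; group
    · have hqq : Ax p i (w⁻¹ * q) := by rw [Ln.ax_left', inv_inv]; exact hq
      have h1 := S.om_shift H hi' hj ha ha' hb hb'
      set b' := (i' * u * i'⁻¹) ^ j * b with hb'd
      have h2 := S.keyK H (x := w⁻¹ * q) hi' (Or.inr ⟨i, hi, hqq, hs⟩) ha ha'
        (H.ax_pow j hb')
      rw [← hb'd] at h2
      have h3 := S.keyK H (x := a) hi (Or.inl ha) hb0 hb0' hqq
      rw [← td_left w, ← td_left w (w⁻¹ * q), ← td_left w a, mul_inv_cancel_left] at h2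
      rw [← td_left w, ← td_left w a, ← td_left w b0, mul_inv_cancel_left] at h3
      rw [mul_assoc, ← hb'd, td_left]
      refine ⟨h1, ?_⟩
      rw [← td_left w a b'] at h1 ⊢
      have h4 := fp x q (w * b0) (w * a)
      have h5 := fp x q (w * a) (w * b')
      have t1 := tr q (w * b0) (w * a)
      have t2 := tr x q (w * a)
      have t3 := tr q (w * a) (w * b')
      simp only [td_comm (w * b0) q, td_comm (w * a) q, td_comm (w * a) (w * b0),
        td_comm (w * b') q, td_comm (w * b') (w * a)] at *
      omega
lemma ch_end (S : St n m u p W M) (H : Ln k n m u p) {x w i y : FG k} (h : Ch u p W M x w i)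
    (hy : Sx u p W M (w⁻¹ * y) i) : ∃ a b, Ax p (w * i) a ∧ Ax p (w * i) b ∧ bw x a y ∧
      bw x b y ∧ n ≤ td a b + 8 * m := by
  have hn := H.hn; have hm := H.hm
  obtain ⟨q, hq, hq'⟩ := S.ch_inv H h
  have hi := ch_om h
  obtain ⟨b0, hb0, hb0'⟩ := hi.1
  obtain ⟨q1, q2⟩ := hq' b0 hb0 hb0'
  have hqq : Ax p i (w⁻¹ * q) := by rw [Ln.ax_left', inv_inv]; exact hq
  have h2 := S.keyK H hi hy hb0 hb0' hqq
  rw [← td_left w, ← td_left w b0, ← td_left w (w⁻¹ * y), mul_inv_cancel_left,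
    mul_inv_cancel_left] at h2
  have hax : Ax p (w * i) (w * b0) := Ln.ax_left.2 hb0'
  generalize w * b0 = e at *
  obtain ⟨a, a1, a2, a3⟩ := median x q e
  obtain ⟨b, b1, b2, b3⟩ := median q e y
  refine ⟨a, b, H.ax_conv hq hax a2, H.ax_conv hq hax b1, ?_⟩
  have f1 := fp x q e y
  have f2 := fp x a e y
  have f3 := fp q a e y
  have f4 := fp x q b y
  have f5 := fp x q b e
  have f6 := fp q a b e
  have f7 := tr x b y
  have f8 := tr x a y
  unfold bw at *
  simp only [td_comm q x, td_comm e x, td_comm a x, td_comm b x, td_comm y x, td_comm e q,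
    td_comm a q, td_comm b q, td_comm y q, td_comm e a, td_comm b a, td_comm y a,
    td_comm e b, td_comm y b, td_comm y e] at *
  refine ⟨?_, ?_, ?_⟩ <;> omega
end St
def Pc (u : FG k) (p : ℤ → FG k) (W : Set (FG k)) (M : Subgroup (FG k)) (x : FG k) : Prop :=
  x ∈ W ∨ ∃ i, Om u p W M i ∧ Ax p i x
def Mx (u : FG k) (p : ℤ → FG k) (W : Set (FG k)) (M : Subgroup (FG k)) : Subgroup (FG k) :=
  Subgroup.closure ((M : Set (FG k)) ∪ {h | ∃ i, Om u p W M i ∧ h = i * u * i⁻¹})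
def Wx (u : FG k) (p : ℤ → FG k) (W : Set (FG k)) (M : Subgroup (FG k)) : Set (FG k) :=
  {x | ∃ g ∈ Mx u p W M, Pc u p W M (g⁻¹ * x)}
namespace St
variable {n m : ℕ} {u : FG k} {p : ℤ → FG k} {W : Set (FG k)} {M : Subgroup (FG k)}
lemma om_M (S : St n m u p W M) {g i : FG k} (hg : g ∈ M) (hi : Om u p W M i) :
    Om u p W M (g * i) := by
  obtain ⟨⟨a, ha, ha'⟩, h⟩ := hi
  refine ⟨⟨g * a, S.inv g hg a ha, Ln.ax_left.2 ha'⟩, fun h' => h ⟨fun x hx => ?_, ?_⟩⟩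
  · have := S.inv _ (M.inv_mem hg) _ (h'.1 (g * x) (Ln.ax_left.2 hx))
    rwa [inv_mul_cancel_left] at this
  · have := M.mul_mem (M.mul_mem (M.inv_mem hg) h'.2) hg
    convert this using 1; group
lemma M_le : M ≤ Mx u p W M := fun _ h => Subgroup.subset_closure (Or.inl h)
lemma om_mem {i : FG k} (h : Om u p W M i) : i * u * i⁻¹ ∈ Mx u p W M :=
  Subgroup.subset_closure (Or.inr ⟨i, h, rfl⟩)
def NF (u : FG k) (p : ℤ → FG k) (W : Set (FG k)) (M : Subgroup (FG k)) (x g : FG k) : Prop :=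
  ∃ g1 ∈ Mx u p W M, ∃ g2, g = g1 * g2 ∧ (x ∈ W → g1 = 1) ∧ Pc u p W M (g1⁻¹ * x) ∧
    (g2 ∈ M ∨ ∃ w i m0, m0 ∈ M ∧ Ch u p W M (g1⁻¹ * x) w i ∧ g2 = w * m0)
lemma nf_step (S : St n m u p W M) (H : Ln k n m u p) {x g i : FG k} (h : NF u p W M x g)
    (hi : Om u p W M i) (e : ℤ) (he : e ≠ 0) : NF u p W M x (g * (i * u * i⁻¹) ^ e) := by
  obtain ⟨g1, h1, g2, rfl, hx, hP, h2⟩ := h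
  rcases h2 with h2 | ⟨w, i', m0, hm0, hC, rfl⟩
  · have hi' := S.om_M h2 hi
    have e1 : g2 * (i * u * i⁻¹) ^ e = (g2 * i * u * (g2 * i)⁻¹) ^ e * g2 := by
      rw [conj_zpow, conj_zpow]; group
    by_cases hS : Sx u p W M (g1⁻¹ * x) (g2 * i)
    · exact ⟨g1, h1, _, by rw [mul_assoc], hx, hP, Or.inr ⟨_, _, g2, h2, Ch.one _ e hi' he hS, e1⟩⟩
    · have hxW : g1⁻¹ * x ∉ W := fun h => hS (Or.inl h)
      obtain ⟨i0, hi0, hax⟩ := hP.resolve_left hxW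
      have hs : Same u i0 (g2 * i) := by_contra fun h => hS (Or.inr ⟨i0, hi0, hax, h⟩)
      refine ⟨g1 * (g2 * i * u * (g2 * i)⁻¹) ^ e, mul_mem h1 (zpow_mem (om_mem hi') _), g2, ?_,
        fun h => absurd ?_ hxW, Or.inr ⟨i0, hi0, ?_⟩, Or.inl h2⟩
      · rw [mul_assoc g1 g2, e1, mul_assoc g1]
      · rw [hx h]; simpa using h
      · rw [mul_inv_rev, ← zpow_neg, mul_assoc, ← Ln.same_conj hs]
        exact H.ax_pow _ hax
  · have hi' := S.om_M hm0 hi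
    have e1 : m0 * (i * u * i⁻¹) ^ e = (m0 * i * u * (m0 * i)⁻¹) ^ e * m0 := by
      rw [conj_zpow, conj_zpow]; group
    by_cases hs : Same u i' (m0 * i)
    · have e2 : g1 * (w * m0) * (i * u * i⁻¹) ^ e = g1 * (w * (i' * u * i'⁻¹) ^ e * m0) := by
        rw [Ln.same_conj hs, mul_assoc w, ← e1]; group
      rw [e2]
      cases hC with
      | one i' j a1 a2 a3 =>
        rw [← zpow_add]
        by_cases hj : j + e = 0
        · exact ⟨g1, h1, _, rfl, hx, hP, Or.inl (by rw [hj]; simpa using hm0)⟩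
        · exact ⟨g1, h1, _, rfl, hx, hP, Or.inr ⟨_, _, m0, hm0, Ch.one _ _ a1 hj a3, rfl⟩⟩
      | cons w0 i0 i' j a1 a2 a3 a4 =>
        rw [mul_assoc w0, ← zpow_add]
        by_cases hj : j + e = 0
        · exact ⟨g1, h1, _, rfl, hx, hP, Or.inr ⟨_, _, m0, hm0, a1, by rw [hj]; simp⟩⟩
        · exact ⟨g1, h1, _, rfl, hx, hP, Or.inr ⟨_, _, m0, hm0, Ch.cons _ _ _ _ a1 a2 hj a4, rfl⟩⟩
    · refine ⟨g1, h1, _, by rw [mul_assoc], hx, hP,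
        Or.inr ⟨_, _, m0, hm0, Ch.cons _ _ _ e hC hi' he hs, ?_⟩⟩
      rw [mul_assoc w m0, e1, mul_assoc w]
lemma nf_all (S : St n m u p W M) (H : Ln k n m u p) {x g : FG k} (hx : Pc u p W M x)
    (hg : g ∈ Mx u p W M) : NF u p W M x g := by
  have key : ∀ g y : FG k, NF u p W M x g → y ∈ M → NF u p W M x (g * y) := by
    rintro g y ⟨g1, h1, g2, rfl, hx, hP, h2⟩ hy
    refine ⟨g1, h1, g2 * y, by rw [mul_assoc], hx, hP, ?_⟩
    rcases h2 with h2 | ⟨w, i', m0, hm0, hC, rfl⟩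
    · exact Or.inl (mul_mem h2 hy)
    · exact Or.inr ⟨w, i', m0 * y, mul_mem hm0 hy, hC, by rw [mul_assoc]⟩
  induction hg using Subgroup.closure_induction_right with
  | one => exact ⟨1, one_mem _, 1, by simp, fun _ => rfl, by simpa using hx, Or.inl (one_mem _)⟩
  | mul_right g hg y hy ih =>
    rcases hy with hy | ⟨i, hi, rfl⟩
    · exact key _ _ ih hy
    · simpa using S.nf_step H ih hi 1 (by simp)
  | mul_inv_cancel g hg y hy ih =>
    rcases hy with hy | ⟨i, hi, rfl⟩
    · exact key _ _ ih (inv_mem hy)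
    · simpa using S.nf_step H ih hi (-1) (by simp)
lemma wx_sub {x : FG k} (h : Pc u p W M x) : x ∈ Wx u p W M := ⟨1, one_mem _, by simpa using h⟩
lemma wx_inv {g x : FG k} (hg : g ∈ Mx u p W M) (h : x ∈ Wx u p W M) : g * x ∈ Wx u p W M := by
  obtain ⟨g', hg', h⟩ := h
  exact ⟨g * g', mul_mem hg hg', by convert h using 1; group⟩
lemma wx_conv (S : St n m u p W M) (H : Ln k n m u p) {x y z : FG k} (hx : x ∈ Wx u p W M)
    (hy : y ∈ Wx u p W M) (hz : bw x z y) : z ∈ Wx u p W M := by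
  let R : FG k → FG k → Prop := fun x y => ∀ z, bw x z y → z ∈ Wx u p W M
  have Rt : ∀ {x y z}, R x y → R y z → R x z := fun {x y z} h1 h2 c hc =>
    (bw_sub y hc).elim (h1 c) (h2 c)
  have Rs : ∀ {x y}, R x y → R y x := fun h c hc => h c (bw_symm hc)
  have Rl : ∀ {g x y}, g ∈ Mx u p W M → R x y → R (g * x) (g * y) := fun {g x y} hg h c hc => by
    have := wx_inv hg (h (g⁻¹ * c) (by rw [← bw_left (g := g)]; simpa using hc))
    simpa using this
  have RW : ∀ {x y}, x ∈ W → y ∈ W → R x y := fun hx hy c hc => wx_sub (Or.inl (S.conv _ _ _ hx hy hc))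
  have RP : ∀ {x}, Pc u p W M x → R 1 x := fun {x} hx => by
    rcases hx with hx | ⟨i, hi, hx⟩
    · exact RW S.one hx
    · obtain ⟨a, ha, ha'⟩ := hi.1
      exact Rt (RW S.one ha) fun c hc => wx_sub (Or.inr ⟨i, hi, H.ax_conv ha' hx hc⟩)
  have Rg : ∀ {g}, g ∈ Mx u p W M → R 1 g := fun {g} hg => by
    have key : ∀ y ∈ ((M : Set (FG k)) ∪ {h | ∃ i, Om u p W M i ∧ h = i * u * i⁻¹}), R 1 y := by
      rintro y (hy | ⟨i, hi, rfl⟩)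
      · exact RW S.one (by simpa using S.inv y hy 1 S.one)
      · obtain ⟨a, ha, ha'⟩ := hi.1
        refine Rt (RP (Or.inr ⟨i, hi, H.ax_pow 1 ha'⟩)) ?_
        have := Rl (om_mem hi) (RW ha S.one)
        simpa using this
    induction hg using Subgroup.closure_induction_right with
    | one => exact RW S.one S.one
    | mul_right g hg y hy ih => have := Rl hg (key y hy); rw [mul_one] at this; exact Rt ih this
    | mul_inv_cancel g hg y hy ih =>
      refine Rt ih (Rs ?_)
      have := Rl (mul_mem hg (inv_mem (Subgroup.subset_closure hy))) (key y hy)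
      simpa using this
  have fin : ∀ {x}, x ∈ Wx u p W M → R 1 x := fun {x} ⟨g, hg, h⟩ => by
    have := Rl hg (RP h)
    rw [mul_one, mul_inv_cancel_left] at this
    exact Rt (Rg hg) this
  exact Rt (Rs (fin hx)) (fin hy) z hz
lemma ax_wx (_S : St n m u p W M) {g c a : FG k} (hg : g ∈ Mx u p W M) (ha : a ∈ W)
    (hc : Ax p c (g * a)) : (∀ x, Ax p c x → x ∈ Wx u p W M) ∧ c * u * c⁻¹ ∈ Mx u p W M := by
  rw [Ln.ax_left'] at hc
  by_cases h : Om u p W M (g⁻¹ * c)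
  · refine ⟨fun x hx => ⟨g, hg, Or.inr ⟨_, h, Ln.ax_left.2 hx⟩⟩, ?_⟩
    have := mul_mem (mul_mem hg (om_mem h)) (inv_mem hg)
    convert this using 1; group
  · have h' : ((∀ x, Ax p (g⁻¹ * c) x → x ∈ W) ∧ g⁻¹ * c * u * (g⁻¹ * c)⁻¹ ∈ M) :=
      by_contra fun hh => h ⟨⟨a, ha, hc⟩, hh⟩
    refine ⟨fun x hx => ⟨g, hg, Or.inl (h'.1 _ (Ln.ax_left.2 hx))⟩, ?_⟩
    have := mul_mem (mul_mem hg (M_le h'.2)) (inv_mem hg)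
    convert this using 1; group
lemma step (S : St n m u p W M) (H : Ln k n m u p) : St n m u p (Wx u p W M) (Mx u p W M) where
  conv x y z hx hy hz := S.wx_conv H hx hy hz
  one := wx_sub (Or.inl S.one)
  inv g hg x hx := wx_inv hg hx
  b g hg hg1 := by
    obtain ⟨g1, -, g2, rfl, hx, hP, h⟩ := S.nf_all H (Or.inl S.one) hg
    obtain rfl := hx S.one
    rcases h with h | ⟨w, i, m0, hm0, hC, rfl⟩
    · exact S.b _ (by simpa using h) hg1
    · obtain ⟨a, b, h1, h2, h3⟩ := S.ch_end H (y := w * m0) hC (Or.inl (by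
        simpa using S.inv m0 hm0 1 S.one))
      simp only [inv_one, one_mul] at *
      exact ⟨a, b, w * i, h1, h2, h3⟩
  a c := by
    have hn := H.hn; have hm := H.hm
    by_cases hc : ∃ g ∈ Mx u p W M, ∃ a ∈ W, Ax p c (g * a)
    · obtain ⟨g, hg, a, ha, hc⟩ := hc
      exact Or.inl (S.ax_wx hg ha hc)
    refine Or.inr fun x y hx hy hxc hyc => by_contra fun hd => ?_
    have main : ∀ g i, g ∈ Mx u p W M → Om u p W M i → ¬ Same u c (g * i) := fun g i hg hi hs => by
      obtain ⟨a, ha, ha'⟩ := hi.1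
      exact hc ⟨g, hg, a, ha, H.same_ax hs (Ln.ax_left.2 ha')⟩
    have com : ∀ g i1 i2, g ∈ Mx u p W M → Om u p W M i1 → Om u p W M i2 → Ax p (g * i1) x →
        Ax p (g * i2) y → False := fun g i1 i2 hg h1 h2 hx1 hy2 => by
      obtain ⟨z, z1, z2⟩ := geo_exists x y m OM
      have hz : bw x z y := by unfold bw; omega
      have hzc := H.ax_conv hxc hyc hz
      obtain ⟨a, ha, ha'⟩ := h1.1
      obtain ⟨b, hb, hb'⟩ := h2.1
      rw [← Ln.ax_left (g := g)] at ha' hb'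
      rcases bw_sub (g * a) hz with h | h
      · exact main g i1 hg h1 (H.ax_sep hx1 (H.ax_conv hx1 ha' h) hxc hzc OM)
      · rcases bw_sub (g * b) h with h | h
        · refine hc ⟨g, hg, g⁻¹ * z, S.conv _ _ _ ha hb ?_, by simpa using hzc⟩
          rw [← bw_left (g := g)]; simpa using h
        · exact main g i2 hg h2 (H.ax_sep (H.ax_conv hb' hy2 h) hy2 hzc hyc OM)
    obtain ⟨gx, hgx, hx⟩ := hx
    obtain ⟨gy, hgy, hy⟩ := hy
    have nW : ∀ g z, g ∈ Mx u p W M → Ax p c z → g⁻¹ * z ∉ W := fun g z hg hz h =>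
      hc ⟨g, hg, _, h, by simpa using hz⟩
    obtain ⟨i', hi', hy⟩ := hy.resolve_left (nW _ _ hgy hyc)
    obtain ⟨g1, hg1, g2, he, -, hP, h⟩ := S.nf_all H hx (mul_mem (inv_mem hgx) hgy)
    have hgg : gx * g1 ∈ Mx u p W M := mul_mem hgx hg1
    have e0 : g1⁻¹ * (gx⁻¹ * x) = (gx * g1)⁻¹ * x := by group
    rw [e0] at hP h
    obtain ⟨i1, hi1, hx1⟩ := hP.resolve_left (nW _ _ hgg hxc)
    have hx1' := hx1
    rw [Ln.ax_left', inv_inv] at hx1'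
    have e1 : gy = gx * g1 * g2 := by rw [mul_assoc, ← he]; group
    rw [Ln.ax_left', inv_inv, e1] at hy
    rcases h with h | ⟨w, i, m0, hm0, hC, rfl⟩
    · rw [mul_assoc] at hy
      exact com _ _ _ hgg hi1 (S.om_M h hi') hx1' hy
    rw [← mul_assoc, mul_assoc, mul_assoc] at hy
    have hi'' := S.om_M hm0 hi'
    have fin : ∀ w i i'', Ch u p W M ((gx * g1)⁻¹ * x) w i → Om u p W M i'' → w ∈ Mx u p W M →
        Ax p (gx * g1 * (w * i'')) y → ¬ Same u i'' i → False := by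
      intro w i i'' hC hi'' hw hy hs
      have hSy : Sx u p W M (w⁻¹ * ((gx * g1)⁻¹ * y)) i := Or.inr ⟨i'', hi'', by
        rw [Ln.ax_left', Ln.ax_left', inv_inv, inv_inv]; exact hy, hs⟩
      obtain ⟨a, b, h1, h2, h3, h4, h5⟩ := S.ch_end H hC hSy
      rw [← bw_left (g := gx * g1)] at h3 h4
      rw [← Ln.ax_left (g := gx * g1)] at h1 h2
      simp only [mul_inv_cancel_left] at h3 h4
      have hd := td_left (gx * g1) a b
      have := H.ax_sep h1 h2 (H.ax_conv hxc hyc h3) (H.ax_conv hxc hyc h4) OM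
      rw [← mul_assoc] at this
      exact main _ i (mul_mem hgg hw) (ch_om hC) this
    have hwM : w ∈ Mx u p W M := by
      have := mul_mem (mul_mem (inv_mem hgg) hgy) (inv_mem (M_le hm0))
      convert this using 1; rw [e1]; group
    by_cases hs : Same u (m0 * i') i
    · have hs' := Ln.same_symm hs
      cases hC with
      | one i j a1 a2 a3 =>
        refine com _ _ _ hgg hi1 a1 hx1' (H.same_ax ?_ hy)
        obtain ⟨t, ht⟩ := hs'
        exact ⟨j + t, by rw [ht, conj_zpow]; group⟩
      | cons w0 i0 i j a1 a2 a3 a4 =>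
        refine fin w0 i0 i a1 a2 ?_ (H.same_ax ?_ hy) (fun h => a4 (Ln.same_symm h))
        · have := mul_mem hwM (inv_mem (zpow_mem (om_mem a2) j)); rwa [mul_inv_cancel_right] at this
        · obtain ⟨t, ht⟩ := hs'
          exact ⟨j + t, by rw [ht, conj_zpow]; group⟩
    · exact fin _ _ _ hC hi'' hwM hy hs
end St
lemma greendlinger {n m : ℕ} {u : FG k} {p : ℤ → FG k} (H : Ln k n m u p) {w : FG k}
    (hw : w ∈ Subgroup.normalClosure ({u} : Set (FG k))) (h1 : w ≠ 1) :
    ∃ y z h, Ax p h y ∧ Ax p h z ∧ bw 1 y w ∧ bw 1 z w ∧ n ≤ td y z + 8 * m := by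
  have ex : ∀ R : ℕ, ∃ W M, St n m u p W M ∧ (∀ x : FG k, x.norm ≤ R → x ∈ W) ∧
      ∀ g : FG k, g.norm < R → g * u * g⁻¹ ∈ M := by
    intro R
    induction R with
    | zero =>
      refine ⟨{1}, ⊥, ⟨?_, rfl, ?_, ?_, ?_⟩, ?_, fun g hg => absurd hg (by simp)⟩
      · rintro x y z rfl rfl h; simp [bw, td_self] at h; exact (td_zero.1 h.1).symm
      · rintro g hg x rfl; simpa using hg
      · refine fun g => Or.inr ?_; rintro x y rfl rfl - -; simp [td_self]
      · intro g hg h; simp at hg; exact absurd hg h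
      · intro x hx; simpa using hx
    | succ R ih =>
      obtain ⟨W, M, S, hW, hM⟩ := ih
      have key : ∀ c a, a ∈ W → Ax p c a →
          (∀ x, Ax p c x → x ∈ Wx u p W M) ∧ c * u * c⁻¹ ∈ Mx u p W M := fun c a ha hc =>
        S.ax_wx (one_mem _) ha (by simpa using hc)
      refine ⟨_, _, S.step H, fun x hx => ?_, fun g hg => ?_⟩
      · rcases Nat.lt_or_ge R x.norm with h | h
        · obtain ⟨z, z1, z2⟩ := geo_exists 1 x R (by rw [td_one_left]; omega)
          rw [td_one_left] at z1 z2
          obtain ⟨g, i, j, e1, e2⟩ := H.cov z x OM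
          exact (key g z (hW z OM) ⟨i, e1⟩).1 x ⟨j, e2⟩
        · exact St.wx_sub (Or.inl (hW x h))
      · exact (key g g (hW g OM) (H.ax_self g)).2
  have : ∃ R : ℕ, w ∈ Subgroup.closure {h | ∃ g : FG k, g.norm < R ∧ h = g * u * g⁻¹} := by
    have mono : ∀ {R R' : ℕ}, R ≤ R' →
        Subgroup.closure {h | ∃ g : FG k, g.norm < R ∧ h = g * u * g⁻¹} ≤
        Subgroup.closure {h | ∃ g : FG k, g.norm < R' ∧ h = g * u * g⁻¹} := fun hR =>
      Subgroup.closure_mono fun h ⟨g, h1, h2⟩ => ⟨g, OM, h2⟩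
    unfold Subgroup.normalClosure at hw
    induction hw using Subgroup.closure_induction with
    | mem x hx =>
      obtain ⟨_, rfl, hxc⟩ := Group.mem_conjugatesOfSet_iff.1 hx
      obtain ⟨c, rfl⟩ := isConj_iff.1 hxc
      exact ⟨c.norm + 1, Subgroup.subset_closure ⟨c, OM, rfl⟩⟩
    | one => exact ⟨0, one_mem _⟩
    | mul x y _ _ hx hy =>
      by_cases hx1 : x = 1
      · subst hx1; simp only [one_mul] at *; exact hy h1
      by_cases hy1 : y = 1
      · subst hy1; simp only [mul_one] at *; exact hx h1
      obtain ⟨R, hR⟩ := hx hx1; obtain ⟨R', hR'⟩ := hy hy1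
      exact ⟨max R R', mul_mem (mono (le_max_left _ _) hR) (mono (le_max_right _ _) hR')⟩
    | inv x _ hx => obtain ⟨R, hR⟩ := hx (by simpa using h1); exact ⟨R, inv_mem hR⟩
  obtain ⟨R, hR⟩ := this
  obtain ⟨W, M, S, -, hM⟩ := ex R
  refine S.b w ((Subgroup.closure_le M).2 ?_ hR) h1
  rintro _ ⟨g, hg, rfl⟩; exact hM g hg
def lt (a : Letter k) : FG k := mk [a]
lemma linv_linv (a : Letter k) : linv (linv a) = a := by simp [linv]
lemma linv_ne (a : Letter k) : linv a ≠ a := by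
  rcases a with ⟨a, s⟩; cases s <;> simp [linv]
lemma lt_inv (a : Letter k) : (lt a)⁻¹ = lt (linv a) := by
  simp [lt, inv_mk, invRev, linv]
lemma lt_toWord (a : Letter k) : (lt a).toWord = [a] := by simp [lt, toWord_mk]
lemma lt_inj {a b : Letter k} (h : lt a = lt b) : a = b := by
  have := congrArg FreeGroup.toWord h; simpa [lt_toWord] using this
lemma lt_norm (a : Letter k) : (lt a).norm = 1 := by rw [FreeGroup.norm, lt_toWord]; rfl
lemma td_lt (x : FG k) (a : Letter k) : td x (x * lt a) = 1 := by
  rw [td, inv_mul_cancel_left, lt_norm]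
lemma td_one {x y : FG k} (h : td x y = 1) : ∃ a, y = x * lt a := by
  obtain ⟨a, ha⟩ := List.length_eq_one_iff.1 (show (x⁻¹ * y).toWord.length = 1 from h)
  exact ⟨a, by rw [lt, ← ha, mk_toWord]; group⟩
lemma isReduced_of_cyc {u : LW k} (hu : CyclicallyReducedWord u) :
    FreeGroup.IsReduced u :=
  (isReduced_append.1 (isReduced_iff_reduce_eq.2 hu)).1
def uu (hk : 0 < k) (u : LW k) (i : ℤ) : Letter k :=
  u.getD (i % u.length).toNat (⟨0, hk⟩, true)
def pp (u : LW k) (i : ℤ) : FG k :=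
  mk u ^ (i / u.length) * mk (u.take (i % u.length).toNat)
def win (hk : 0 < k) (u : LW k) (i : ℤ) (L : ℕ) : LW k :=
  (List.range L).map fun t => uu hk u (i + t)
section
variable {hk : 0 < k} {u : LW k}
lemma uu_per (i t : ℤ) : uu hk u (i + u.length * t) = uu hk u i := by
  simp [uu]
lemma uu_nat {t : ℕ} (h : t < u.length) : uu hk u t = u[t] := by
  have : ((t : ℤ) % u.length).toNat = t := by
    rw [Int.emod_eq_of_lt OM OM]; simp
  simp [uu, this, h]
lemma pp_per (h : u ≠ []) (i : ℤ) : pp u (i + u.length) = mk u * pp u i := by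
  have : (u.length : ℤ) ≠ 0 := by simpa using h
  simp only [pp, Int.add_emod_right]
  rw [Int.add_ediv_of_dvd_right (dvd_refl _), Int.ediv_self this, zpow_add, zpow_one,
    (Commute.zpow_self _ _).eq, mul_assoc]
lemma pp_succ (h : u ≠ []) (i : ℤ) : pp u (i + 1) = pp u i * lt (uu hk u i) := by
  have hn : (0 : ℤ) < u.length := by exact_mod_cast length_pos_iff.2 h
  have h0 := Int.emod_nonneg i hn.ne'
  have h1 := Int.emod_lt_of_pos i hn
  have hd := Int.mul_ediv_add_emod i u.length
  have hlen : (i % u.length).toNat < u.length := OM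
  have e1 : mk (u.take (i % u.length).toNat) * lt (uu hk u i) =
      mk (u.take ((i % u.length).toNat + 1)) := by
    rw [lt, mul_mk, List.take_add_one]
    simp [uu, hlen]
  rcases (Int.add_one_le_iff.2 h1).lt_or_eq with h2 | h2
  · have e2 : (i + 1) % u.length = i % u.length + 1 := by
      rw [Int.add_emod, Int.emod_eq_of_lt (a := 1) OM OM,
        Int.emod_eq_of_lt OM h2]
    have e3 : (i + 1) / u.length = i / u.length := by
      have := Int.mul_ediv_add_emod (i + 1) u.length
      have h3 : (u.length : ℤ) * ((i + 1) / u.length) = u.length * (i / u.length) := OM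
      exact mul_left_cancel₀ hn.ne' h3
    rw [pp, pp, mul_assoc, e1, e2, e3]
    congr 3; omega
  · have e4 : i + 1 = u.length * (i / u.length + 1) := by rw [mul_add, mul_one]; omega
    have e3 : (i + 1) / u.length = i / u.length + 1 := by
      rw [e4, Int.mul_ediv_cancel_left _ hn.ne']
    have e2 : (i + 1) % u.length = 0 := by rw [e4]; simp
    have e5 : u.take ((i % u.length).toNat + 1) = u := List.take_of_length_le OM
    rw [pp, pp, mul_assoc, e1, e2, e3, e5, zpow_add, zpow_one]
    simp [← one_eq_mk]
lemma pp_zero : pp u 0 = 1 := by simp [pp, ← one_eq_mk]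
lemma win_succ (i : ℤ) (L : ℕ) : win hk u i (L + 1) = win hk u i L ++ [uu hk u (i + L)] := by
  simp [win, range_succ]
lemma pp_win (h : u ≠ []) (i : ℤ) (L : ℕ) :
    pp u (i + L) = pp u i * mk (win hk u i L) := by
  induction L with
  | zero => simp [win, ← one_eq_mk]
  | succ L ih =>
    rw [win_succ, ← mul_mk, ← mul_assoc, ← ih]
    push_cast
    rw [← add_assoc, pp_succ (hk := hk) h]; rfl
lemma uu_succ_ne (h : u ≠ []) (hu : CyclicallyReducedWord u) (i : ℤ) :
    uu hk u (i + 1) ≠ linv (uu hk u i) := by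
  have hn : (0 : ℤ) < u.length := by exact_mod_cast length_pos_iff.2 h
  have h0 := Int.emod_nonneg i hn.ne'
  have h1 := Int.emod_lt_of_pos i hn
  have hr := isReduced_iff_reduce_eq.2 hu
  have e : ∀ t : ℕ, t < u.length + u.length → (u ++ u)[t]? = some (uu hk u t) := by
    intro t ht
    rcases Nat.lt_or_ge t u.length with h' | h'
    · rw [List.getElem?_append_left h', uu_nat h', List.getElem?_eq_getElem h']
    · rw [List.getElem?_append_right h', List.getElem?_eq_getElem OM,
        ← uu_nat (hk := hk) OM, ← uu_per _ 1]
      congr 2; push_cast [h']; ring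
  have hi := e (i % u.length).toNat OM
  have hi' := e ((i % u.length).toNat + 1) OM
  have hd := Int.mul_ediv_add_emod i u.length
  have e1 : uu hk u i = uu hk u ((i % u.length).toNat : ℕ) := by
    rw [← uu_per ((i % u.length).toNat : ℕ) (i / u.length)]; congr 1; omega
  have e2 : uu hk u (i + 1) = uu hk u (((i % u.length).toNat + 1 : ℕ) : ℤ) := by
    rw [← uu_per (((i % u.length).toNat + 1 : ℕ) : ℤ) (i / u.length)]; congr 1; push_cast; omega
  rw [e1, e2]
  set t := (i % u.length).toNat
  rw [← take_append_drop (t + 1) (u ++ u), isReduced_append] at hr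
  refine hr.2.2 _ ?_ _ ?_
  · rw [List.getLast?_take]; simp [hi]
  · rw [List.head?_drop]; simp [hi']
lemma win_reduced (h : u ≠ []) (hu : CyclicallyReducedWord u) (i : ℤ) (L : ℕ) :
    FreeGroup.IsReduced (win hk u i L) := by
  induction L with
  | zero => simp [win]
  | succ L ih =>
    rw [win_succ, isReduced_append]
    refine ⟨ih, by simp, ?_⟩
    intro x hx y hy
    simp at hy; subst hy
    rcases L with _ | L
    · simp [win] at hx
    · rw [win_succ] at hx; simp at hx; subst hx
      push_cast; rw [← add_assoc]; exact uu_succ_ne h hu _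
lemma pp_dist (h : u ≠ []) (hu : CyclicallyReducedWord u) (hk : 0 < k) (i j : ℤ) :
    td (pp u i) (pp u j) = (i - j).natAbs := by
  have key : ∀ i (L : ℕ), td (pp u i) (pp u (i + L)) = L := fun i L => by
    rw [pp_win (hk := hk) h, td, inv_mul_cancel_left, norm_mk (win_reduced h hu _ _)]; simp [win]
  rcases le_total i j with hij | hij
  · have := key i (j - i).toNat
    rw [show i + ((j - i).toNat : ℤ) = j by omega] at this; omega
  · have := key j (i - j).toNat
    rw [show j + ((i - j).toNat : ℤ) = i by omega, td_comm] at this; omega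
def P1 (hk : 0 < k) (m : ℕ) (u : LW k) : Prop :=
  (∀ i j : ℤ, (∀ t : ℕ, t < m → uu hk u (i + t) = uu hk u (j + t)) → (u.length : ℤ) ∣ i - j) ∧
  (∀ i j : ℤ, ¬ ∀ t : ℕ, t < m → uu hk u (i + t) = linv (uu hk u (j - t)))
lemma ln_of (h : u ≠ []) (hu : CyclicallyReducedWord u) {m : ℕ} (hP : P1 hk m u) (hm : 1 ≤ m)
    (hn : 20 * m ≤ u.length) (hc : ∀ a : Letter k, ∃ i, uu hk u i = a ∨ uu hk u i = linv a) :
    Ln k u.length m (mk u) (pp u) where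
  dist := pp_dist h hu hk
  per := pp_per h
  p0 := pp_zero
  hn := hn
  hm := hm
  cov x y hxy := by
    obtain ⟨a, rfl⟩ := td_one hxy
    obtain ⟨i, rfl | hi⟩ := hc a
    · exact ⟨x * (pp u i)⁻¹, i, i + 1, by group, by rw [pp_succ (hk := hk) h]; group⟩
    · refine ⟨x * (pp u (i + 1))⁻¹, i + 1, i, by group, ?_⟩
      rw [pp_succ (hk := hk) h, hi, ← lt_inv]; group
  sep := by
    have D := pp_dist h hu hk
    have key : ∀ (g : FG k) (i j i' j' : ℤ), g * pp u i = pp u j → g * pp u i' = pp u j' →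
        i + m ≤ i' → ∃ t : ℤ, g = mk u ^ t := by
      intro g i j i' j' h1 h2 h3
      have hd := D j j'
      rw [← h1, ← h2, td_left, D] at hd
      have lt' : ∀ a, lt (uu hk u a) = (pp u a)⁻¹ * pp u (a + 1) := fun a => by
        rw [pp_succ (hk := hk) h]; group
      rcases le_total j j' with hj | hj
      · have e : ∀ t : ℕ, t ≤ m → g * pp u (i + t) = pp u (j + t) := fun t ht => by
          refine geo_unique (x := pp u j) (y := pp u j') ?_ ?_ ?_
          all_goals (try rw [← h1]); (try rw [← h2]); (try simp only [td_left, D])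
          · omega
          · rw [h1, h2]; simp only [D]; omega
          · rw [h1]; simp only [D]; omega
        obtain ⟨s, hs⟩ := hP.1 i j fun t ht => by
          apply lt_inj
          have e1 := e t ht.le; have e2 := e (t + 1) ht
          push_cast at e2; rw [← add_assoc, ← add_assoc] at e2
          rw [lt', lt', ← e1, ← e2]; group
        refine ⟨-s, ?_⟩
        have : pp u j = mk u ^ (-s) * pp u i := by
          have hz : ∀ (t i : ℤ), pp u (i + u.length * t) = mk u ^ t * pp u i := by
            intro t i
            have hn0 : (u.length : ℤ) ≠ 0 := by simpa using h
            simp only [pp, Int.add_mul_emod_self_left, Int.add_mul_ediv_left _ _ hn0]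
            rw [add_comm, zpow_add, mul_assoc]
          rw [← hz]; congr 1; rw [mul_neg, ← hs]; ring
        rw [this] at h1; exact mul_right_cancel h1
      · exfalso
        have e : ∀ t : ℕ, t ≤ m → g * pp u (i + t) = pp u (j - t) := fun t ht => by
          refine geo_unique (x := pp u j) (y := pp u j') ?_ ?_ ?_
          all_goals (try rw [← h1]); (try rw [← h2]); (try simp only [td_left, D])
          · omega
          · rw [h1, h2]; simp only [D]; omega
          · rw [h1]; simp only [D]; omega
        refine hP.2 i (j - 1) fun t ht => lt_inj ?_
        have e1 := e t ht.le; have e2 := e (t + 1) ht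
        push_cast at e2; rw [← add_assoc] at e2
        rw [← lt_inv, lt', lt', show j - 1 - (t : ℤ) + 1 = j - t by ring,
          show j - 1 - (t : ℤ) = j - (t + 1) by ring, ← e1, ← e2]; group
    intro g i j i' j' h1 h2 h3
    rcases le_total i i' with hi | hi
    · exact key g i j i' j' h1 h2 OM
    · exact key g i' j' i j h2 h1 OM
end
abbrev Ed (k : ℕ) (Q : Type) := ℕ × Fin k × ℕ × Q
def Stp {Q : Type} [Group Q] (E : Finset (Ed k Q)) (x : ℕ) (a : Letter k) (y : ℕ) (μ : Q) :
    Prop := if a.2 then (x, a.1, y, μ) ∈ E else (y, a.1, x, μ⁻¹) ∈ E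
inductive Pth {Q : Type} [Group Q] (E : Finset (Ed k Q)) :
    ℕ → LW k → ℕ → Q → Prop
  | nil (x : ℕ) : Pth E x [] x 1
  | cons {x y z : ℕ} {a : Letter k} {w : LW k} {μ ν : Q} :
      Stp E x a y μ → Pth E y w z ν → Pth E x (a :: w) z (μ * ν)
section
variable {Q : Type} [Group Q] {E E' : Finset (Ed k Q)}
lemma Stp.rev {x y : ℕ} {a : Letter k} {μ : Q} (h : Stp E x a y μ) :
    Stp E y (linv a) x μ⁻¹ := by
  rcases a with ⟨a, s⟩; cases s <;> simpa [Stp, linv] using h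
lemma Stp.mono {x y : ℕ} {a : Letter k} {μ : Q} (hE : E ⊆ E') (h : Stp E x a y μ) :
    Stp E' x a y μ := by
  unfold Stp at *; split_ifs at * <;> exact hE h
lemma Stp.of_edge {s t : ℕ} {i : Fin k} {m : Q} (h : (s, i, t, m) ∈ E) : Stp E s (i, true) t m := by
  simpa [Stp] using h
lemma Pth.single {x y : ℕ} {a : Letter k} {μ : Q} (h : Stp E x a y μ) : Pth E x [a] y μ := by
  have := Pth.cons h (Pth.nil y); rwa [mul_one] at this
lemma Pth.append {x y z : ℕ} {w v : LW k} {μ ν : Q} (h : Pth E x w y μ)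
    (h' : Pth E y v z ν) : Pth E x (w ++ v) z (μ * ν) := by
  induction h with
  | nil x => simpa using h'
  | cons s _ ih => rw [mul_assoc]; exact Pth.cons s (ih h')
lemma Pth.rev {x y : ℕ} {w : LW k} {μ : Q} (h : Pth E x w y μ) :
    ∃ w', Pth E y w' x μ⁻¹ := by
  induction h with
  | nil x => exact ⟨[], by simpa using Pth.nil x⟩
  | cons s _ ih =>
    obtain ⟨w', h'⟩ := ih
    exact ⟨_, by rw [mul_inv_rev]; exact h'.append (Pth.single s.rev)⟩
lemma Pth.mono {x y : ℕ} {w : LW k} {μ : Q} (hE : E ⊆ E') (h : Pth E x w y μ) :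
    Pth E' x w y μ := by
  induction h with
  | nil x => exact Pth.nil x
  | cons s _ ih => exact Pth.cons (s.mono hE) ih
lemma Pth.sim {f : ℕ → ℕ} {c : ℕ → Q}
    (hs : ∀ s i t m, (s, i, t, m) ∈ E → ∃ w, Pth E' (f s) w (f t) (c s * m * (c t)⁻¹))
    {x y : ℕ} {w : LW k} {μ : Q} (h : Pth E x w y μ) :
    ∃ w', Pth E' (f x) w' (f y) (c x * μ * (c y)⁻¹) := by
  induction h with
  | nil x => exact ⟨[], by simpa using Pth.nil (f x)⟩
  | @cons x y z a w μ ν s _ ih =>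
    obtain ⟨w', h'⟩ := ih
    have : ∃ v, Pth E' (f x) v (f y) (c x * μ * (c y)⁻¹) := by
      rcases a with ⟨a, s'⟩
      cases s'
      · obtain ⟨v, hv⟩ := hs y a x μ⁻¹ (by simpa [Stp] using s)
        obtain ⟨v', hv'⟩ := hv.rev
        exact ⟨v', by convert hv' using 1; group⟩
      · exact hs x a y μ (by simpa [Stp] using s)
    obtain ⟨v, hv⟩ := this
    exact ⟨v ++ w', by convert hv.append h' using 1; group⟩
end
structure Lab {Q : Type} [Group Q] {u : FG k} (q : Q →* OneRel k u) (E : Finset (Ed k Q))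
    (V : Finset ℕ) : Prop where
  ends : ∀ s i t m, (s, i, t, m) ∈ E → s ∈ V ∧ t ∈ V
  lab : ∀ s i t m, (s, i, t, m) ∈ E → q m = QuotientGroup.mk (of i)
structure Valid {Q : Type} [Group Q] {u : FG k} (q : Q →* OneRel k u) (r : ℕ)
    (E : Finset (Ed k Q)) (V : Finset ℕ) : Prop extends Lab q E V where
  ne : V.Nonempty
  conn : ∀ x ∈ V, ∀ y ∈ V, ∀ g : Q, ∃ w, Pth E x w y g
  card : E.card + 1 ≤ V.card + r
section
variable {Q : Type} [Group Q] {u : FG k} {q : Q →* OneRel k u} {E E' : Finset (Ed k Q)}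
  {V : Finset ℕ}
lemma Lab.stp (h : Lab q E V) {x y : ℕ} {a : Letter k} {μ : Q} (s : Stp E x a y μ) :
    x ∈ V ∧ y ∈ V ∧ q μ = QuotientGroup.mk (lt a) := by
  rcases a with ⟨a, s'⟩
  cases s'
  · simp [Stp] at s
    have h2 := h.lab _ _ _ _ s
    refine ⟨(h.ends _ _ _ _ s).2, (h.ends _ _ _ _ s).1, ?_⟩
    rw [map_inv, inv_eq_iff_eq_inv] at h2
    rw [h2, ← QuotientGroup.mk_inv]; rfl
  · simp [Stp] at s
    exact ⟨(h.ends _ _ _ _ s).1, (h.ends _ _ _ _ s).2, h.lab _ _ _ _ s⟩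
lemma Lab.pth (h : Lab q E V) {x y : ℕ} {w : LW k} {μ : Q} (s : Pth E x w y μ) :
    q μ = QuotientGroup.mk (FreeGroup.mk w) := by
  induction s with
  | nil x => rw [← one_eq_mk]; simp
  | @cons x y z a w μ ν s _ ih =>
    rw [map_mul, ih, (h.stp s).2.2, ← QuotientGroup.mk_mul, lt, mul_mk]; rfl
lemma conn_of_base {E : Finset (Ed k Q)} {V : Finset ℕ} {V0 : Finset ℕ} {x0 : ℕ}
    (h0 : ∀ x ∈ V0, ∀ g : Q, ∃ w, Pth E x w x0 g)
    (h : ∀ v ∈ V, ∃ v0 ∈ V0, ∃ w μ, Pth E v w v0 μ) :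
    ∀ x ∈ V, ∀ y ∈ V, ∀ g : Q, ∃ w, Pth E x w y g := by
  intro x hx y hy g
  obtain ⟨x1, hx1, w1, μ1, p1⟩ := h x hx
  obtain ⟨y1, hy1, w2, μ2, p2⟩ := h y hy
  obtain ⟨w3, p3⟩ := h0 x1 hx1 (μ1⁻¹ * g * μ2)
  obtain ⟨w4, p4⟩ := h0 y1 hy1 1
  obtain ⟨w5, p5⟩ := (p2.append p4).rev
  exact ⟨_, by convert (p1.append p3).append p5 using 1; group⟩
lemma add_arc [DecidableEq Q] (hq : Function.Surjective q) (w : LW k) (hw : w ≠ []) :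
    ∀ (E : Finset (Ed k Q)) (V : Finset ℕ), Lab q E V → ∀ x ∈ V, ∀ y ∈ V, ∀ μ : Q,
    q μ = QuotientGroup.mk (mk w) → ∃ E' V', Lab q E' V' ∧ E ⊆ E' ∧ V ⊆ V' ∧
      E'.card ≤ E.card + w.length ∧ V.card + w.length ≤ V'.card + 1 ∧ Pth E' x w y μ ∧
      ∀ v ∈ V', ∃ v0 ∈ V, ∃ w μ, Pth E' v w v0 μ := by
  have one : ∀ (E : Finset (Ed k Q)) (V : Finset ℕ), Lab q E V → ∀ x ∈ V, ∀ y, ∀ (a : Letter k)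
      (μ : Q), q μ = QuotientGroup.mk (lt a) → ∃ E', Lab q E' (insert y V) ∧ E ⊆ E' ∧
        E'.card ≤ E.card + 1 ∧ Stp E' x a y μ := by
    intro E V hL x hx y a μ hμ
    rcases a with ⟨a, s⟩
    cases s
    · refine ⟨insert (y, a, x, μ⁻¹) E, ⟨?_, ?_⟩, subset_insert _ _,
        card_insert_le _ _, by simp [Stp]⟩
      · intro s i t m h
        simp only [mem_insert, Prod.mk.injEq] at h ⊢
        rcases h with ⟨rfl, rfl, rfl, rfl⟩ | h
        · simp [hx]
        · simp [hL.ends _ _ _ _ h]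
      · intro s i t m h
        simp only [mem_insert, Prod.mk.injEq] at h ⊢
        rcases h with ⟨rfl, rfl, rfl, rfl⟩ | h
        · rw [map_inv, hμ, ← QuotientGroup.mk_inv, lt_inv]; rfl
        · exact hL.lab _ _ _ _ h
    · refine ⟨insert (x, a, y, μ) E, ⟨?_, ?_⟩, subset_insert _ _,
        card_insert_le _ _, by simp [Stp]⟩
      · intro s i t m h
        simp only [mem_insert, Prod.mk.injEq] at h ⊢
        rcases h with ⟨rfl, rfl, rfl, rfl⟩ | h
        · simp [hx]
        · simp [hL.ends _ _ _ _ h]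
      · intro s i t m h
        simp only [mem_insert, Prod.mk.injEq] at h ⊢
        rcases h with ⟨rfl, rfl, rfl, rfl⟩ | h
        · exact hμ
        · exact hL.lab _ _ _ _ h
  induction w with
  | nil => exact absurd rfl hw
  | cons a w ih =>
    intro E V hL x hx y hy μ hμ
    rcases w with _ | ⟨b, w⟩
    · obtain ⟨E', h1, h2, h3, h4⟩ := one E V hL x hx y a μ hμ
      rw [Finset.insert_eq_of_mem hy] at h1
      exact ⟨E', V, h1, h2, subset_rfl, h3, by simp, Pth.single h4,
        fun v hv => ⟨v, hv, [], 1, Pth.nil v⟩⟩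
    · obtain ⟨z, hz⟩ := Infinite.exists_notMem_finset V
      obtain ⟨l, hl⟩ := hq (QuotientGroup.mk (lt a))
      obtain ⟨E1, h1, h2, h3, h4⟩ := one E V hL x hx z a l hl
      obtain ⟨E', V', g1, g2, g3, g4, g5, g6, g7⟩ := ih (by simp) E1 (insert z V) h1 z (by simp) y
        (by simp [hy]) (l⁻¹ * μ) (by
          rw [map_mul, map_inv, hl, hμ, ← QuotientGroup.mk_inv, ← QuotientGroup.mk_mul,
            inv_mul_eq_iff_eq_mul.2]
          rw [lt, mul_mk]; rfl)
      rw [card_insert_of_notMem hz] at g5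
      refine ⟨E', V', g1, h2.trans g2, (subset_insert _ _).trans g3, ?_, ?_, ?_, ?_⟩
      · simp only [length_cons] at *; omega
      · simp only [length_cons] at *; omega
      · have := Pth.cons (h4.mono g2) g6
        rwa [mul_inv_cancel_left] at this
      · intro v hv
        obtain ⟨v0, hv0, w1, μ1, p1⟩ := g7 v hv
        rcases mem_insert.1 hv0 with rfl | hv0
        · exact ⟨x, hx, _, _, p1.append (Pth.single (h4.mono g2).rev)⟩
        · exact ⟨v0, hv0, _, _, p1⟩
lemma Valid.transfer {r : ℕ} {V0 V' : Finset ℕ} (hV : Valid q r E V) {f : ℕ → ℕ} {c : ℕ → Q}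
    (hL : Lab q E' V') (hne : V0.Nonempty) (hsub : V0 ⊆ V')
    (hs : ∀ s i t m, (s, i, t, m) ∈ E → ∃ w, Pth E' (f s) w (f t) (c s * m * (c t)⁻¹))
    (hf : ∀ v ∈ V0, v ∈ V ∧ f v = v)
    (h : ∀ v ∈ V', ∃ v0 ∈ V0, ∃ w μ, Pth E' v w v0 μ)
    (hc : E'.card + 1 ≤ V'.card + r) : Valid q r E' V' := by
  obtain ⟨x0, hx0⟩ := hne
  refine { toLab := hL, ne := ⟨x0, hsub hx0⟩, card := hc, conn := conn_of_base (x0 := x0) ?_ h }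
  intro x hx g
  obtain ⟨w, hw⟩ := hV.conn x (hf x hx).1 x0 (hf x0 hx0).1 ((c x)⁻¹ * g * c x0)
  obtain ⟨w', hw'⟩ := hw.sim hs
  rw [(hf x hx).2, (hf x0 hx0).2] at hw'
  exact ⟨w', by convert hw' using 1; group⟩
end
open Classical in
noncomputable def lv {Q : Type} [Group Q] (E : Finset (Ed k Q)) (v : ℕ) :
    Finset (Letter k) := univ.filter fun b => ∃ y μ, Stp E v b y μ
section
variable {Q : Type} [Group Q] {u : FG k} {q : Q →* OneRel k u} {E E' : Finset (Ed k Q)}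
  {V : Finset ℕ} {r : ℕ}
lemma mem_lv {v : ℕ} {b : Letter k} : b ∈ lv E v ↔ ∃ y μ, Stp E v b y μ := by
  simp [lv]
structure MinG (q : Q →* OneRel k u) (r : ℕ) (E : Finset (Ed k Q)) (V : Finset ℕ) : Prop
    extends Valid q r E V where
  min : ∀ E' V', Valid q r E' V' → E.card ≤ E'.card
  nd : ∀ s i t m m', (s, i, t, m) ∈ E → (s, i, t, m') ∈ E → m = m'
  hq : Function.Surjective q
  hone : ∀ a : Letter k, (QuotientGroup.mk (lt a) : OneRel k u) ≠ 1
  hk : 2 ≤ k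
  hr : r ≤ k
lemma MinG.glue (H : MinG q r E V) {y1 y2 : ℕ} (h1 : y1 ∈ V) (h2 : y2 ∈ V) (hy : y1 ≠ y2)
    {c0 : Q} (hc : q c0 = 1) (e1 e2 : Ed k Q) (he1 : e1 ∈ E) (he2 : e2 ∈ E) (he : e1 ≠ e2)
    (hee : ∀ f : ℕ → ℕ, ∀ c : ℕ → Q, (∀ v, f v = if v = y2 then y1 else v) →
      (∀ v, c v = if v = y2 then c0 else 1) →
      (f e1.1, e1.2.1, f e1.2.2.1, c e1.1 * e1.2.2.2 * (c e1.2.2.1)⁻¹) =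
      (f e2.1, e2.2.1, f e2.2.2.1, c e2.1 * e2.2.2.2 * (c e2.2.2.1)⁻¹)) : False := by
  classical
  set f : ℕ → ℕ := fun v => if v = y2 then y1 else v with hf
  set c : ℕ → Q := fun v => if v = y2 then c0 else 1 with hcc
  have hee := hee f c (fun v => rfl) (fun v => rfl)
  set F : Ed k Q → Ed k Q := fun e => (f e.1, e.2.1, f e.2.2.1, c e.1 * e.2.2.2 * (c e.2.2.1)⁻¹)
    with hF
  have hcard : (E.image F).card < E.card := by
    refine lt_of_le_of_ne card_image_le fun h => he ?_
    exact card_image_iff.1 h he1 he2 hee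
  have hqc : ∀ v, q (c v) = 1 := by
    intro v; simp only [hcc]; split_ifs <;> simp [hc]
  have hfV : ∀ v ∈ V, f v ∈ V.erase y2 := by
    intro v hv
    simp only [hf]; split_ifs with h
    · simp [hy, h1]
    · simp [h, hv]
  have hV := card_erase_of_mem h2
  have hpos : 0 < V.card := card_pos.2 ⟨_, h2⟩
  have hv : Valid q r (E.image F) (V.erase y2) := by
    refine H.toValid.transfer (V0 := V.erase y2) (f := f) (c := c) ⟨?_, ?_⟩ ⟨y1, by simp [hy, h1]⟩
      subset_rfl ?_ ?_ ?_ ?_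
    · intro s i t m h
      obtain ⟨e, he, hee⟩ := mem_image.1 h
      obtain ⟨s', i', t', m'⟩ := e
      simp only [hF, Prod.mk.injEq] at hee
      obtain ⟨rfl, rfl, rfl, rfl⟩ := hee
      exact ⟨hfV _ (H.ends _ _ _ _ he).1, hfV _ (H.ends _ _ _ _ he).2⟩
    · intro s i t m h
      obtain ⟨e, he, hee⟩ := mem_image.1 h
      obtain ⟨s', i', t', m'⟩ := e
      simp only [hF, Prod.mk.injEq] at hee
      obtain ⟨rfl, rfl, rfl, rfl⟩ := hee
      simp [hqc, H.lab _ _ _ _ he]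
    · intro s i t m h
      exact ⟨_, Pth.single (Stp.of_edge (mem_image_of_mem F h))⟩
    · intro v hv
      simp only [mem_erase] at hv
      exact ⟨hv.2, by simp [hf, hv.1]⟩
    · intro v hv
      exact ⟨v, hv, [], 1, Pth.nil v⟩
    · have := H.card; omega
  have := H.min _ _ hv
  omega
lemma MinG.det (H : MinG q r E V) {x y y' : ℕ} {a : Letter k} {μ μ' : Q} (h : Stp E x a y μ)
    (h' : Stp E x a y' μ') : y = y' ∧ μ = μ' := by
  have hy : y = y' := by
    by_contra hne
    have hqq := (H.stp h).2.2.trans (H.stp h').2.2.symm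
    have hy := (H.stp h).2.1
    have hy' := (H.stp h').2.1
    rcases a with ⟨a, s⟩
    cases s
    · simp only [Stp, Bool.false_eq_true, if_false] at h h'
      refine H.glue (c0 := μ⁻¹ * μ') hy hy' hne ?_ _ _ h h' (by simp [hne]) ?_
      · simp [hqq]
      · intro f c hf hc
        simp only [hf, hc, Prod.mk.injEq]
        simp [hne]
    · simp only [Stp, if_true] at h h'
      refine H.glue (c0 := μ⁻¹ * μ') hy hy' hne ?_ _ _ h h' (by simp [hne]) ?_
      · simp [hqq]
      · intro f c hf hc
        simp only [hf, hc, Prod.mk.injEq]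
        simp [hne, mul_assoc]
  subst hy
  refine ⟨rfl, ?_⟩
  rcases a with ⟨a, s⟩
  cases s
  · simp only [Stp, Bool.false_eq_true, if_false] at h h'
    simpa using H.nd _ _ _ _ _ h h'
  · simp only [Stp, if_true] at h h'
    exact H.nd _ _ _ _ _ h h'
lemma linv_ne' (a : Letter k) : linv a ≠ a := by
  rcases a with ⟨a, s⟩; cases s <;> simp [linv]
lemma MinG.deg2 (H : MinG q r E V) {v : ℕ} (hv : v ∈ V) : 2 ≤ (lv E v).card := by
  classical
  by_contra hlt
  have h01 : (lv E v).card = 0 ∨ (lv E v).card = 1 := OM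
  rcases h01 with h0 | h0
  · obtain ⟨g, hg⟩ := H.hq (QuotientGroup.mk (lt ((⟨0, by have := H.hk; omega⟩ : Fin k), true)))
    obtain ⟨w, hw⟩ := H.conn v hv v hv g
    rw [Finset.card_eq_zero] at h0
    cases hw with
    | nil =>
      rw [map_one] at hg
      exact H.hone _ hg.symm
    | cons s p =>
      have := mem_lv.2 ⟨_, _, s⟩
      rw [h0] at this; simp at this
  · obtain ⟨b, hb⟩ := card_eq_one.1 h0
    have huniq : ∀ b' y μ, Stp E v b' y μ → b' = b := by
      intro b' y μ h
      have := mem_lv.2 ⟨_, _, h⟩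
      rw [hb] at this; simpa using this
    obtain ⟨s, μ, hs⟩ := mem_lv.1 (hb ▸ Finset.mem_singleton_self b : b ∈ lv E v)
    have hsv : s ≠ v := by
      rintro rfl
      exact linv_ne' b (huniq _ _ _ hs.rev)
    have hsV := (H.stp hs).2.1
    obtain ⟨e, he, hee, hst⟩ : ∃ e ∈ E, (∀ e' ∈ E, e' ≠ e → e'.1 ≠ v ∧ e'.2.2.1 ≠ v) ∧
        ((e = (v, b.1, s, μ)) ∨ e = (s, b.1, v, μ⁻¹)) := by
      rcases b with ⟨b, sg⟩
      have key : ∀ e' ∈ E, (e'.1 = v → sg = true ∧ e' = (v, b, s, μ)) ∧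
          (e'.2.2.1 = v → sg = false ∧ e' = (s, b, v, μ⁻¹)) := by
        rintro ⟨s', i', t', m'⟩ he'
        have h1 := Stp.of_edge he'
        constructor
        · rintro rfl
          have h2 := huniq _ _ _ h1
          simp only [Prod.mk.injEq] at h2
          obtain ⟨rfl, rfl⟩ := h2
          obtain ⟨rfl, rfl⟩ := H.det hs h1
          simp
        · rintro rfl
          have h2 := huniq _ _ _ h1.rev
          simp only [Prod.mk.injEq, linv] at h2
          obtain ⟨rfl, rfl⟩ := h2
          obtain ⟨rfl, rfl⟩ := H.det hs h1.rev
          simp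
      cases sg
      · simp only [Stp, Bool.false_eq_true, if_false] at hs
        refine ⟨_, hs, ?_, Or.inr rfl⟩
        intro e' he' hne
        have := key e' he'
        exact ⟨fun h => by simpa using (this.1 h).1, fun h => hne (this.2 h).2⟩
      · simp only [Stp, if_true] at hs
        refine ⟨_, hs, ?_, Or.inl rfl⟩
        intro e' he' hne
        have := key e' he'
        exact ⟨fun h => hne (this.1 h).2, fun h => by simpa using (this.2 h).1⟩
    have hcE := card_erase_of_mem he
    have hcV := card_erase_of_mem hv
    have hpE : 0 < E.card := card_pos.2 ⟨_, he⟩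
    have hpV : 0 < V.card := card_pos.2 ⟨_, hv⟩
    have hval : Valid q r (E.erase e) (V.erase v) := by
      refine H.toValid.transfer (V0 := V.erase v) (f := fun x => if x = v then s else x)
        (c := fun x => if x = v then μ⁻¹ else 1) ⟨?_, ?_⟩ ⟨s, by simp [hsv, hsV]⟩
        subset_rfl ?_ ?_ ?_ ?_
      · intro s i t m h
        rw [mem_erase] at h
        have h2 := hee _ h.2 h.1
        have h3 := H.ends _ _ _ _ h.2
        simp only [mem_erase]
        exact ⟨⟨h2.1, h3.1⟩, ⟨h2.2, h3.2⟩⟩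
      · intro s i t m h
        rw [mem_erase] at h
        exact H.lab _ _ _ _ h.2
      · intro s' i t m h
        by_cases hne : (s', i, t, m) = e
        · refine ⟨[], ?_⟩
          rcases hst with hst | hst
          · rw [hst] at hne
            simp only [Prod.mk.injEq] at hne
            obtain ⟨rfl, rfl, rfl, rfl⟩ := hne
            simpa [hsv] using Pth.nil t
          · rw [hst] at hne
            simp only [Prod.mk.injEq] at hne
            obtain ⟨rfl, rfl, rfl, rfl⟩ := hne
            simpa [hsv] using Pth.nil s'
        · have h2 := hee _ h hne
          refine ⟨[(i, true)], Pth.single (Stp.of_edge ?_)⟩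
          simp only at h2
          simp [h2.1, h2.2, hne, h]
      · intro x hx
        simp only [mem_erase] at hx
        exact ⟨hx.2, by simp [hx.1]⟩
      · intro x hx
        exact ⟨x, hx, [], 1, Pth.nil x⟩
      · have := H.card; omega
    have := H.min _ _ hval
    omega
lemma sum_deg (E : Finset (Ed k Q)) (V : Finset ℕ) : ∑ v ∈ V, (lv E v).card ≤ 2 * E.card := by
  classical
  have hch : ∀ (v : ℕ) (b : Letter k), ∃ e : Ed k Q, b ∈ lv E v →
      e ∈ E ∧ e.2.1 = b.1 ∧ (b.2 = true → e.1 = v) ∧ (b.2 = false → e.2.2.1 = v) := by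
    intro v b
    by_cases h : b ∈ lv E v
    · obtain ⟨y, μ, hs⟩ := mem_lv.1 h
      rcases b with ⟨b, s⟩
      cases s
      · exact ⟨(y, b, v, μ⁻¹), fun _ => ⟨by simpa [Stp] using hs, rfl, by simp, by simp⟩⟩
      · exact ⟨(v, b, y, μ), fun _ => ⟨by simpa [Stp] using hs, rfl, by simp, by simp⟩⟩
    · exact ⟨(0, b.1, 0, 1), fun h' => absurd h' h⟩
  choose F hF using hch
  rw [← card_sigma, mul_comm]
  have h2 : E.card * 2 = (E ×ˢ (univ : Finset Bool)).card := by simp [card_product]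
  rw [h2]
  refine card_le_card_of_injOn (fun x => (F x.1 x.2, x.2.2)) ?_ ?_
  · intro x hx
    have hx := (mem_sigma.1 hx).2
    exact mem_product.2 ⟨(hF _ _ hx).1, mem_univ _⟩
  · rintro ⟨v, b, s⟩ hx ⟨v', b', s'⟩ hx' h
    have h1 := hF _ _ (mem_sigma.1 hx).2
    have h2 := hF _ _ (mem_sigma.1 hx').2
    obtain ⟨h3, h4⟩ := Prod.mk.inj h
    dsimp only at h1 h2 h3 h4
    rw [← h3] at h2
    subst h4
    obtain rfl : b = b' := h1.2.1.symm.trans h2.2.1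
    have : v = v' := by
      cases s
      · exact (h1.2.2.2 rfl).symm.trans (h2.2.2.2 rfl)
      · exact (h1.2.2.1 rfl).symm.trans (h2.2.2.1 rfl)
    rw [this]
lemma MinG.branch (H : MinG q r E V) :
    (V.filter fun v => 3 ≤ (lv E v).card).card ≤ 2 * k - 2 := by
  have h1 := sum_deg E V
  have h2 : ∑ v ∈ V, (2 + if 3 ≤ (lv E v).card then 1 else 0) ≤ ∑ v ∈ V, (lv E v).card := by
    refine sum_le_sum fun v hv => ?_
    have := H.deg2 hv
    split_ifs <;> omega
  rw [sum_add_distrib, ← card_filter] at h2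
  simp only [sum_const, smul_eq_mul] at h2
  have := H.card
  have := H.hr
  have := H.hk
  omega
lemma MinG.full (H : MinG q r E V) (hf : ∀ v ∈ V, lv E v = univ) :
    r = k ∧ ∃ v, V = {v} := by
  have h1 := sum_deg E V
  have h2 : ∑ v ∈ V, (lv E v).card = V.card * (2 * k) := by
    rw [sum_congr rfl (fun v hv => by rw [hf v hv])]
    simp [Letter, mul_comm]
  rw [h2] at h1
  have h3 := H.card
  have h4 := H.hr
  have h5 := H.hk
  have h6 : 0 < V.card := card_pos.2 H.ne
  have h7 : V.card = 1 := by
    by_contra h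
    have : 2 ≤ V.card := OM
    nlinarith
  rw [h7] at h1 h3
  refine ⟨by omega, card_eq_one.1 h7⟩
end
lemma toWord_bw {x y z : FG k} (h : bw x y z) :
    (x⁻¹ * z).toWord = (x⁻¹ * y).toWord ++ (y⁻¹ * z).toWord := by
  have h1 : x⁻¹ * z = (x⁻¹ * y) * (y⁻¹ * z) := by group
  have h2 := FreeGroup.toWord_mul_sublist (x⁻¹ * y) (y⁻¹ * z)
  rw [← h1] at h2
  refine h2.eq_of_length ?_
  rw [length_append]
  exact h.symm
lemma win_length {hk : 0 < k} {u : LW k} (i : ℤ) (L : ℕ) :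
    (win hk u i L).length = L := by simp [win]
lemma pp_word {hk : 0 < k} {u : LW k} (h : u ≠ [])
    (hu : CyclicallyReducedWord u) (i j : ℤ) : ∃ i0, ((pp u i)⁻¹ * pp u j).toWord =
      win hk u i0 (i - j).natAbs ∨ ((pp u i)⁻¹ * pp u j).toWord =
      invRev (win hk u i0 (i - j).natAbs) := by
  have key : ∀ (i : ℤ) (L : ℕ), ((pp u i)⁻¹ * pp u (i + L)).toWord = win hk u i L := by
    intro i L
    rw [pp_win (hk := hk) h, inv_mul_cancel_left, toWord_mk]
    exact isReduced_iff_reduce_eq.1 (win_reduced h hu i L)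
  rcases le_total i j with hij | hij
  · refine ⟨i, Or.inl ?_⟩
    have := key i (i - j).natAbs
    rwa [show i + ((i - j).natAbs : ℤ) = j by omega] at this
  · refine ⟨j, Or.inr ?_⟩
    have := key j (i - j).natAbs
    rw [show j + ((i - j).natAbs : ℤ) = i by omega] at this
    rw [← this, ← FreeGroup.toWord_inv]; congr 1; group
lemma chunk {m : ℕ} {hk : 0 < k} {u : LW k} (h : u ≠ [])
    (hu : CyclicallyReducedWord u) (H : Ln k u.length m (mk u) (pp u))
    {w : LW k} (hw : FreeGroup.IsReduced w) {g : FG k} (hg : g.norm ≤ 1)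
    (hN : mk w * g ∈ Subgroup.normalClosure ({mk u} : Set (FG k)))
    (h1 : mk w * g ≠ 1) {L : ℕ} (hL : L + 8 * m + 1 = u.length) :
    ∃ s c l i, w = s ++ c ++ l ∧ (c = win hk u i L ∨ c = invRev (win hk u i L)) := by
  have : ∃ y z h, Ax (pp u) h y ∧ Ax (pp u) h z ∧ bw 1 y (mk w * g) ∧
      bw 1 z (mk w * g) ∧ u.length ≤ td y z + 8 * m ∧ td 1 y ≤ td 1 z := by
    obtain ⟨y, z, h, h1, h2, h3, h4, h5⟩ := greendlinger H hN h1
    rcases le_total (td 1 y) (td 1 z) with h6 | h6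
    · exact ⟨y, z, h, h1, h2, h3, h4, h5, h6⟩
    · exact ⟨z, y, h, h2, h1, h4, h3, by rwa [td_comm], h6⟩
  obtain ⟨y, z, h0, hy, hz, by1, bz1, hd, hyz⟩ := this
  set W := mk w * g with hW
  obtain ⟨z', e1, e2⟩ := geo_exists y z L OM
  have f1 := fp 1 y z W
  have t1 := tr 1 y z
  have hbz : bw 1 y z := by
    simp only [bw] at *
    rw [td_comm y z, td_comm y W, td_comm z W] at *
    omega
  have hb2 : bw 1 z' z ∧ bw 1 y z' := by
    have := tr 1 y z'
    have := tr 1 z' z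
    simp only [bw] at *
    omega
  have hb3 : bw 1 z' W := bw_trans bz1 hb2.1
  have hax : Ax (pp u) h0 z' := H.ax_conv hy hz (by simp only [bw]; omega)
  have hb4 : bw 1 z' (mk w) := by
    rcases bw_sub (mk w) hb3 with h | h
    · exact h
    · have h5 : td (mk w) W ≤ 1 := by
        rw [hW, td, inv_mul_cancel_left]; exact hg
      have h6 : 1 ≤ td z' W := by
        have := tr 1 z W
        have := tr 1 z' W
        simp only [bw] at *
        omega
      have h7 : td (mk w) z' = 0 := by
        simp only [bw] at h; omega
      rw [td_zero] at h7
      rw [h7]; simp [bw, td_self]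
  have w1 := toWord_bw hb4
  have w2 := toWord_bw hb2.2
  simp only [inv_one, one_mul] at w1 w2
  rw [toWord_mk, isReduced_iff_reduce_eq.1 hw, w2] at w1
  obtain ⟨i, rfl⟩ := hy
  obtain ⟨j, rfl⟩ := hax
  have hij : (i - j).natAbs = L := by
    rw [← H.dist i j, ← e1, td_left]
  obtain ⟨i0, hi0⟩ := pp_word (hk := hk) h hu i j
  rw [hij] at hi0
  refine ⟨_, _, _, i0, w1, ?_⟩
  rwa [show (h0 * pp u i)⁻¹ * (h0 * pp u j) = (pp u i)⁻¹ * pp u j by group]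
section
variable {Q : Type} [Group Q] {E E' : Finset (Ed k Q)}
lemma Pth.split {x z : ℕ} {w v : LW k} {μ : Q} (h : Pth E x (w ++ v) z μ) :
    ∃ y μ1 μ2, Pth E x w y μ1 ∧ Pth E y v z μ2 ∧ μ = μ1 * μ2 := by
  induction w generalizing x μ with
  | nil => exact ⟨x, 1, μ, Pth.nil x, h, by simp⟩
  | cons a w ih =>
    cases h with
    | cons s p =>
      obtain ⟨y, μ1, μ2, h1, h2, rfl⟩ := ih p
      exact ⟨y, _, μ2, Pth.cons s h1, h2, by rw [mul_assoc]⟩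
lemma Pth.inv {x y : ℕ} {w : LW k} {μ : Q} (h : Pth E x w y μ) :
    Pth E y (invRev w) x μ⁻¹ := by
  induction h with
  | nil x => simpa using Pth.nil x
  | cons s _ ih =>
    rw [mul_inv_rev]
    have := ih.append (Pth.single s.rev)
    simpa [invRev, linv] using this
lemma Pth.red {x y : ℕ} {w : LW k} {μ : Q}
    (det : ∀ {x y y' : ℕ} {a : Letter k} {μ μ' : Q}, Stp E x a y μ → Stp E x a y' μ' →
      y = y' ∧ μ = μ') (h : Pth E x w y μ) :
    ∃ w', FreeGroup.IsReduced w' ∧ Pth E x w' y μ := by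
  induction h with
  | nil x => exact ⟨[], by simp, Pth.nil x⟩
  | @cons x y z a w μ ν s _ ih =>
    obtain ⟨w', hr, h'⟩ := ih
    cases h' with
    | nil => exact ⟨[a], by simp, Pth.cons s (Pth.nil _)⟩
    | @cons _ y' _ b w'' μ' ν' s' p =>
      by_cases hb : b = linv a
      · subst hb
        obtain ⟨rfl, rfl⟩ := det s.rev s'
        refine ⟨w'', ?_, by simpa using p⟩
        exact (isReduced_append (a := [linv a]).1 hr).2.1
      · refine ⟨a :: b :: w'', ?_, Pth.cons s (Pth.cons s' p)⟩
        refine isReduced_append (a := [a]).2 ⟨by simp, hr, ?_⟩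
        simpa using hb
structure Wk (hk : 0 < k) (u : LW k) (E : Finset (Ed k Q)) (i : ℤ) (L : ℕ)
    (X : ℕ → ℕ) (G : ℕ → Q) : Prop where
  stp : ∀ t, t < L → Stp E (X t) (uu hk u (i + t)) (X (t + 1)) ((G t)⁻¹ * G (t + 1))
  g0 : G 0 = 1
lemma wk_of {hk : 0 < k} {u : LW k} {i : ℤ} {L : ℕ} {x y : ℕ} {μ : Q}
    (h : Pth E x (win hk u i L) y μ) : ∃ X G, Wk hk u E i L X G ∧ X L = y ∧ X 0 = x := by
  induction L generalizing y μ with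
  | zero =>
    simp only [win] at h
    cases h
    exact ⟨fun _ => x, fun _ => 1, ⟨by simp, rfl⟩, rfl, rfl⟩
  | succ L ih =>
    rw [win_succ] at h
    obtain ⟨z, μ1, μ2, h1, h2, rfl⟩ := h.split
    obtain ⟨X, G, hW, rfl, rfl⟩ := ih h1
    cases h2 with
    | cons s p =>
      cases p
      rename_i μ2
      refine ⟨fun t => if t ≤ L then X t else y, fun t => if t ≤ L then G t else G L * μ2,
        ⟨?_, by simp [hW.g0]⟩, by simp, by simp⟩
      intro t ht
      rcases lt_succ_iff_lt_or_eq.1 ht with ht | rfl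
      · simpa [ht.le, Nat.succ_le_of_lt ht] using hW.stp t ht
      · simpa using s
lemma Wk.pth {hk : 0 < k} {u : LW k} {i : ℤ} {L : ℕ} {X : ℕ → ℕ} {G : ℕ → Q}
    (_W : Wk hk u E i L X G) (a b : ℕ) (hab : a ≤ b) (hb : b ≤ L)
    (hE : ∀ t, a ≤ t → t < b →
      Stp E' (X t) (uu hk u (i + t)) (X (t + 1)) ((G t)⁻¹ * G (t + 1))) :
    Pth E' (X a) (win hk u (i + a) (b - a)) (X b) ((G a)⁻¹ * G b) := by
  induction b, hab using Nat.le_induction with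
  | base => simpa [win] using Pth.nil (X a)
  | succ b hab ih =>
    have h1 := ih OM (fun t h1 h2 => hE t h1 OM)
    have h2 := h1.append (Pth.single (hE b hab OM))
    rw [show b + 1 - a = b - a + 1 by omega, win_succ]
    rw [show i + (a : ℤ) + ((b - a : ℕ) : ℤ) = i + b by omega]
    convert h2 using 1; group
end
section
variable {Q : Type} [Group Q] {u : LW k} {q : Q →* OneRel k (FreeGroup.mk u)}
  {E : Finset (Ed k Q)} {V : Finset ℕ} {r : ℕ}
lemma MinG.walk (H : MinG q r E V) {hk : 0 < k} {m L : ℕ} (h : u ≠ [])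
    (hu : CyclicallyReducedWord u) (HL : Ln k u.length m (FreeGroup.mk u) (pp u))
    (hL : L + 8 * m + 1 = u.length) {v : ℕ} (hv : v ∈ V) {b : Letter k} (hb : b ∉ lv E v) :
    ∃ i X G, Wk hk u E i L X G := by
  obtain ⟨g, hg⟩ := H.hq (QuotientGroup.mk (lt b))
  obtain ⟨w, hw⟩ := H.conn v hv v hv g
  obtain ⟨w, hr, hw⟩ := hw.red H.det
  have hg2 := H.pth hw
  rw [hg] at hg2
  obtain ⟨s, c, l, i, rfl, hc⟩ := chunk (hk := hk) h hu HL hr (g := (lt b)⁻¹)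
    (by rw [norm_inv_eq, lt_norm]) (by
      rw [← QuotientGroup.eq_one_iff, QuotientGroup.mk_mul, ← hg2, ← QuotientGroup.mk_mul]; simp)
    (by
      rw [Ne, mul_inv_eq_one]
      intro h1
      have h2 := congrArg toWord h1
      rw [lt_toWord, toWord_mk, isReduced_iff_reduce_eq.1 hr] at h2
      subst h2
      cases hw with
      | cons s p => exact hb (mem_lv.2 ⟨_, _, s⟩)) hL
  obtain ⟨y, _, _, h1, _, _⟩ := hw.split
  obtain ⟨x, _, _, _, h2, _⟩ := h1.split
  rcases hc with rfl | rfl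
  · obtain ⟨X, G, hW, _⟩ := wk_of h2
    exact ⟨i, X, G, hW⟩
  · have h3 := h2.inv
    rw [FreeGroup.invRev_invRev] at h3
    obtain ⟨X, G, hW, _⟩ := wk_of h3
    exact ⟨i, X, G, hW⟩
end
section
variable {Q : Type} [Group Q] {u : LW k} {q : Q →* OneRel k (FreeGroup.mk u)}
  {E : Finset (Ed k Q)} {V : Finset ℕ} {r : ℕ} {hk : 0 < k} {m L : ℕ} {i : ℤ} {X : ℕ → ℕ}
  {G : ℕ → Q}
lemma linv_inj {a b : Letter k} (h : linv a = linv b) : a = b := by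
  rw [← linv_linv a, h, linv_linv]
lemma MinG.forced (H : MinG q r E V) (N : ℕ) (Y Z : ℕ → ℕ) (b c : ℕ → Letter k)
    (hY : ∀ s, s < N → ∃ μ, Stp E (Y s) (b s) (Y (s + 1)) μ)
    (hb : ∀ s, s + 1 < N → b (s + 1) ≠ linv (b s))
    (hZ : ∀ s, s < N → ∃ μ, Stp E (Z s) (c s) (Z (s + 1)) μ)
    (hNB : ∀ s, s + 1 < N → ∀ a ∈ lv E (Z (s + 1)), a = c (s + 1) ∨ a = linv (c s))
    (h0 : Y 0 = Z 0) (hb0 : b 0 = c 0) : ∀ s, s < N → Y s = Z s ∧ b s = c s := by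
  intro s
  induction s with
  | zero => intro _; exact ⟨h0, hb0⟩
  | succ s ih =>
    intro hs
    obtain ⟨h1, h2⟩ := ih OM
    obtain ⟨μ, e1⟩ := hY s OM
    obtain ⟨μ', e2⟩ := hZ s OM
    rw [h1, h2] at e1
    have h3 := (H.det e1 e2).1
    refine ⟨h3, ?_⟩
    obtain ⟨μ'', e3⟩ := hY (s + 1) hs
    rw [h3] at e3
    rcases hNB s hs _ (mem_lv.2 ⟨_, _, e3⟩) with h | h
    · exact h
    · exact absurd (h.trans (by rw [h2])) (hb s hs)
def NB (hk : 0 < k) (u : LW k) (E : Finset (Ed k Q)) (i : ℤ) (X : ℕ → ℕ) (t : ℕ) :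
    Prop := ∀ a ∈ lv E (X t), a = uu hk u (i + t) ∨ a = linv (uu hk u (i + t - 1))
lemma Wk.nb (W : Wk hk u E i L X G) (h : u ≠ []) (hu : CyclicallyReducedWord u) {t : ℕ}
    (h0 : 0 < t) (hL : t < L) (hb : ¬ 3 ≤ (lv E (X t)).card) : NB hk u E i X t := by
  classical
  obtain ⟨s, rfl⟩ : ∃ s, t = s + 1 := ⟨t - 1, OM⟩
  have h1 := mem_lv.2 ⟨_, _, W.stp (s + 1) hL⟩
  have h2 := mem_lv.2 ⟨_, _, (W.stp s OM).rev⟩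
  have e : i + ((s + 1 : ℕ) : ℤ) - 1 = i + s := by push_cast; ring
  have h3 : uu hk u (i + (s + 1 : ℕ)) ≠ linv (uu hk u (i + s)) := by
    have := uu_succ_ne (hk := hk) h hu (i + s)
    push_cast; rwa [← add_assoc]
  have h4 : ({uu hk u (i + (s + 1 : ℕ)), linv (uu hk u (i + s))} : Finset (Letter k)) =
      lv E (X (s + 1)) := by
    apply Finset.eq_of_subset_of_card_le
    · intro a ha
      simp only [mem_insert, mem_singleton] at ha
      rcases ha with rfl | rfl <;> assumption
    · rw [Finset.card_pair h3]; omega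
  intro a ha
  rw [← h4] at ha
  rw [e]
  simpa only [mem_insert, mem_singleton] using ha
lemma Wk.fwd (W : Wk hk u E i L X G) (h : u ≠ []) (hu : CyclicallyReducedWord u) {t : ℕ}
    (ht : t + m ≤ L) :
    (∀ s, s < m → ∃ μ, Stp E (X (t + s)) (uu hk u (i + t + s)) (X (t + (s + 1))) μ) ∧
    (∀ s : ℕ, s + 1 < m → uu hk u (i + t + (s + 1 : ℕ)) ≠ linv (uu hk u (i + t + s))) := by
  constructor
  · intro s hs
    have := W.stp (t + s) OM
    rw [show i + ((t + s : ℕ) : ℤ) = i + t + s by push_cast; ring] at this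
    exact ⟨_, this⟩
  · intro s hs
    have := uu_succ_ne (hk := hk) h hu (i + t + s)
    push_cast; rwa [← add_assoc]
lemma Wk.bwd (W : Wk hk u E i L X G) (h : u ≠ []) (hu : CyclicallyReducedWord u) {t : ℕ}
    (ht : m ≤ t + 1) (hL : t < L) :
    (∀ s, s < m → ∃ μ, Stp E (X (t + 1 - s)) (linv (uu hk u (i + t - s))) (X (t + 1 - (s + 1))) μ)
    ∧ (∀ s : ℕ, s + 1 < m → linv (uu hk u (i + t - (s + 1 : ℕ))) ≠
      linv (linv (uu hk u (i + t - s)))) := by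
  constructor
  · intro s hs
    have := (W.stp (t - s) OM).rev
    rw [show i + ((t - s : ℕ) : ℤ) = i + t - s by omega, show t - s + 1 = t + 1 - s by omega] at this
    rw [show t + 1 - (s + 1) = t - s by omega]
    exact ⟨_, this⟩
  · intro s hs
    rw [linv_linv]
    have := uu_succ_ne (hk := hk) h hu (i + t - (s + 1 : ℕ))
    rw [show i + (t : ℤ) - (s + 1 : ℕ) + 1 = i + t - s by push_cast; ring] at this
    exact fun h => this h.symm
def Deep (hk : 0 < k) (u : LW k) (E : Finset (Ed k Q)) (i : ℤ) (X : ℕ → ℕ) (m L t : ℕ) :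
    Prop := m ≤ t ∧ t + m < L ∧ ∀ s, t ≤ s + m → s ≤ t + m → NB hk u E i X s
lemma MinG.once (H : MinG q r E V) (W : Wk hk u E i L X G) (h : u ≠ [])
    (hu : CyclicallyReducedWord u) (hP : P1 hk m u) (hm : 1 ≤ m)
    (hLn : L ≤ u.length) {t : ℕ} (hD : Deep hk u E i X m L t) {t' : ℕ} (ht' : t' < L) :
    (X t' = X t → uu hk u (i + t') = uu hk u (i + t) → t' = t) ∧
    (X t' = X (t + 1) → uu hk u (i + t') ≠ linv (uu hk u (i + t))) := by
  obtain ⟨d1, d2, d3⟩ := hD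
  have F := W.fwd (m := m) h hu (t := t) OM
  have B := W.bwd (m := m) h hu (t := t) OM OM
  have nF : ∀ s, s + 1 < m → ∀ a ∈ lv E (X (t + (s + 1))),
      a = uu hk u (i + t + (s + 1 : ℕ)) ∨ a = linv (uu hk u (i + t + s)) := by
    intro s hs a ha
    have := d3 (t + (s + 1)) OM OM a ha
    rwa [show i + ((t + (s + 1) : ℕ) : ℤ) - 1 = i + t + s by push_cast; ring,
      show i + ((t + (s + 1) : ℕ) : ℤ) = i + t + (s + 1 : ℕ) by push_cast; ring] at this
  have nB : ∀ s, s + 1 < m → ∀ a ∈ lv E (X (t + 1 - (s + 1))),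
      a = linv (uu hk u (i + t - (s + 1 : ℕ))) ∨ a = linv (linv (uu hk u (i + t - s))) := by
    intro s hs a ha
    have := d3 (t + 1 - (s + 1)) OM OM a ha
    rw [show i + ((t + 1 - (s + 1) : ℕ) : ℤ) = i + t - s by omega] at this
    rw [linv_linv, show i + (t : ℤ) - (s + 1 : ℕ) = i + t - s - 1 by push_cast; ring]
    exact this.symm
  have hdvd : (u.length : ℤ) ∣ (i + t') - (i + t) → t' = t := by
    intro hd
    have := Int.eq_zero_of_abs_lt_dvd hd (by rw [abs_lt]; constructor <;> omega)
    omega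
  by_cases hc : t' + m ≤ L
  · have F' := W.fwd (m := m) h hu hc
    constructor
    · intro e1 e2
      apply hdvd
      apply hP.1
      have := H.forced m (fun s => X (t' + s)) (fun s => X (t + s)) (fun s => uu hk u (i + t' + s))
        (fun s => uu hk u (i + t + s)) F'.1 F'.2 F.1 nF (by simpa using e1) (by simpa using e2)
      exact fun s hs => (this s hs).2
    · intro e1 e2
      apply hP.2 (i + t') (i + t)
      have := H.forced m (fun s => X (t' + s)) (fun s => X (t + 1 - s))
        (fun s => uu hk u (i + t' + s)) (fun s => linv (uu hk u (i + t - s))) F'.1 F'.2 B.1 nB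
        (by simpa using e1) (by simpa using e2)
      exact fun s hs => (this s hs).2
  · have B' := W.bwd (m := m) h hu (t := t') OM ht'
    constructor
    · intro e1 e2
      have e3 : X (t' + 1) = X (t + 1) := by
        have s1 := W.stp t' ht'
        have s2 := W.stp t OM
        rw [e1, e2] at s1
        exact (H.det s1 s2).1
      have := H.forced m (fun s => X (t' + 1 - s)) (fun s => X (t + 1 - s))
        (fun s => linv (uu hk u (i + t' - s)))
        (fun s => linv (uu hk u (i + t - s))) B'.1 B'.2 B.1 nB (by simpa using e3)
        (by simpa using congrArg linv e2)
      apply hdvd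
      have := hP.1 (i + t' - (m - 1 : ℕ)) (i + t - (m - 1 : ℕ)) (by
        intro s hs
        have := linv_inj (this (m - 1 - s) OM).2
        convert this using 2 <;> omega)
      convert this using 1; ring
    · intro e1 e2
      have e3 : X (t' + 1) = X t := by
        have s1 := W.stp t' ht'
        have s2 := (W.stp t OM).rev
        rw [e1, e2] at s1
        exact (H.det s1 s2).1
      apply hP.2 (i + t) (i + t')
      have := H.forced m (fun s => X (t' + 1 - s)) (fun s => X (t + s))
        (fun s => linv (uu hk u (i + t' - s))) (fun s => uu hk u (i + t + s)) B'.1 B'.2 F.1 nF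
        (by simpa using e3) (by simp [e2, linv_linv])
      exact fun s hs => (this s hs).2.symm
lemma MinG.vonce (H : MinG q r E V) (W : Wk hk u E i L X G) (h : u ≠ [])
    (hu : CyclicallyReducedWord u) (hP : P1 hk m u) (hm : 1 ≤ m)
    (hLn : L ≤ u.length) {t : ℕ} (hD : Deep hk u E i X m L t) (hD' : Deep hk u E i X m L (t + 1))
    {t' : ℕ} (ht' : t' ≤ L) (e : X t' = X (t + 1)) : t' = t + 1 := by
  have hnb := hD'.2.2 (t + 1) OM OM
  have e0 : i + ((t + 1 : ℕ) : ℤ) - 1 = i + t := by push_cast; ring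
  rcases Nat.lt_or_ge t' L with hlt | hge
  · have s1 := W.stp t' hlt
    rcases hnb _ (e ▸ mem_lv.2 ⟨_, _, s1⟩) with h1 | h1
    · exact (H.once W h hu hP hm hLn hD' hlt).1 e h1
    · rw [e0] at h1
      exact absurd h1 ((H.once W h hu hP hm hLn hD hlt).2 e)
  · obtain ⟨s, rfl⟩ : ∃ s, t' = s + 1 := ⟨t' - 1, by have := hD.2.1; omega⟩
    have s1 := (W.stp s OM).rev
    have s2 := W.stp t (by have := hD.2.1; omega)
    have s3 := W.stp (t + 1) (by have := hD'.2.1; omega)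
    rcases hnb _ (e ▸ mem_lv.2 ⟨_, _, s1⟩) with h1 | h1
    · rw [h1, e] at s1
      have h2 := (H.det s1 s3).1
      refine absurd ?_ ((H.once W h hu hP hm hLn hD' (t' := s) OM).2 h2)
      rw [← h1, linv_linv]
    · rw [e0] at h1
      rw [h1, e] at s1
      have h2 := (H.det s1 s2.rev).1
      have := (H.once W h hu hP hm hLn hD (t' := s) OM).1 h2 (linv_inj h1)
      omega
end
section
variable {Q : Type} [Group Q] {u : LW k} {q : Q →* OneRel k (FreeGroup.mk u)}
  {E : Finset (Ed k Q)} {V : Finset ℕ} {r : ℕ} {hk : 0 < k} {m L : ℕ} {i : ℤ} {X : ℕ → ℕ}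
  {G : ℕ → Q}
def edg (x : ℕ) (a : Letter k) (y : ℕ) (μ : Q) : Ed k Q :=
  if a.2 then (x, a.1, y, μ) else (y, a.1, x, μ⁻¹)
lemma stp_edg {x y : ℕ} {a : Letter k} {μ : Q} : Stp E x a y μ ↔ edg x a y μ ∈ E := by
  unfold Stp edg; split_ifs <;> rfl
lemma edg_rev (x y : ℕ) (a : Letter k) (μ : Q) : edg y (linv a) x μ⁻¹ = edg x a y μ := by
  rcases a with ⟨a, s⟩; cases s <;> simp [edg, linv]
lemma edg_eq {x y x' y' : ℕ} {a a' : Letter k} {μ μ' : Q} (h : edg x a y μ = edg x' a' y' μ') :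
    (x = x' ∧ a = a' ∧ y = y' ∧ μ = μ') ∨ (x = y' ∧ a = linv a' ∧ y = x' ∧ μ = μ'⁻¹) := by
  rcases a with ⟨a, s⟩; rcases a' with ⟨a', s'⟩
  cases s <;> cases s' <;> simp [edg, linv] at h ⊢ <;> obtain ⟨h1, h2, h3, h4⟩ := h <;> simp [*]
  · rw [← h4]; simp
lemma win_append (i : ℤ) (a b : ℕ) :
    win hk u i (a + b) = win hk u i a ++ win hk u (i + a) b := by
  induction b with
  | zero => simp [win]
  | succ b ih =>
    rw [← add_assoc, win_succ, ih, win_succ, append_assoc]; congr 3; push_cast; ring_nf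
lemma MinG.detour (H : MinG q r E V) (W : Wk hk u E i L X G) (h : u ≠ [])
    (hu : CyclicallyReducedWord u) (hP : P1 hk m u) (hm : 1 ≤ m)
    (hL : L + 8 * m + 1 = u.length) {a b : ℕ} (hab : a + 8 * m + 1 < b)
    (hD : ∀ t, a ≤ t → t < b → Deep hk u E i X m L t) : False := by
  classical
  have hLn : L ≤ u.length := OM
  have hbL : b < L := by have := (hD (b - 1) OM OM).2.1; omega
  set ef : ℕ → Ed k Q := fun t => edg (X t) (uu hk u (i + t)) (X (t + 1)) ((G t)⁻¹ * G (t + 1))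
    with hef
  have hefE : ∀ t, t < L → ef t ∈ E := fun t ht => stp_edg.1 (W.stp t ht)
  have hinj : ∀ t, a ≤ t → t < b → ∀ t', t' < L → ef t' = ef t → t' = t := by
    intro t h1 h2 t' h3 h4
    have h5 := H.once W h hu hP hm hLn (hD t h1 h2) h3
    rcases edg_eq h4 with h6 | h6
    · exact h5.1 h6.1 h6.2.1
    · exact absurd h6.2.1 (h5.2 h6.1)
  have hvinj : ∀ t, a < t → t < b → ∀ t', t' ≤ L → X t' = X t → t' = t := by
    intro t h1 h2 t' h3 h4
    obtain ⟨s, rfl⟩ : ∃ s, t = s + 1 := ⟨t - 1, OM⟩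
    exact H.vonce W h hu hP hm hLn (hD s OM OM) (hD (s + 1) OM h2) h3 h4
  set R := (Ico a b).image ef with hR
  set S := (Ioo a b).image X with hS
  have hRc : R.card = b - a := by
    rw [hR, card_image_of_injOn, card_Ico]
    intro t ht t' ht' he
    simp only [Finset.coe_Ico, Set.mem_Ico] at ht ht'
    exact (hinj t' ht'.1 ht'.2 t OM he)
  have hSc : S.card = b - a - 1 := by
    rw [hS, card_image_of_injOn, Nat.card_Ioo]
    intro t ht t' ht' he
    simp only [Finset.coe_Ioo, Set.mem_Ioo] at ht ht'
    exact (hvinj t' ht'.1 ht'.2 t OM he)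
  have hRE : R ⊆ E := by
    intro e he
    obtain ⟨t, ht, rfl⟩ := mem_image.1 he
    rw [mem_Ico] at ht
    exact hefE t OM
  have hXV : ∀ t, t ≤ L → X t ∈ V := by
    intro t ht
    rcases Nat.lt_or_ge t L with h1 | h1
    · exact (H.stp (W.stp t h1)).1
    · obtain ⟨s, rfl⟩ : ∃ s, t = s + 1 := ⟨t - 1, OM⟩
      exact (H.stp (W.stp s OM)).2.1
  have hSV : S ⊆ V := by
    intro e he
    obtain ⟨t, ht, rfl⟩ := mem_image.1 he
    rw [mem_Ioo] at ht
    exact hXV t OM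
  have hXS : ∀ t, t ≤ L → (X t ∈ S ↔ a < t ∧ t < b) := by
    intro t ht
    constructor
    · intro h1
      obtain ⟨t', ht', he⟩ := mem_image.1 h1
      rw [mem_Ioo] at ht'
      rw [hvinj t' ht'.1 ht'.2 t ht he.symm]; exact ht'
    · intro h1
      exact mem_image_of_mem X (mem_Ioo.2 h1)
  have hout : ∀ x c y μ, Stp E x c y μ → x ∈ S → edg x c y μ ∈ R := by
    intro x c y μ hs hx
    obtain ⟨t, ht, rfl⟩ := mem_image.1 hx
    rw [mem_Ioo] at ht
    rcases (hD t OM OM).2.2 t OM OM _ (mem_lv.2 ⟨_, _, hs⟩) with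
      h1 | h1
    · subst h1
      obtain ⟨rfl, rfl⟩ := H.det hs (W.stp t OM)
      exact mem_image.2 ⟨t, mem_Ico.2 ⟨OM, OM⟩, rfl⟩
    · obtain ⟨s, rfl⟩ : ∃ s, t = s + 1 := ⟨t - 1, OM⟩
      rw [show i + ((s + 1 : ℕ) : ℤ) - 1 = i + s by push_cast; ring] at h1
      subst h1
      obtain ⟨rfl, rfl⟩ := H.det hs (W.stp s OM).rev
      rw [edg_rev]
      exact mem_image.2 ⟨s, mem_Ico.2 ⟨OM, OM⟩, rfl⟩
  have hends : ∀ s i t m, (s, i, t, m) ∈ E \ R → s ∉ S ∧ t ∉ S := by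
    intro s i t m hm
    rw [mem_sdiff] at hm
    have h1 := Stp.of_edge hm.1
    constructor
    · intro h2
      exact hm.2 (by simpa [edg] using hout _ _ _ _ h1 h2)
    · intro h2
      exact hm.2 (by simpa [edg, linv] using hout _ _ _ _ h1.rev h2)
  have hL0 : Lab q (E \ R) (V \ S) := by
    constructor
    · intro s i t m hm
      have h1 := hends s i t m hm
      have h2 := H.ends _ _ _ _ (mem_sdiff.1 hm).1
      simp only [mem_sdiff]
      tauto
    · intro s i t m hm
      exact H.lab _ _ _ _ (mem_sdiff.1 hm).1
  have hXV0 : ∀ t, t ≤ L → ¬ (a < t ∧ t < b) → X t ∈ V \ S := by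
    intro t h1 h2
    rw [mem_sdiff, hXS t h1]
    exact ⟨hXV t h1, h2⟩
  have hG := H.pth (W.pth 0 L OM le_rfl (fun t _ ht => W.stp t ht))
  simp only [cast_zero, add_zero, Nat.sub_zero, W.g0, inv_one, one_mul] at hG
  have hq' : q (G L)⁻¹ = QuotientGroup.mk (FreeGroup.mk (win hk u (i + L) (8 * m + 1))) := by
    rw [map_inv, hG, inv_eq_iff_mul_eq_one, ← QuotientGroup.mk_mul, QuotientGroup.eq_one_iff,
      mul_mk, ← win_append, show L + (8 * m + 1) = u.length by omega]
    have h1 := pp_win (hk := hk) h i u.length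
    rw [pp_per h, ← inv_mul_eq_iff_eq_mul, ← mul_assoc] at h1
    rw [← h1]
    have := (Subgroup.normalClosure_normal (s := ({FreeGroup.mk u} : Set (FG k)))).conj_mem
      (FreeGroup.mk u) (Subgroup.subset_normalClosure (Set.mem_singleton _)) (pp u i)⁻¹
    simpa using this
  obtain ⟨E', V', g1, g2, g3, g4, g5, g6, g7⟩ := add_arc H.hq (win hk u (i + L) (8 * m + 1))
    (by rw [← length_pos_iff, win_length]; omega) (E \ R) (V \ S) hL0 (X L)
    (hXV0 _ le_rfl OM) (X 0) (hXV0 _ OM OM) _ hq'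
  rw [win_length] at g4 g5
  have c1 := card_sdiff_add_card_eq_card hRE
  have c2 := card_sdiff_add_card_eq_card hSV
  have c3 := H.card
  have hmin := H.min E' V'
  have hstp' : ∀ t, t < L → ¬ (a ≤ t ∧ t < b) →
      Stp E' (X t) (uu hk u (i + t)) (X (t + 1)) ((G t)⁻¹ * G (t + 1)) := by
    intro t h1 h2
    refine stp_edg.2 (g2 (mem_sdiff.2 ⟨hefE t h1, fun h3 => h2 ?_⟩))
    obtain ⟨t', ht', he⟩ := mem_image.1 h3
    rw [mem_Ico] at ht'
    rw [hinj t' ht'.1 ht'.2 t h1 he.symm]; exact ht'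
  have hfc : ∃ (f : ℕ → ℕ) (c : ℕ → Q), (∀ v, v ∉ S → f v = v ∧ c v = 1) ∧
      ∀ t, a < t → t < b → f (X t) = X a ∧ c (X t) = (G a)⁻¹ * G t := by
    have : ∀ v, ∃ p : ℕ × Q, (v ∉ S → p = (v, 1)) ∧ (∀ t, a < t → t < b → X t = v →
        p = (X a, (G a)⁻¹ * G t)) := by
      intro v
      by_cases hv : v ∈ S
      · obtain ⟨t, ht, rfl⟩ := mem_image.1 hv
        refine ⟨(X a, (G a)⁻¹ * G t), fun h => absurd hv h, fun t' h1 h2 h3 => ?_⟩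
        rw [mem_Ioo] at ht
        rw [hvinj t ht.1 ht.2 t' OM h3]
      · refine ⟨(v, 1), fun _ => rfl, fun t h1 h2 h3 => absurd ?_ hv⟩
        rw [← h3]; exact (hXS t OM).2 ⟨h1, h2⟩
    choose F hF using this
    refine ⟨fun v => (F v).1, fun v => (F v).2, fun v hv => ?_, fun t h1 h2 => ?_⟩
    · beta_reduce; rw [(hF v).1 hv]; simp
    · beta_reduce; rw [(hF _).2 t h1 h2 rfl]; simp
  obtain ⟨f, c, hf1, hf2⟩ := hfc
  have hloop : ∀ t, a ≤ t → t < b → ∃ w, Pth E' (f (X t)) w (f (X (t + 1)))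
      (c (X t) * ((G t)⁻¹ * G (t + 1)) * (c (X (t + 1)))⁻¹) := by
    intro t h1 h2
    have e1 : f (X t) = X a ∧ c (X t) = (G a)⁻¹ * G t := by
      rcases h1.eq_or_lt with rfl | h1
      · have := hf1 (X a) (by rw [hXS a OM]; omega)
        simpa using this
      · exact hf2 t h1 h2
    rcases Nat.lt_or_ge (t + 1) b with h3 | h3
    · have e2 := hf2 (t + 1) OM h3
      refine ⟨[], ?_⟩
      rw [e1.1, e1.2, e2.1, e2.2]
      convert Pth.nil (X a) using 1; group
    · obtain rfl : b = t + 1 := OM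
      have e2 := hf1 (X (t + 1)) (by rw [hXS _ OM]; omega)
      rw [e1.1, e1.2, e2.1, e2.2]
      have p1 := (W.pth (E' := E') 0 a OM OM
        (fun s _ h5 => hstp' s OM OM)).inv
      have p2 := g6.inv
      have p3 := (W.pth (E' := E') (t + 1) L OM le_rfl
        (fun s h4 h5 => hstp' s OM OM)).inv
      exact ⟨_, by convert (p1.append p2).append p3 using 1; rw [W.g0]; group⟩
  have hval : Valid q r E' V' := by
    refine H.toValid.transfer (V0 := V \ S) (f := f) (c := c) g1 ⟨X 0, hXV0 _ OM OM⟩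
      g3 ?_ ?_ g7 OM
    · intro s i' t μ hs
      by_cases hR' : (s, i', t, μ) ∈ R
      · obtain ⟨t', ht', he⟩ := mem_image.1 hR'
        rw [mem_Ico] at ht'
        obtain ⟨w, hw⟩ := hloop t' ht'.1 ht'.2
        have : edg s (i', true) t μ = ef t' := by rw [he]; simp [edg]
        rcases edg_eq this with ⟨rfl, _, rfl, rfl⟩ | ⟨rfl, _, rfl, rfl⟩
        · exact ⟨w, hw⟩
        · exact ⟨_, by convert hw.inv using 1; group⟩
      · have hs' : (s, i', t, μ) ∈ E \ R := mem_sdiff.2 ⟨hs, hR'⟩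
        have h1 := hends _ _ _ _ hs'
        rw [(hf1 s h1.1).1, (hf1 t h1.2).1, (hf1 s h1.1).2, (hf1 t h1.2).2]
        refine ⟨_, Pth.single (Stp.of_edge (i := i') (g2 ?_))⟩
        simpa using hs'
    · intro v hv
      rw [mem_sdiff] at hv
      exact ⟨hv.1, (hf1 v hv.2).1⟩
  have := hmin hval
  omega
lemma MinG.frequent (H : MinG q r E V) (W : Wk hk u E i L X G) (h : u ≠ [])
    (hu : CyclicallyReducedWord u) (hP : P1 hk m u) (hm : 1 ≤ m)
    (hL : L + 8 * m + 1 = u.length) (s : ℕ) (hs : 1 ≤ s) (hsL : s + 10 * m + 2 < L) :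
    ∃ t, s ≤ t ∧ t ≤ s + 10 * m + 2 ∧ 3 ≤ (lv E (X t)).card := by
  by_contra hcon
  push Not at hcon
  refine H.detour (a := s + m) (b := s + m + 8 * m + 2) W h hu hP hm hL OM ?_
  intro t h1 h2
  refine ⟨OM, OM, fun t' h3 h4 => ?_⟩
  refine W.nb h hu OM OM ?_
  have := hcon t' OM OM
  omega
end
section

def Wd (c : Letter k) : ℕ → Finset (LW k)
  | 0 => {[]}
  | N + 1 => (univ.erase (linv c)).biUnion fun b => (Wd b N).image (List.cons b)
lemma red_cons {a b : Letter k} {w : LW k} : FreeGroup.IsReduced (a :: b :: w) ↔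
    b ≠ linv a ∧ FreeGroup.IsReduced (b :: w) := by
  have := isReduced_append (a := [a]) (b := b :: w)
  simpa [and_comm] using this
lemma mem_Wd {c : Letter k} {N : ℕ} {z : LW k} :
    z ∈ Wd c N ↔ z.length = N ∧ FreeGroup.IsReduced (c :: z) := by
  induction N generalizing c z with
  | zero =>
    simp only [Wd, mem_singleton, length_eq_zero_iff]
    constructor
    · rintro rfl; simp
    · exact fun h => h.1
  | succ N ih =>
    simp only [Wd, mem_biUnion, mem_erase, mem_univ, and_true,
      mem_image, ih]
    constructor
    · rintro ⟨b, hb, y, ⟨rfl, hy⟩, rfl⟩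
      exact ⟨rfl, red_cons.2 ⟨hb, hy⟩⟩
    · rintro ⟨h1, h2⟩
      cases z with
      | nil => simp at h1
      | cons b y =>
        rw [red_cons] at h2
        exact ⟨b, h2.1, y, ⟨by simpa using h1, h2.2⟩, rfl⟩
lemma sum_Wd {M : Type*} [AddCommMonoid M] (c : Letter k) (N : ℕ) (f : LW k → M) :
    ∑ z ∈ Wd c (N + 1), f z = ∑ b ∈ univ.erase (linv c), ∑ z ∈ Wd b N, f (b :: z) := by
  rw [Wd, Finset.sum_biUnion]
  · refine sum_congr rfl fun b _ => ?_
    rw [Finset.sum_image (by simp)]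
  · intro b _ b' _ hne
    simp only [Function.onFun, disjoint_left, mem_image]
    rintro z ⟨y, _, rfl⟩ ⟨y', _, h⟩
    exact hne (by simpa using (List.cons.inj h).1.symm)
lemma card_Wd (c : Letter k) (N : ℕ) : (Wd c N).card = (2 * k - 1) ^ N := by
  induction N generalizing c with
  | zero => simp [Wd]
  | succ N ih =>
    rw [card_eq_sum_ones, sum_Wd]
    simp only [← card_eq_sum_ones, ih, sum_const, card_erase_of_mem
      (mem_univ _), card_univ, smul_eq_mul]
    simp [Letter, pow_succ, mul_comm]
def lst : Letter k → LW k → Letter k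
  | c, [] => c
  | _, b :: z => lst b z
lemma red_split {a : Letter k} {z1 z2 : LW k} :
    FreeGroup.IsReduced (a :: (z1 ++ z2)) ↔
      FreeGroup.IsReduced (a :: z1) ∧ FreeGroup.IsReduced (lst a z1 :: z2) := by
  induction z1 generalizing a with
  | nil => simp [lst]
  | cons b z1 ih => rw [cons_append, red_cons, ih, red_cons, lst, and_assoc]
lemma red_rep (a : Letter k) (s : ℕ) : FreeGroup.IsReduced (a :: replicate s a) := by
  induction s with
  | zero => simp
  | succ s ih => rw [replicate_succ, red_cons]; exact ⟨fun h => linv_ne a h.symm, ih⟩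
lemma red_tail {a : Letter k} {z : LW k} (h : FreeGroup.IsReduced (a :: z)) :
    FreeGroup.IsReduced z := (isReduced_append (a := [a]).1 h).2.1
end
section
variable {Q : Type} [Group Q] {u : LW k} {q : Q →* OneRel k (FreeGroup.mk u)}
  {E : Finset (Ed k Q)} {V : Finset ℕ} {r : ℕ} {hk : 0 < k} {m L : ℕ} {i : ℤ} {X : ℕ → ℕ}
  {G : ℕ → Q}
def Rd (E : Finset (Ed k Q)) (v : ℕ) (z : LW k) : Prop := ∃ y μ, Pth E v z y μ
lemma MinG.pdet (H : MinG q r E V) {x y y' : ℕ} {w : LW k} {μ μ' : Q}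
    (h : Pth E x w y μ) (h' : Pth E x w y' μ') : y = y' ∧ μ = μ' := by
  induction h generalizing μ' with
  | nil => cases h'; simp
  | cons s p ih =>
    cases h' with
    | cons s' p' =>
      obtain ⟨rfl, rfl⟩ := H.det s s'
      obtain ⟨rfl, rfl⟩ := ih p'
      simp
lemma MinG.pV (H : MinG q r E V) {x y : ℕ} {w : LW k} {μ : Q}
    (h : Pth E x w y μ) (hx : x ∈ V) : y ∈ V := by
  induction h with
  | nil => exact hx
  | cons s p ih => exact ih (H.stp s).2.1
lemma MinG.unr (H : MinG q r E V) {x y : ℕ} {w z : LW k} {μ : Q}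
    (h : Pth E x w y μ) (hz : ¬ Rd E y z) : ¬ Rd E x (w ++ z) := by
  rintro ⟨y', μ', h'⟩
  obtain ⟨y1, μ1, μ2, h1, h2, _⟩ := h'.split
  obtain ⟨rfl, rfl⟩ := H.pdet h h1
  exact hz ⟨_, _, h2⟩
lemma unr_one {x : ℕ} {b : Letter k} (hb : b ∉ lv E x) : ¬ Rd E x [b] := by
  rintro ⟨y', μ', h'⟩
  cases h' with
  | cons s _ => exact hb (mem_lv.2 ⟨_, _, s⟩)
lemma Pth.redl {x y : ℕ} {w : LW k} {μ : Q}
    (det : ∀ {x y y' : ℕ} {a : Letter k} {μ μ' : Q}, Stp E x a y μ → Stp E x a y' μ' →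
      y = y' ∧ μ = μ') (h : Pth E x w y μ) :
    ∃ w', FreeGroup.IsReduced w' ∧ w'.length ≤ w.length ∧ Pth E x w' y μ := by
  induction h with
  | nil x => exact ⟨[], by simp, le_rfl, Pth.nil x⟩
  | @cons x y z a w μ ν s _ ih =>
    obtain ⟨w', hr, hl, h'⟩ := ih
    cases h' with
    | nil => exact ⟨[a], by simp, by simp, Pth.cons s (Pth.nil _)⟩
    | @cons _ y' _ b w'' μ' ν' s' p =>
      simp only [length_cons] at *
      by_cases hb : b = linv a
      · subst hb
        obtain ⟨rfl, rfl⟩ := det s.rev s'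
        exact ⟨w'', red_tail hr, OM, by simpa using p⟩
      · exact ⟨a :: b :: w'', red_cons.2 ⟨hb, hr⟩, by simp; omega, Pth.cons s (Pth.cons s' p)⟩
lemma Pth.lastin {x y : ℕ} {w : LW k} {μ : Q} (h : Pth E x w y μ) (a : Letter k)
    (hw : w ≠ []) : linv (lst a w) ∈ lv E y := by
  induction h generalizing a with
  | nil => exact absurd rfl hw
  | @cons x y z b w μ ν s p ih =>
    cases p with
    | nil => exact mem_lv.2 ⟨_, _, s.rev⟩
    | cons s' p' => exact ih b (by simp)
lemma MinG.fullcard (H : MinG q r E V) (S : Finset ℕ) (hS : S ⊆ V)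
    (hf : ∀ v ∈ S, lv E v = univ) : S.card ≤ 2 * k - 2 := by
  refine le_trans (card_le_card ?_) H.branch
  intro v hv
  rw [mem_filter, hf v hv]
  refine ⟨hS hv, ?_⟩
  have := H.hk
  simp [Letter]; omega
lemma MinG.near (H : MinG q r E V) (hnf : ∃ v ∈ V, lv E v ≠ univ) {v : ℕ} (hv : v ∈ V) :
    ∃ w y μ, w.length ≤ 2 * k - 2 ∧ FreeGroup.IsReduced w ∧ Pth E v w y μ ∧ lv E y ≠ univ := by
  classical
  by_contra hcon
  push Not at hcon
  have hcon' : ∀ w y μ, w.length ≤ 2 * k - 2 → Pth E v w y μ → lv E y = univ := by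
    intro w y μ h1 h2
    obtain ⟨w', h3, h4, h5⟩ := h2.redl H.det
    exact hcon w' y μ OM h3 h5
  set S : ℕ → Finset ℕ := fun j => V.filter fun y => ∃ w μ, w.length ≤ j ∧ Pth E v w y μ with hS
  have hgrow : ∀ j, j ≤ 2 * k - 2 → j + 1 ≤ (S j).card := by
    intro j
    induction j with
    | zero =>
      intro _
      exact card_pos.2 ⟨v, mem_filter.2 ⟨hv, [], 1, by simp, Pth.nil v⟩⟩
    | succ j ih =>
      intro hj
      have h1 := ih OM
      have hss : S j ⊂ S (j + 1) := by
        refine Finset.ssubset_iff_subset_ne.2 ⟨?_, ?_⟩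
        · intro y hy
          simp only [hS, mem_filter] at hy ⊢
          obtain ⟨hy, w, μ, hw, hp⟩ := hy
          exact ⟨hy, w, μ, OM, hp⟩
        · intro heq
          have hcl : ∀ x w y μ, x ∈ S j → Pth E x w y μ → y ∈ S j := by
            intro x w y μ hx hp
            induction hp with
            | nil => exact hx
            | @cons x y z b w μ ν s p ih' =>
              apply ih'
              rw [heq]
              simp only [hS, mem_filter] at hx ⊢
              obtain ⟨hx, w', μ', hw', hp'⟩ := hx
              exact ⟨(H.stp s).2.1, w' ++ [b], _, by simp; omega, hp'.append (Pth.single s)⟩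
          obtain ⟨x, hx, hxf⟩ := hnf
          obtain ⟨w, hw⟩ := H.conn v hv x hx 1
          have h3 := hcl v w x 1 (mem_filter.2 ⟨hv, [], 1, by simp, Pth.nil v⟩) hw
          simp only [hS, mem_filter] at h3
          obtain ⟨_, w', μ', hw', hp'⟩ := h3
          exact hxf (hcon' w' x μ' OM hp')
      have := Finset.card_lt_card hss
      omega
  have h1 := hgrow (2 * k - 2) le_rfl
  have h2 := H.fullcard (S (2 * k - 2)) (filter_subset _ _) (by
    intro y hy
    simp only [hS, mem_filter] at hy
    obtain ⟨_, w', μ', hw', hp'⟩ := hy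
    exact hcon' w' y μ' hw' hp')
  omega
lemma exists_nf {v : ℕ} (h : lv E v ≠ univ) : ∃ b, b ∉ lv E v := by
  by_contra hc
  push Not at hc
  exact h (Finset.eq_univ_iff_forall.2 hc)
lemma MinG.unread (H : MinG q r E V) (hnf : ∃ v ∈ V, lv E v ≠ univ) {v : ℕ} (hv : v ∈ V)
    (a : Letter k) : ∃ z ∈ Wd a (4 * k), ¬ Rd E v z := by
  have hk2 := H.hk
  suffices hs : ∃ z, z.length ≤ 4 * k ∧ FreeGroup.IsReduced (a :: z) ∧ ¬ Rd E v z by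
    obtain ⟨z, h1, h2, h3⟩ := hs
    refine ⟨z ++ replicate (4 * k - z.length) (lst a z), mem_Wd.2 ⟨by simp; omega,
      red_split.2 ⟨h2, red_rep _ _⟩⟩, ?_⟩
    rintro ⟨y, μ, h⟩
    obtain ⟨y', μ', _, h4, _⟩ := h.split
    exact h3 ⟨y', μ', h4⟩
  obtain ⟨w, y, μ, hl, hr, hp, hyf⟩ := H.near hnf hv
  obtain ⟨b, hb⟩ := exists_nf hyf
  have hz0 : ∃ z0 : LW k, z0.length ≤ 2 * k - 1 ∧ FreeGroup.IsReduced z0 ∧ ¬ Rd E v z0 ∧ z0 ≠ [] := by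
    refine ⟨w ++ [b], by simp; omega, ?_, H.unr hp (unr_one hb), by simp⟩
    cases w with
    | nil => simp
    | cons c w =>
      refine red_split.2 ⟨hr, red_cons.2 ⟨?_, by simp⟩⟩
      have := hp.lastin c (by simp)
      rintro rfl
      exact hb this
  obtain ⟨z0, hl0, hr0, hu0, hne0⟩ := hz0
  obtain ⟨c, z1, rfl⟩ := List.exists_cons_of_ne_nil hne0
  by_cases hc : c = linv a
  · obtain ⟨b', hb1, hb2⟩ : ∃ b' : Letter k, b' ≠ linv a ∧ b' ≠ a := by
      have : ∃ j : Fin k, j ≠ a.1 := by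
        haveI : Nontrivial (Fin k) := Fin.nontrivial_iff_two_le.2 hk2
        exact exists_ne a.1
      obtain ⟨j, hj⟩ := this
      exact ⟨(j, true), fun h => hj (by simpa [linv] using congrArg Prod.fst h),
        fun h => hj (congrArg Prod.fst h)⟩
    have hrep : ∀ s z, FreeGroup.IsReduced z → z.head? ≠ some (linv b') →
        FreeGroup.IsReduced (a :: z) ∨ 1 ≤ s →
        FreeGroup.IsReduced (a :: (replicate s b' ++ z)) := by
      intro s z h1 h2 h3
      have aux : ∀ s, FreeGroup.IsReduced (b' :: (replicate s b' ++ z)) := by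
        intro s
        induction s with
        | zero =>
          cases z with
          | nil => simp
          | cons d z => exact red_cons.2 ⟨by simpa using h2, h1⟩
        | succ s ih =>
          rw [replicate_succ, cons_append, red_cons]
          exact ⟨fun h => linv_ne b' h.symm, ih⟩
      cases s with
      | zero => simpa using h3
      | succ s =>
        rw [replicate_succ, cons_append, red_cons]
        exact ⟨hb1, aux s⟩
    by_cases hR : Rd E v (replicate (2 * k - 1) b')
    · have hpre : ∀ s, s ≤ 2 * k - 1 → ∃ y μ, Pth E v (replicate s b') y μ := by
        intro s hs
        obtain ⟨y, μ, h⟩ := hR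
        rw [show 2 * k - 1 = s + (2 * k - 1 - s) by omega, replicate_add] at h
        obtain ⟨y', μ', _, h4, _⟩ := h.split
        exact ⟨y', μ', h4⟩
      have hpre' : ∀ s, ∃ y μ, s ≤ 2 * k - 1 → Pth E v (replicate s b') y μ := by
        intro s
        by_cases hs : s ≤ 2 * k - 1
        · obtain ⟨y, μ, h⟩ := hpre s hs
          exact ⟨y, μ, fun _ => h⟩
        · exact ⟨0, 1, fun h => absurd h hs⟩
      choose Y M hY using hpre'
      by_cases hfull : ∀ s, 1 ≤ s → s ≤ 2 * k - 1 → lv E (Y s) = univ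
      · obtain ⟨s, hs, t, ht, hst, heq⟩ : ∃ s ∈ Icc 1 (2 * k - 1), ∃ t ∈
            Icc 1 (2 * k - 1), s ≠ t ∧ Y s = Y t := by
          refine Finset.exists_ne_map_eq_of_card_lt_of_maps_to (t :=
            (Icc 1 (2 * k - 1)).image Y) ?_ ?_
          · refine lt_of_le_of_lt (H.fullcard _ ?_ ?_) ?_
            · intro x hx
              obtain ⟨s, hs, rfl⟩ := mem_image.1 hx
              exact H.pV (hY s (mem_Icc.1 hs).2) hv
            · intro x hx
              obtain ⟨s, hs, rfl⟩ := mem_image.1 hx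
              exact hfull s (mem_Icc.1 hs).1 (mem_Icc.1 hs).2
            · simp; omega
          · intro s hs
            exact mem_image_of_mem _ hs
        rw [mem_Icc] at hs ht
        have hcyc : ∃ d, 1 ≤ d ∧ d ≤ 2 * k - 1 ∧ ∃ ν, Pth E v (replicate d b') v ν := by
          have key : ∀ s t, s < t → t ≤ 2 * k - 1 → Y s = Y t →
              ∃ d, 1 ≤ d ∧ d ≤ 2 * k - 1 ∧ ∃ ν, Pth E v (replicate d b') v ν := by
            intro s t h1 h2 h3
            have p1 := hY t h2
            rw [show t = (t - s) + s by omega, replicate_add, show (t - s) + s = t by omega] at p1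
            obtain ⟨x, ν1, ν2, p2, p3, _⟩ := p1.split
            have p4 := (hY s OM).inv
            have p5 := p3.inv
            rw [h3] at p4
            obtain ⟨rfl, _⟩ := H.pdet p4 p5
            exact ⟨t - s, OM, OM, _, p2⟩
          rcases Nat.lt_or_gt_of_ne hst with h | h
          · exact key s t h ht.2 heq
          · exact key t s h hs.2 heq.symm
        obtain ⟨d, hd1, hd2, ν, hd3⟩ := hcyc
        refine ⟨List.replicate d b' ++ c :: z1, by simp at *; omega, hrep d _ hr0 ?_ (Or.inr hd1),
          H.unr hd3 hu0⟩
        simp only [List.head?_cons, ne_eq, Option.some.injEq, hc]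
        exact fun h => hb2 (linv_inj h).symm
      · push Not at hfull
        obtain ⟨s, hs1, hs2, hs3⟩ := hfull
        obtain ⟨b2, hb2'⟩ := exists_nf hs3
        have hp2 := hY s hs2
        refine ⟨List.replicate s b' ++ [b2], by simp; omega, hrep s _ (by simp) ?_ (Or.inr hs1),
          H.unr hp2 (unr_one hb2')⟩
        simp only [List.head?_cons, ne_eq, Option.some.injEq]
        rintro rfl
        have h5 := hp2.lastin b' (by simp; omega)
        have h6 : ∀ s, lst b' (replicate s b') = b' := by
          intro s
          induction s with
          | zero => rfl
          | succ s ih => rw [replicate_succ, lst, ih]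
        rw [h6] at h5
        exact hb2' h5
    · refine ⟨replicate (2 * k - 1) b', by simp; omega, ?_, hR⟩
      have := hrep (2 * k - 1) [] (by simp) (by simp) (Or.inr OM)
      simpa using this
  · exact ⟨c :: z1, by simp at *; omega, red_cons.2 ⟨hc, hr0⟩, hu0⟩
open Classical in
lemma MinG.readcount (H : MinG q r E V) (hnf : ∃ v ∈ V, lv E v ≠ univ) (j : ℕ) :
    ∀ v ∈ V, ∀ a : Letter k, ((Wd a (j * (4 * k))).filter (Rd E v)).card ≤
      ((2 * k - 1) ^ (4 * k) - 1) ^ j := by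
  induction j with
  | zero =>
    intro v hv a
    refine (card_filter_le _ _).trans ?_
    simp [Wd]
  | succ j ih =>
    intro v hv a
    refine (card_le_mul_card_image (f := take (4 * k)) _
      (((2 * k - 1) ^ (4 * k) - 1) ^ j) ?_).trans ?_
    · intro z1 hz1
      obtain ⟨z, hz, rfl⟩ := mem_image.1 hz1
      rw [mem_filter, mem_Wd] at hz
      obtain ⟨⟨hzl, hzr⟩, y, μ, hzp⟩ := hz
      rw [← take_append_drop (4 * k) z] at hzp
      obtain ⟨x, μ1, μ2, p1, p2, _⟩ := hzp.split
      refine le_trans ?_ (ih x (H.pV p1 hv) (lst a (z.take (4 * k))))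
      refine card_le_card_of_injOn (List.drop (4 * k)) ?_ ?_
      · intro z' hz'
        simp only [coe_filter, mem_setOf_eq, mem_filter, mem_Wd] at hz' ⊢
        obtain ⟨⟨⟨h1, h2⟩, y', μ', h3⟩, h4⟩ := hz'
        rw [← take_append_drop (4 * k) z', h4] at h3 h2
        obtain ⟨x', _, _, p1', p2', _⟩ := h3.split
        obtain ⟨rfl, _⟩ := H.pdet p1 p1'
        refine ⟨⟨?_, (red_split.1 h2).2⟩, _, _, p2'⟩
        rw [length_drop, h1, Nat.succ_mul]; omega
      · intro z' hz' z'' hz'' he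
        simp only [coe_filter, mem_setOf_eq] at hz' hz''
        rw [← take_append_drop (4 * k) z', ← take_append_drop (4 * k) z'', hz'.2, hz''.2,
          he]
    · rw [pow_succ]
      refine Nat.mul_le_mul_left _ ?_
      obtain ⟨z0, hz0, hz0'⟩ := H.unread hnf hv a
      have hsub : ((Wd a ((j + 1) * (4 * k))).filter (Rd E v)).image (take (4 * k)) ⊆
          (Wd a (4 * k)).erase z0 := by
        intro z1 hz1
        obtain ⟨z, hz, rfl⟩ := mem_image.1 hz1
        rw [mem_filter, mem_Wd] at hz
        obtain ⟨⟨hzl, hzr⟩, y, μ, hzp⟩ := hz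
        rw [← take_append_drop (4 * k) z] at hzp hzr
        obtain ⟨x, μ1, μ2, p1, p2, _⟩ := hzp.split
        rw [mem_erase, mem_Wd]
        refine ⟨?_, ?_, (red_split.1 hzr).1⟩
        · intro h; exact hz0' (h ▸ ⟨_, _, p1⟩)
        · rw [length_take, hzl]; exact min_eq_left (le_mul_of_pos_left _ (Nat.succ_pos j))
      have := card_le_card hsub
      rwa [card_erase_of_mem hz0, card_Wd] at this
end
def P2 (hk : 0 < k) (B l : ℕ) (u : LW k) : Prop :=
  ∀ z : LW k, z.length = l → FreeGroup.IsReduced z →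
    B < ((range u.length).filter fun t : ℕ => win hk u t l = z).card
section
variable {Q : Type} [Group Q] {u : LW k} {q : Q →* OneRel k (FreeGroup.mk u)}
  {E : Finset (Ed k Q)} {V : Finset ℕ} {r : ℕ} {hk : 0 < k} {m L : ℕ} {i : ℤ} {X : ℕ → ℕ}
  {G : ℕ → Q}
lemma win_eq_of {u : LW k} {i j : ℤ} (hd : (u.length : ℤ) ∣ i - j) (l : ℕ) :
    win hk u i l = win hk u j l := by
  have : ∀ t, uu hk u (i + t) = uu hk u (j + t) := by
    intro t
    obtain ⟨c, hc⟩ := hd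
    have : i + t = j + t + c * u.length := by linarith
    rw [this]
    unfold uu; simp
  simp [win, this]
lemma P2.occ {B l : ℕ} (hP : P2 hk B l u) (h : u ≠ []) {L H1 : ℕ} (hL : L ≤ u.length) (hl : 1 ≤ l)
    (hB : H1 + (u.length - L) + l ≤ B) (i : ℤ) {z : LW k} (hz : z.length = l)
    (hr : FreeGroup.IsReduced z) : ∃ t : ℕ, H1 ≤ t ∧ t + l ≤ L ∧ win hk u (i + t) l = z := by
  by_contra hcon
  push Not at hcon
  have hn : 0 < u.length := length_pos_iff.2 h
  have hn' : (u.length : ℤ) ≠ 0 := OM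
  have := hP z hz hr
  refine absurd this (not_lt.2 (le_trans ?_ hB))
  let f : ℕ → ℕ := fun p => ((p - i) % u.length).toNat
  have hf : ∀ p : ℕ, (f p : ℤ) = (p - i) % u.length := fun p =>
    Int.toNat_of_nonneg (Int.emod_nonneg _ hn')
  have hf2 : ∀ p : ℕ, f p < u.length := fun p => by
    have := Int.emod_lt_of_pos (p - i) (by omega : (0 : ℤ) < u.length)
    have := hf p; omega
  have hf3 : ∀ p : ℕ, (u.length : ℤ) ∣ (i + f p) - p := fun p =>
    ⟨-((p - i) / u.length), by rw [hf]; have := Int.emod_add_mul_ediv (p - i) u.length; linarith⟩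
  have hi : InjOn f ↑((range u.length).filter fun t : ℕ => win hk u t l = z) := by
    intro p hp p' hp' e
    simp only [coe_filter, mem_range, mem_setOf_eq] at hp hp'
    have h1 := hf3 p
    have h2 := hf3 p'
    rw [e] at h1
    have h3 := Int.eq_zero_of_abs_lt_dvd (dvd_sub h2 h1) (by rw [abs_lt]; constructor <;> omega)
    omega
  rw [← card_image_of_injOn hi]
  have hs : Finset.image f ((range u.length).filter fun t : ℕ => win hk u t l = z) ⊆
      range H1 ∪ Ico (L + 1 - l) u.length := by
    intro t ht
    obtain ⟨p, hp, rfl⟩ := mem_image.1 ht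
    simp only [mem_filter, mem_range] at hp
    simp only [mem_union, mem_range, mem_Ico]
    by_contra hc
    push Not at hc
    have := hf2 p
    exact hcon (f p) hc.1 OM ((win_eq_of (hf3 p) l).trans hp.2)
  refine (card_le_card hs).trans ((card_union_le _ _).trans ?_)
  simp; omega
lemma MinG.visits (H : MinG q r E V) (W : Wk hk u E i L X G) (h : u ≠ [])
    (hu : CyclicallyReducedWord u) (hP : P1 hk m u) (hm : 1 ≤ m)
    (hL : L + 8 * m + 1 = u.length) : ∃ S : Finset ℕ, S ⊆ V ∧
      S.card ≤ (2 * k - 2) * (2 * k * (10 * m + 3)) ∧ ∀ t, 10 * m + 3 ≤ t → t < L → X t ∈ S := by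
  classical
  let C : ℕ × Letter k × ℕ → ℕ → Prop := fun c t => ∃ t0, t0 + c.2.2 = t ∧ t < L ∧ c.1 = X t0 ∧
    c.2.1 = uu hk u (i + t0) ∧ ∀ s, t0 < s → s ≤ t → ¬ 3 ≤ (lv E (X s)).card
  have key : ∀ c t t', C c t → C c t' → X t = X t' := by
    rintro ⟨v, a, d⟩ t t' ⟨t0, h1, h2, h3, h4, h5⟩ ⟨t0', h1', h2', h3', h4', h5'⟩
    simp only at *
    have F := W.fwd (m := d + 1) h hu (t := t0) OM
    have F' := W.fwd (m := d + 1) h hu (t := t0') OM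
    have := H.forced (d + 1) (fun s => X (t0 + s)) (fun s => X (t0' + s))
      (fun s => uu hk u (i + t0 + s)) (fun s => uu hk u (i + t0' + s)) F.1 F.2 F'.1 ?_
      (by simp [← h3, ← h3']) (by simp [← h4, ← h4']) d OM
    · rw [← h1, ← h1']; exact this.1
    · intro s hs a ha
      have := W.nb h hu (t := t0' + (s + 1)) OM OM (h5' _ OM OM) a ha
      rcases this with e | e
      · left; rw [e]; congr 1; push_cast; ring
      · right; rw [e]; congr 2; push_cast; ring
  let D := (V.filter fun v => 3 ≤ (lv E v).card) ×ˢ ((univ : Finset (Letter k)) ×ˢ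
    range (10 * m + 3))
  refine ⟨V ∩ D.image fun c => if hc : ∃ t, C c t then X hc.choose else 0,
    Finset.inter_subset_left, ?_, ?_⟩
  · refine (card_le_card Finset.inter_subset_right).trans (card_image_le.trans ?_)
    simp only [D, card_product, card_univ, card_range]
    refine Nat.mul_le_mul H.branch (Nat.mul_le_mul (by simp [Letter, mul_comm]) le_rfl)
  · intro t ht htL
    have hex : ∃ d, d ≤ t ∧ 3 ≤ (lv E (X (t - d))).card := by
      obtain ⟨s, h1, h2, h3⟩ := H.frequent W h hu hP hm hL (t - (10 * m + 2)) OM OM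
      exact ⟨t - s, by omega, by rwa [show t - (t - s) = s by omega]⟩
    have hd : find hex < 10 * m + 3 := by
      obtain ⟨s, h1, h2, h3⟩ := H.frequent W h hu hP hm hL (t - (10 * m + 2)) OM OM
      have : find hex ≤ t - s :=
        find_min' hex ⟨by omega, by rwa [show t - (t - s) = s by omega]⟩
      omega
    obtain ⟨hd1, hd2⟩ := find_spec hex
    set d := find hex
    have hC : C (X (t - d), uu hk u (i + (t - d : ℕ)), d) t := by
      refine ⟨t - d, by simp; omega, htL, rfl, rfl, fun s h1 h2 h3 => ?_⟩
      exact Nat.find_min hex (m := t - s) OM ⟨by omega, by rwa [show t - (t - s) = s by omega]⟩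
    have hV : ∀ s, s < L → X s ∈ V := fun s hs => (H.stp (W.stp s hs)).1
    refine Finset.mem_inter.2 ⟨hV t htL, mem_image.2
      ⟨(X (t - d), uu hk u (i + (t - d : ℕ)), d), ?_, ?_⟩⟩
    · simp only [D, mem_product, mem_filter, mem_univ, mem_range]
      exact ⟨⟨hV _ OM, hd2⟩, trivial, hd⟩
    · have hc : ∃ t', C (X (t - d), uu hk u (i + (t - d : ℕ)), d) t' := ⟨t, hC⟩
      rw [dif_pos hc]
      exact key _ _ _ hc.choose_spec hC
lemma MinG.isfull (H : MinG q r E V) (h : u ≠ []) (hu : CyclicallyReducedWord u)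
    (hP : P1 hk m u) (hm : 1 ≤ m) (HL : Ln k u.length m (FreeGroup.mk u) (pp u)) {j B : ℕ}
    (hP2 : P2 hk B (j * (4 * k) + 1) u) (hB : 18 * m + 4 + (j * (4 * k) + 1) ≤ B)
    (hK : (2 * k - 2) * (2 * k * (10 * m + 3)) * ((2 * k - 1) ^ (4 * k) - 1) ^ j <
      (2 * k - 1) ^ (j * (4 * k))) : ∀ v ∈ V, lv E v = univ := by
  classical
  by_contra hnf
  push Not at hnf
  obtain ⟨v, hv, hv'⟩ := hnf
  obtain ⟨b, hb⟩ := exists_nf hv'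
  have hn := HL.hn
  obtain ⟨L, hL⟩ : ∃ L, L + 8 * m + 1 = u.length := ⟨u.length - 8 * m - 1, OM⟩
  obtain ⟨i, X, G, W⟩ := H.walk (hk := hk) h hu HL hL hv hb
  obtain ⟨S, hSV, hSc, hS⟩ := H.visits W h hu hP hm hL
  have hsub : Wd b (j * (4 * k)) ⊆ S.biUnion fun v => (Wd b (j * (4 * k))).filter (Rd E v) := by
    intro z hz
    obtain ⟨hz1, hz2⟩ := mem_Wd.1 hz
    obtain ⟨t, h1, h2, h3⟩ := hP2.occ (H1 := 10 * m + 3) h (by omega : L ≤ u.length) OM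
      OM i (z := b :: z) (by simp [hz1]) hz2
    by_cases hj : j * (4 * k) = 0
    · rw [hj] at hz1
      obtain rfl := length_eq_zero_iff.1 hz1
      exact mem_biUnion.2 ⟨X t, hS _ h1 OM, mem_filter.2
        ⟨hz, _, _, Pth.nil _⟩⟩
    have p := W.pth t (t + (j * (4 * k) + 1)) OM h2 fun s _ hs => W.stp s OM
    rw [Nat.add_sub_cancel_left, h3] at p
    refine mem_biUnion.2 ⟨X (t + 1), hS _ OM OM, mem_filter.2
        ⟨hz, X (t + (j * (4 * k) + 1)), ?_⟩⟩
    have hbt : uu hk u (i + t) = b := by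
      have := congrArg List.head? h3
      simpa [win, List.range_succ_eq_map] using this
    generalize (G t)⁻¹ * G (t + (j * (4 * k) + 1)) = g at p
    cases p with
    | cons s p' =>
      have := H.det s (by rw [← hbt]; exact W.stp t OM)
      rw [← this.1]; exact ⟨_, p'⟩
  have := (card_le_card hsub).trans (card_biUnion_le_card_mul _ _ _ fun v hvS =>
    H.readcount ⟨_, hv, hv'⟩ j v (hSV hvS) b)
  rw [card_Wd] at this
  exact absurd hK (not_lt.2 (this.trans (Nat.mul_le_mul_right _ hSc)))
end
section

lemma ball_finite (R : ℕ) : Finite {x : FG k // x.norm ≤ R} := by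
  have h : Set.Finite {l : LW k | l.length ≤ R} := List.finite_length_le _ _
  exact (h.preimage (f := toWord) (toWord_injective.injOn)).subset
    (s := {x : FG k | x.norm ≤ R}) fun x hx => hx
lemma resfin (g : FG k) (hg : g ≠ 1) : ∃ (α : Type) (_ : Finite α) (ρ : FG k →* Equiv.Perm α),
    ρ g ≠ 1 := by
  classical
  refine ⟨{x : FG k // x.norm ≤ g.norm}, ball_finite _, ?_⟩
  have := ball_finite (k := k) g.norm
  let _ := Fintype.ofFinite {x : FG k // x.norm ≤ g.norm}
  let e : ∀ i : Fin k, {x : {x : FG k // x.norm ≤ g.norm} // (of i * x.1).norm ≤ g.norm} ≃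
      {x : {x : FG k // x.norm ≤ g.norm} // ((of i)⁻¹ * x.1).norm ≤ g.norm} := fun i =>
    { toFun := fun x => ⟨⟨of i * x.1.1, x.2⟩, by simpa using x.1.2⟩
      invFun := fun x => ⟨⟨(of i)⁻¹ * x.1.1, x.2⟩, by simpa using x.1.2⟩
      left_inv := fun x => by simp
      right_inv := fun x => by simp }
  let ρ : FG k →* Equiv.Perm {x : FG k // x.norm ≤ g.norm} :=
    lift fun i => (e i).extendSubtype
  have h1 : ∀ i (x y : {x : FG k // x.norm ≤ g.norm}), y.1 = of i * x.1 →
      ρ (of i) x = y := by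
    intro i x y h
    have hx : (of i * x.1).norm ≤ g.norm := h ▸ y.2
    have : ρ (of i) = (e i).extendSubtype := by simp [ρ]
    rw [this]
    refine (Equiv.extendSubtype_apply_of_mem (e i) x hx).trans ?_
    exact Subtype.ext h.symm
  have h2 : ∀ w : LW k, ∀ (y : {x : FG k // x.norm ≤ g.norm}), w.length ≤ g.norm →
      y.1 = mk w → ρ (mk w) ⟨1, by simp⟩ = y := by
    intro w
    induction w with
    | nil => intro y _ h; rw [← one_eq_mk] at *; simp [Subtype.ext_iff, h]
    | cons a w ih =>
      intro y hw hy
      have hl : w.length ≤ g.norm := by simp at hw; omega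
      have hw' : (mk w : FG k).norm ≤ g.norm := FreeGroup.norm_mk_le.trans hl
      have e1 : (mk (a :: w) : FG k) = lt a * mk w := by
        rw [lt, mul_mk]; rfl
      rw [e1, map_mul, Equiv.Perm.mul_apply, ih ⟨_, hw'⟩ hl rfl]
      rw [e1] at hy
      obtain ⟨i, s⟩ := a
      cases s
      · have : lt (i, false) = (of i)⁻¹ := rfl
        rw [this] at hy ⊢
        rw [map_inv, Equiv.Perm.inv_eq_iff_eq, h1]
        rw [hy]; simp
      · exact h1 i _ _ hy
  refine ⟨ρ, fun h => hg ?_⟩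
  have := h2 g.toWord ⟨g, le_rfl⟩ le_rfl mk_toWord.symm
  rw [mk_toWord, h] at this
  exact (congrArg Subtype.val this).symm
lemma hopf (f : FG k →* FG k) (hf : Function.Surjective f) : Function.Injective f := by
  rw [injective_iff_map_eq_one]
  intro g hg
  by_contra h1
  obtain ⟨α, _, ρ, hρ⟩ := resfin g h1
  have : Finite (FG k →* Equiv.Perm α) := Finite.of_equiv _ (lift (α := Fin k))
  have hi : Function.Injective fun σ : FG k →* Equiv.Perm α => σ.comp f := fun σ σ' h =>
    (MonoidHom.cancel_right hf).1 h
  obtain ⟨σ, hσ⟩ := Finite.surjective_of_injective hi ρ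
  apply hρ
  rw [← hσ]
  simp [hg]
structure Gd (hk : 0 < k) (m j B : ℕ) (u : LW k) : Prop where
  ne : u ≠ []
  cyc : CyclicallyReducedWord u
  p1 : P1 hk m u
  hm : 1 ≤ m
  ln : Ln k u.length m (FreeGroup.mk u) (pp u)
  p2 : P2 hk B (j * (4 * k) + 1) u
  hB : 18 * m + 4 + (j * (4 * k) + 1) ≤ B
  hK : (2 * k - 2) * (2 * k * (10 * m + 3)) * ((2 * k - 1) ^ (4 * k) - 1) ^ j <
      (2 * k - 1) ^ (j * (4 * k))
  k2 : 2 ≤ k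
variable {hk : 0 < k} {m j B : ℕ} {u : LW k}
lemma Gd.hone (D : Gd hk m j B u) (a : Letter k) :
    (QuotientGroup.mk (lt a) : OneRel k (FreeGroup.mk u)) ≠ 1 := by
  intro h
  rw [QuotientGroup.eq_one_iff] at h
  have hl : (lt a).norm = 1 := lt_norm a
  obtain ⟨y, z, g, _, _, h1, h2, h3⟩ := greendlinger D.ln h (by rintro e; rw [e] at hl; simp at hl)
  have e : td 1 (lt a) = 1 := by rw [td_one_left, hl]
  have := D.ln.hn
  have := D.ln.hm
  unfold bw at h1 h2
  have := td_tri y 1 z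
  rw [td_comm y 1] at this
  omega
lemma exists_min {Q : Type} [Group Q] {w : FG k} {q : Q →* OneRel k w} {r : ℕ}
    (h : ∃ E V, Valid q r E V) : ∃ E V, Valid q r E V ∧ ∀ E' V', Valid q r E' V' → E.card ≤ E'.card := by
  classical
  have hex : ∃ c, ∃ E V, Valid q r E V ∧ E.card = c := by
    obtain ⟨E, V, h⟩ := h; exact ⟨_, E, V, h, rfl⟩
  obtain ⟨E, V, h1, h2⟩ := find_spec hex
  exact ⟨E, V, h1, fun E' V' h' => h2 ▸ find_min' hex ⟨E', V', h', rfl⟩⟩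
lemma Gd.thm1 (D : Gd hk m j B u) {r : ℕ} (hr : r < k) {E : Finset (Ed k (OneRel k (FreeGroup.mk u)))}
    {V : Finset ℕ} (hv : Valid (MonoidHom.id (OneRel k (FreeGroup.mk u))) r E V) : False := by
  obtain ⟨E, V, h1, h2⟩ := exists_min ⟨E, V, hv⟩
  have H : MinG (MonoidHom.id (OneRel k (FreeGroup.mk u))) r E V :=
    { toValid := h1, min := h2, hq := fun x => ⟨x, rfl⟩, hone := D.hone, hk := D.k2, hr := hr.le
      nd := fun s i t m m' e e' => (h1.lab _ _ _ _ e).trans (h1.lab _ _ _ _ e').symm }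
  have := (H.full (H.isfull D.ne D.cyc D.p1 D.hm D.ln D.p2 D.hB D.hK)).1
  omega
lemma init_valid {w : FG k} {q : FG k →* OneRel k w} (hq : Function.Surjective q) :
    ∃ E V, Valid q k E V := by
  classical
  have key : ∀ s : Finset (Fin k), ∃ E V, Lab q E V ∧ 0 ∈ V ∧ E.card + 1 ≤ V.card + s.card ∧
      (∀ i ∈ s, ∃ w, Pth E 0 w 0 (of i)) ∧ ∀ v ∈ V, ∃ w μ, Pth E v w 0 μ := by
    intro s
    induction s using Finset.induction_on with
    | empty =>
      refine ⟨∅, {0}, ⟨by simp, by simp⟩, by simp, by simp, by simp, ?_⟩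
      intro v hv
      rw [mem_singleton.1 hv]; exact ⟨_, _, Pth.nil 0⟩
    | insert i s hi ih =>
      obtain ⟨E, V, h1, h2, h3, h4, h5⟩ := ih
      obtain ⟨g, hg⟩ := QuotientGroup.mk_surjective (q (of i))
      obtain ⟨E', V', a1, a2, a3, a4, a5, a6, a7⟩ := add_arc hq (g.toWord ++ [(i, true), (i, false)])
        (by simp) E V h1 0 h2 0 h2 (of i) (by
          rw [← mul_mk, mk_toWord, ← hg]
          congr 1
          have : (mk [(i, true), (i, false)] : FG k) = lt (i, true) * (lt (i, true))⁻¹ := rfl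
          rw [this]; simp)
      refine ⟨E', V', a1, a3 h2, ?_, ?_, ?_⟩
      · rw [card_insert_of_notMem hi]; omega
      · intro i' hi'
        rcases mem_insert.1 hi' with rfl | hi'
        · exact ⟨_, a6⟩
        · obtain ⟨w, hw⟩ := h4 _ hi'
          exact ⟨_, hw.mono a2⟩
      · intro v hv
        obtain ⟨v0, hv0, w, μ, hw⟩ := a7 v hv
        obtain ⟨w', μ', hw'⟩ := h5 v0 hv0
        exact ⟨_, _, hw.append (hw'.mono a2)⟩
  obtain ⟨E, V, h1, h2, h3, h4, h5⟩ := key univ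
  refine ⟨E, V, h1, ⟨0, h2⟩, ?_, by simpa using h3⟩
  refine conn_of_base (V0 := {0}) (x0 := 0) ?_ (fun v hv => ⟨0, by simp, h5 v hv⟩)
  intro x hx g
  rw [mem_singleton.1 hx]
  induction g using FreeGroup.induction_on with
  | C1 => exact ⟨_, Pth.nil 0⟩
  | of i => exact h4 i (mem_univ _)
  | inv_of i h => exact h.elim fun w h => h.rev
  | mul x y h h' =>
    obtain ⟨w, h⟩ := h
    obtain ⟨w', h'⟩ := h'
    exact ⟨_, h.append h'⟩
theorem Gd.thm2 (D : Gd hk m j B u) {q : FG k →* OneRel k (FreeGroup.mk u)}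
    (hq : Function.Surjective q) : ∃ θ : FG k ≃* FG k, ∀ x, q (θ x) = QuotientGroup.mk x := by
  classical
  obtain ⟨E, V, h1, h2⟩ := exists_min (init_valid hq)
  have H : MinG q k E V :=
    { toValid := h1, min := h2, hq := hq, hone := D.hone, hk := D.k2, hr := le_rfl
      nd := by
        intro s i t m1 m2 e1 e2
        by_contra hne
        let F : Ed k (FG k) → Ed k (OneRel k (FreeGroup.mk u)) := fun e => (e.1, e.2.1, e.2.2.1, q e.2.2.2)
        have hF : (E.image F).card < E.card := by
          refine lt_of_le_of_ne card_image_le fun h => hne ?_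
          have := Finset.card_image_iff.1 h e1 e2 (by
            simp only [F, h1.lab _ _ _ _ e1, h1.lab _ _ _ _ e2])
          simpa using this
        have hS : ∀ {x y : ℕ} {w : LW k} {μ : FG k}, Pth E x w y μ →
            Pth (E.image F) x w y (q μ) := by
          intro x y w μ hp
          induction hp with
          | nil x => simpa using Pth.nil x
          | cons s p ih =>
            rw [map_mul]
            refine Pth.cons ?_ ih
            unfold Stp at *
            split_ifs at * with hs
            · exact mem_image.2 ⟨_, s, rfl⟩
            · exact mem_image.2 ⟨_, s, by simp [F]⟩
        refine D.thm1 (r := k - 1) OM (E := E.image F) (V := V) ⟨⟨?_, ?_⟩, h1.ne, ?_, ?_⟩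
        · intro s i t m h
          obtain ⟨⟨s', i', t', m'⟩, he, hee⟩ := mem_image.1 h
          simp only [F, Prod.mk.injEq] at hee
          obtain ⟨rfl, rfl, rfl, rfl⟩ := hee
          exact h1.ends _ _ _ _ he
        · intro s i t m h
          obtain ⟨⟨s', i', t', m'⟩, he, hee⟩ := mem_image.1 h
          simp only [F, Prod.mk.injEq] at hee
          obtain ⟨rfl, rfl, rfl, rfl⟩ := hee
          exact h1.lab _ _ _ _ he
        · intro x hx y hy g
          obtain ⟨g, rfl⟩ := hq g
          obtain ⟨w, hw⟩ := h1.conn x hx y hy g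
          exact ⟨w, hS hw⟩
        · have := h1.card; omega }
  have hf := H.isfull D.ne D.cyc D.p1 D.hm D.ln D.p2 D.hB D.hK
  obtain ⟨v, rfl⟩ := (H.full hf).2
  have hl : ∀ a : Letter k, ∃ μ, Stp E v a v μ := by
    intro a
    have : a ∈ lv E v := by rw [hf v (by simp)]; simp
    obtain ⟨y, μ, hs⟩ := mem_lv.1 this
    have := (H.stp hs).2.1
    rw [mem_singleton.1 this] at hs
    exact ⟨μ, hs⟩
  choose μ hμ using fun i : Fin k => hl (i, true)
  let θ : FG k →* FG k := lift μ
  have hθ : ∀ {x y : ℕ} {w : LW k} {g : FG k}, Pth E x w y g → θ (FreeGroup.mk w) = g := by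
    intro x y w g hp
    induction hp with
    | nil x => rw [← FreeGroup.one_eq_mk, map_one]
    | @cons x y z a w g g' s p ih =>
      have e1 : (FreeGroup.mk (a :: w) : FG k) = lt a * FreeGroup.mk w := by
        rw [lt, mul_mk]; rfl
      rw [e1, map_mul, ih]
      congr 1
      have h3 := H.stp s
      rw [mem_singleton.1 h3.1, mem_singleton.1 h3.2.1] at s
      obtain ⟨i, b⟩ := a
      cases b
      · have e2 : lt (i, false) = (of i)⁻¹ := rfl
        rw [e2, map_inv, (H.det s (hμ i).rev).2]
        simp [θ]
      · have e2 : lt (i, true) = of i := rfl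
        rw [e2, (H.det s (hμ i)).2]
        simp [θ]
  have hs : Function.Surjective θ := fun g => by
    obtain ⟨w, hw⟩ := h1.conn v (by simp) v (by simp) g
    exact ⟨_, hθ hw⟩
  refine ⟨MulEquiv.ofBijective θ ⟨hopf θ hs, hs⟩, ?_⟩
  have : q.comp θ = QuotientGroup.mk' _ := by
    apply ext_hom
    intro i
    have := (H.stp (hμ i)).2.2
    simp only [θ, MonoidHom.comp_apply, lift_apply_of]
    exact this
  exact fun x => DFunLike.congr_fun this x
end
section

lemma bw_join {h w b a : FG k} (h1 : bw h w b) (h2 : bw w b a) (h3 : w ≠ b) :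
    bw h b a ∧ bw h w a := by
  have := fp h b w a
  have := tr h b a
  have := tr h w a
  have h4 : td w b ≠ 0 := fun e => h3 (td_zero.1 e)
  unfold bw at *
  simp only [td_comm b w, td_comm b h, td_comm w h, td_comm a b] at *
  omega
lemma dir (x y : FG k) (a : Letter k) : td (x * lt a) y = td x y + 1 ∨
    td (x * lt a) y + 1 = td x y := by
  have h1 := td_lt x a
  have h2 := tr x (x * lt a) y
  obtain ⟨c, hc⟩ := td_even x (x * lt a) y
  omega
lemma dir_unique {x y : FG k} {a b : Letter k} (ha : td (x * lt a) y + 1 = td x y)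
    (hb : td (x * lt b) y + 1 = td x y) : a = b := by
  have h1 := td_lt x a
  have h2 := td_lt x b
  have := geo_unique (x := x) (y := y) (z := x * lt a) (w := x * lt b) OM OM
    OM
  exact lt_inj (mul_left_cancel this)
lemma dir_ex {x y : FG k} (h : x ≠ y) : ∃ a : Letter k, td (x * lt a) y + 1 = td x y := by
  have h4 : td x y ≠ 0 := fun e => h (td_zero.1 e)
  obtain ⟨z, h1, h2⟩ := geo_exists x y 1 OM
  obtain ⟨a, rfl⟩ := td_one h1
  exact ⟨a, OM⟩
lemma avoid (k2 : 2 ≤ k) (x y z : FG k) : ∃ a : Letter k,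
    td (x * lt a) y = td x y + 1 ∧ td (x * lt a) z = td x z + 1 := by
  by_contra hc
  push Not at hc
  have h : ∀ a : Letter k, td (x * lt a) y + 1 = td x y ∨ td (x * lt a) z + 1 = td x z := by
    intro a
    have := dir x y a
    have := dir x z a
    have := hc a
    omega
  have n1 : ((⟨0, OM⟩, true) : Letter k) ≠ (⟨0, OM⟩, false) := by simp
  have n2 : ((⟨0, OM⟩, true) : Letter k) ≠ (⟨1, OM⟩, false) := by simp
  have n3 : ((⟨0, OM⟩, false) : Letter k) ≠ (⟨1, OM⟩, false) := by simp
  rcases h (⟨0, OM⟩, true) with h1 | h1 <;> rcases h (⟨0, OM⟩, false) with h2 | h2 <;>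
    rcases h (⟨1, OM⟩, false) with h3 | h3 <;>
    first
    | exact n1 (dir_unique h1 h2)
    | exact n2 (dir_unique h1 h3)
    | exact n3 (dir_unique h2 h3)
def Out (x y : FG k) : Set (FG k) := {h | bw h x y}
def AC (X : FG k → Bool) (S : Set (FG k)) (c : Bool) : Prop := {h | h ∈ S ∧ X h ≠ c}.Finite
def Loc (X : FG k → Bool) (x y : FG k) : Prop := ∃ c, AC X (Out x y) c ∧ AC X (Out y x) (!c)
lemma AC.mono {X : FG k → Bool} {S T : Set (FG k)} {c : Bool} (h : AC X T c) (hs : S ⊆ T) :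
    AC X S c := Set.Finite.subset h fun _ hh => ⟨hs hh.1, hh.2⟩
lemma AC.union {X : FG k → Bool} {S T : Set (FG k)} {c : Bool} (h : AC X T c) (h' : AC X S c) :
    AC X (T ∪ S) c := (Set.Finite.union h h').subset fun x hx => by
  rcases hx with ⟨h1 | h1, h2⟩
  · exact Or.inl ⟨h1, h2⟩
  · exact Or.inr ⟨h1, h2⟩
lemma AC.not {X : FG k → Bool} {S : Set (FG k)} {c d : Bool} (h : AC X S c) (h' : AC X S d)
    (hS : S.Infinite) : c = d := by
  by_contra hcd
  refine hS ((Set.Finite.union h h').subset fun x hx => ?_)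
  by_cases hx' : X x = c
  · exact Or.inr ⟨hx, hx' ▸ hcd⟩
  · exact Or.inl ⟨hx, hx'⟩
lemma Loc.symm {X : FG k → Bool} {x y : FG k} (h : Loc X x y) : Loc X y x := by
  obtain ⟨c, h1, h2⟩ := h
  exact ⟨!c, h2, by simpa using h1⟩
lemma Out_inf (k2 : 2 ≤ k) (x y : FG k) : (Out x y).Infinite := by
  intro hf
  have hne : (hf.toFinset).Nonempty := ⟨x, by simp [Out, bw, td_self]⟩
  obtain ⟨h, hh, hm⟩ := hf.toFinset.exists_max_image (fun h => td h y) hne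
  obtain ⟨a, ha, -⟩ := avoid k2 h y y
  have h1 : bw h x y := by simpa [Out] using hh
  have : h * lt a ∈ hf.toFinset := by
    simp only [Set.Finite.mem_toFinset, Out, mem_ofPred_eq]
    have h2 := td_lt h a
    have := tr (h * lt a) h x
    have := tr (h * lt a) x y
    simp only [bw, td_comm (h * lt a) h] at *
    omega
  have := hm _ this
  omega
lemma out_sub {w b a : FG k} (h2 : bw w b a) (h3 : w ≠ b) : Out w b ⊆ Out b a :=
  fun _ hh => (bw_join hh h2 h3).1
lemma conf (k2 : 2 ≤ k) {X : FG k → Bool} {A B A' B' : FG k} {v : Bool}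
    (h1 : AC X (Out B A) v) (h2 : AC X (Out A' B') (!v)) : ¬ bw B A' B' := by
  intro hb
  obtain ⟨a, ha, ha'⟩ := avoid k2 B A B'
  have e := td_lt B a
  have hne : B * lt a ≠ B := fun h => by rw [h, td_self] at e; omega
  have s1 : Out (B * lt a) B ⊆ Out B A := out_sub (by unfold bw; rw [td_comm _ B]; omega) hne
  have s2 : Out (B * lt a) B ⊆ Out A' B' := fun h hh =>
    bw_symm (bw_trans (bw_symm (out_sub (by unfold bw; rw [td_comm _ B]; omega) hne hh :
      bw h B B')) (bw_symm hb))
  have := AC.not (h1.mono s1) (h2.mono s2) (Out_inf k2 _ _)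
  cases v <;> simp at this
lemma loss {n m : ℕ} {u : FG k} {p : ℤ → FG k} (k2 : 2 ≤ k) (H : Ln k n m u p) {a b : ℤ}
    (hab : (a - b).natAbs < n) {X : FG k → Bool} {x : FG k} {v : Bool} (T : Finset (FG k))
    (hT : ∀ h ∈ T, bw x (h * p a) (h * p b) ∧ AC X (Out (h * p a) (h * p b)) (!v) ∧
      AC X (Out (h * p b) (h * p a)) v) : T.card ≤ m + 1 := by
  classical
  rcases T.eq_empty_or_nonempty with rfl | hne
  · simp
  have key : ∀ h ∈ T, ∀ h' ∈ T, bw x (h' * p a) (h * p b) := by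
    intro h hh h' hh'
    rcases bw_sub (h * p b) (hT h' hh').1 with h1 | h1
    · exact h1
    · exact (conf k2 (hT h hh).2.2 (hT h' hh').2.1 h1).elim
  obtain ⟨hm, hmT, hmax⟩ := T.exists_max_image (fun h => td x (h * p a)) hne
  obtain ⟨hi, hiT, hmin⟩ := T.exists_min_image (fun h => td x (h * p a)) hne
  have inj : ∀ h ∈ T, ∀ h' ∈ T, td x (h * p a) = td x (h' * p a) → h = h' := fun h hh h' hh' e =>
    mul_right_cancel (geo_unique (key h hh h hh) (key h hh h' hh') e)
  have near : ∀ h ∈ T, h ≠ hi → td x (hm * p a) < td x (h * p a) + m := by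
    intro h' hh' hne'
    by_contra hc
    have b1 := key hi hiT hi hiT
    have b2 := key hi hiT h' hh'
    have b3 := key hi hiT hm hmT
    have b4 := key h' hh' h' hh'
    have b5 := key h' hh' hm hmT
    have l1 := hmin h' hh'
    have l2 := hmax h' hh'
    have c1 := fp x (h' * p a) (hi * p a) (hi * p b)
    have c2 := fp x (hm * p a) (hi * p a) (hi * p b)
    have c3 := fp x (h' * p a) (hm * p a) (hi * p b)
    have c4 := fp x (hm * p a) (h' * p a) (h' * p b)
    have t1 := tr (hi * p a) (h' * p a) (hi * p b)
    have t2 := tr (hi * p a) (hm * p a) (hi * p b)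
    have t3 := tr (h' * p a) (hm * p a) (h' * p b)
    have t4 := tr (h' * p a) (hm * p a) x
    have q1 : bw (hi * p a) (h' * p a) (hi * p b) := by
      unfold bw at *
      simp only [td_comm (h' * p a) (hi * p a), td_comm (hm * p a) (hi * p a)] at *
      omega
    have q2 : bw (hi * p a) (hm * p a) (hi * p b) := by
      unfold bw at *
      simp only [td_comm (h' * p a) (hi * p a), td_comm (hm * p a) (hi * p a)] at *
      omega
    have q3 : bw (h' * p a) (hm * p a) (h' * p b) := by
      unfold bw at *
      simp only [td_comm (h' * p a) (hi * p a), td_comm (hm * p a) (h' * p a)] at *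
      omega
    obtain ⟨i, hi1⟩ := H.ax_conv (g := hi) ⟨a, rfl⟩ ⟨b, rfl⟩ q1
    obtain ⟨i', hi2⟩ := H.ax_conv (g := hi) ⟨a, rfl⟩ ⟨b, rfl⟩ q2
    obtain ⟨j, hj⟩ := H.ax_conv (g := h') ⟨a, rfl⟩ ⟨b, rfl⟩ q3
    have d1 : td (h' * p a) (hm * p a) = (i - i').natAbs := by rw [hi1, hi2, td_left, H.dist]
    obtain ⟨t, ht⟩ := H.sep (h'⁻¹ * hi) i a i' j (by rw [mul_assoc, ← hi1]; group)
      (by rw [mul_assoc, ← hi2, hj]; group) (by simp only [td_comm _ x] at *; omega)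
    have ht' : hi = h' * u ^ t := by rw [← ht]; group
    have d2 : td (hi * p a) (h' * p a) = (a + n * t - a).natAbs := by
      rw [ht', mul_assoc, ← H.perz, td_left, H.dist]
    have d3 : td (hi * p a) (hi * p b) = (a - b).natAbs := by rw [td_left, H.dist]
    have : t = 0 := by
      unfold bw at q1
      rw [add_sub_cancel_left, Int.natAbs_mul, Int.natAbs_natCast] at d2
      by_contra h0
      have : 1 ≤ t.natAbs := OM
      have := Nat.mul_le_mul_left n this
      omega
    rw [this] at ht'; simp at ht'; exact hne' ht'.symm
  have : (T.erase hi).card ≤ (Icc (td x (hm * p a) + 1 - m) (td x (hm * p a))).card := by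
    refine card_le_card_of_injOn (fun h => td x (h * p a)) (fun h hh => ?_) ?_
    · have h1 := near h (mem_of_mem_erase hh) (Finset.ne_of_mem_erase hh)
      have h2 := hmax h (mem_of_mem_erase hh)
      simp only [Finset.coe_Icc, Set.mem_Icc]
      exact ⟨by omega, h2⟩
    · intro h hh h' hh' e
      exact inj h (mem_of_mem_erase hh) h' (mem_of_mem_erase hh') e
  rw [card_erase_of_mem hiT, Nat.card_Icc] at this
  omega
lemma loss' {n m : ℕ} {u : FG k} {p : ℤ → FG k} (k2 : 2 ≤ k) (H : Ln k n m u p) {a b : ℤ}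
    (hab : (a - b).natAbs < n) {X : FG k → Bool} {x : FG k} {v : Bool} (T : Set (FG k))
    (hT : ∀ h ∈ T, bw x (h * p a) (h * p b) ∧ AC X (Out (h * p a) (h * p b)) (!v) ∧
      AC X (Out (h * p b) (h * p a)) v) : T.Finite ∧ T.ncard ≤ m + 1 := by
  have hf : T.Finite := by
    by_contra hc
    obtain ⟨t, ht, hcard⟩ := Set.Infinite.exists_subset_card_eq hc (m + 2)
    have := loss k2 H hab t fun h hh => hT h (ht hh)
    omega
  refine ⟨hf, ?_⟩
  rw [ncard_eq_toFinset_card _ hf]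
  exact loss k2 H hab _ fun h hh => hT h (by simpa using hh)
end
structure Tn (k n m : ℕ) (u : FG k) (p : ℤ → FG k) (e f : ℤ → Letter k) (a b : ℤ) (lo hi : ℕ) :
    Prop where
  H : Ln k n m u p
  k2 : 2 ≤ k
  he : ∀ i, p (i - 1) = p i * lt (e i)
  hf : ∀ i, p (i + 1) = p i * lt (f i)
  hab : a < b
  hbn : b - a < n
  tc : ∀ c d, c ≠ d → lo ≤ ((Ioo a b).filter fun i => (e i, f i) = (c, d)).card ∧
    ((Ioo a b).filter fun i => (e i, f i) = (c, d)).card ≤ hi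
section
variable {n m : ℕ} {u : FG k} {p : ℤ → FG k} {e f : ℤ → Letter k} {a b : ℤ} {lo hi : ℕ}
lemma AC_star {X : FG k → Bool} {x : FG k} {c : Bool} {S : Set (FG k)} (P : Letter k → Prop)
    (hP : ∀ a, P a → AC X (Out (x * lt a) x) c)
    (hS : ∀ h ∈ S, h ≠ x → ∃ a, P a ∧ h ∈ Out (x * lt a) x) : AC X S c := by
  classical
  have : (⋃ a : {a // P a}, {h | h ∈ Out (x * lt a.1) x ∧ X h ≠ c}).Finite :=
    finite_iUnion fun a => hP a.1 a.2
  refine (this.union (Set.finite_singleton x)).subset fun h hh => ?_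
  by_cases hx : h = x
  · exact Or.inr hx
  · obtain ⟨a, ha, ha'⟩ := hS h hh.1 hx
    exact Or.inl (mem_iUnion.2 ⟨⟨a, ha⟩, ha', hh.2⟩)
lemma mem_cone {x h : FG k} {a : Letter k} : h ∈ Out (x * lt a) x ↔ td (x * lt a) h + 1 = td x h := by
  have := td_lt x a
  simp only [Out, mem_ofPred_eq, bw, td_comm _ x, td_comm h]
  omega
lemma cone_disj {x h : FG k} {a b : Letter k} (h1 : h ∈ Out (x * lt a) x)
    (h2 : h ∈ Out (x * lt b) x) : a = b := dir_unique (mem_cone.1 h1) (mem_cone.1 h2)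
lemma out_cone {x A B : FG k} {α : Letter k} (h : A ∈ Out (x * lt α) x) (hn : ¬ bw x A B) :
    Out A B ⊆ Out (x * lt α) x := by
  intro y hy
  rcases bw_sub x hy with h1 | h1
  · exact bw_symm (bw_trans (bw_symm h1) (bw_symm h))
  · exact (hn h1).elim
lemma bw_of_dirs {x A B : FG k} {α γ : Letter k} (hA : A ∈ Out (x * lt α) x)
    (hB : B ∈ Out (x * lt γ) x) (h : α ≠ γ) : bw A x B := by
  have h1 : ¬ td (x * lt α) B + 1 = td x B := fun hc => h (cone_disj (mem_cone.2 hc) hB)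
  have h2 := td_lt x α
  refine (bw_join (w := x * lt α) hA ?_ ?_).1
  · have := dir x B α
    unfold bw; rw [td_comm _ x]; omega
  · intro e; rw [e, td_self] at h2; omega
lemma AC.congr {X Y : FG k → Bool} {S : Set (FG k)} {c : Bool} (h : AC X S c)
    (hs : ∀ h ∈ S, X h = Y h) : AC Y S c :=
  Set.Finite.subset h fun x hx => ⟨hx.1, by rw [hs x hx.1]; exact hx.2⟩
noncomputable def trn (p : ℤ → FG k) (e f : ℤ → Letter k) (a b : ℤ) (x : FG k)
    (R : Finset (Letter k × Letter k)) : Finset (FG k) :=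
  ((Ioo a b).filter fun i => (e i, f i) ∈ R).image fun i => x * (p i)⁻¹
namespace Tn
lemma inj (T : Tn k n m u p e f a b lo hi) {i j : ℤ} (h : p i = p j) : i = j := by
  have := T.H.dist i j
  rw [h, td_self] at this; omega
lemma trn_card (T : Tn k n m u p e f a b lo hi) (x : FG k) (R : Finset (Letter k × Letter k))
    (hR : ∀ r ∈ R, r.1 ≠ r.2) : R.card * lo ≤ (trn p e f a b x R).card ∧
    (trn p e f a b x R).card ≤ R.card * hi := by
  have : (trn p e f a b x R).card = ∑ r ∈ R, ((Ioo a b).filter fun i => (e i, f i) = r).card := by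
    rw [trn, card_image_of_injective _ fun i j h => T.inj (by simpa using h),
      Finset.card_eq_sum_card_fiberwise (t := R) (f := fun i => (e i, f i)) (fun i hi => by
        simpa using (mem_filter.1 hi).2)]
    refine sum_congr rfl fun r hr => ?_
    congr 1; ext i
    simp only [mem_filter]
    constructor
    · rintro ⟨⟨h1, h2⟩, h3⟩; exact ⟨h1, h3⟩
    · rintro ⟨h1, h3⟩; exact ⟨⟨h1, h3 ▸ hr⟩, h3⟩
  rw [this]
  constructor
  · rw [← smul_eq_mul]
    exact Finset.card_nsmul_le_sum _ _ _ fun r hr => (T.tc r.1 r.2 (hR r hr)).1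
  · rw [← smul_eq_mul]
    exact Finset.sum_le_card_nsmul _ _ _ fun r hr => (T.tc r.1 r.2 (hR r hr)).2
lemma pass (T : Tn k n m u p e f a b lo hi) {x : FG k} {i : ℤ} (hi : i ∈ Ioo a b) :
    Out (x * (p i)⁻¹ * p a) (x * (p i)⁻¹ * p b) ⊆ Out (x * lt (e i)) x ∧
    Out (x * (p i)⁻¹ * p b) (x * (p i)⁻¹ * p a) ⊆ Out (x * lt (f i)) x := by
  have e1 : x * lt (e i) = x * (p i)⁻¹ * p (i - 1) := by rw [T.he]; group
  have e2 : x * lt (f i) = x * (p i)⁻¹ * p (i + 1) := by rw [T.hf]; group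
  have e3 : x = x * (p i)⁻¹ * p i := by group
  rw [e1, e2]; nth_rw 4 [e3]; nth_rw 8 [e3]
  generalize x * (p i)⁻¹ = g
  rw [mem_Ioo] at hi
  have D : ∀ i j, td (g * p i) (g * p j) = (i - j).natAbs := fun i j => by rw [td_left, T.H.dist]
  constructor
  · intro h hh
    simp only [Out, bw, mem_ofPred_eq, D] at hh ⊢
    have t1 := tr h (g * p a) (g * p (i - 1))
    have t2 := tr h (g * p b) (g * p i)
    have t3 := tr h (g * p (i - 1)) (g * p i)
    simp only [D] at *
    omega
  · intro h hh
    simp only [Out, bw, mem_ofPred_eq, D] at hh ⊢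
    have t1 := tr h (g * p b) (g * p (i + 1))
    have t2 := tr h (g * p a) (g * p i)
    have t3 := tr h (g * p (i + 1)) (g * p i)
    simp only [D] at *
    omega
lemma loc (T : Tn k n m u p e f a b lo hi) {X : FG k → Bool} {x : FG k}
    {R : Finset (Letter k × Letter k)}
    (hR : ∀ r ∈ R, ∃ c, AC X (Out (x * lt r.1) x) c ∧ AC X (Out (x * lt r.2) x) (!c))
    {h : FG k} (hh : h ∈ trn p e f a b x R) : Loc X (h * p a) (h * p b) := by
  obtain ⟨i, hi, rfl⟩ := mem_image.1 hh
  obtain ⟨hi, hr⟩ := mem_filter.1 hi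
  obtain ⟨c, h1, h2⟩ := hR _ hr
  exact ⟨c, h1.mono (T.pass hi).1, h2.mono (T.pass hi).2⟩
lemma turn (T : Tn k n m u p e f a b lo hi) {x h : FG k} {α γ : Letter k}
    (hA : h * p a ∈ Out (x * lt α) x) (hB : h * p b ∈ Out (x * lt γ) x) (hne : α ≠ γ)
    {R : Finset (Letter k × Letter k)} : h ∈ trn p e f a b x R ↔ (α, γ) ∈ R := by
  have D : ∀ i j, td (h * p i) (h * p j) = (i - j).natAbs := fun i j => by rw [td_left, T.H.dist]
  have hb := bw_of_dirs hA hB hne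
  obtain ⟨i, hi⟩ := T.H.ax_conv (g := h) ⟨a, rfl⟩ ⟨b, rfl⟩ hb
  have hA' := mem_cone.1 hA
  have hB' := mem_cone.1 hB
  have hI : i ∈ Ioo a b := by
    rw [hi] at hA' hB' hb
    simp only [bw, D] at *
    have := T.hab
    rw [mem_Ioo]; omega
  have hh : h = x * (p i)⁻¹ := by rw [hi]; group
  have ps := T.pass (x := x) hI
  rw [← hh] at ps
  have e1 : e i = α := cone_disj (ps.1 (by simp [Out, bw, td_self])) hA
  have e2 : f i = γ := cone_disj (ps.2 (by simp [Out, bw, td_self])) hB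
  constructor
  · intro hm
    obtain ⟨j, hj, hj'⟩ := mem_image.1 hm
    have : j = i := T.inj (by rw [hh] at hj'; simpa using hj')
    subst this
    rw [← e1, ← e2]; exact (mem_filter.1 hj).2
  · intro hm
    exact mem_image.2 ⟨i, mem_filter.2 ⟨hI, by rw [e1, e2]; exact hm⟩, hh.symm⟩
end Tn
end
section
variable {n m : ℕ} {u : FG k} {p : ℤ → FG k} {e f : ℤ → Letter k} {a b : ℤ} {lo hi : ℕ}
open Classical in
noncomputable def modX (x : FG k) (P : Finset (Letter k)) (v : Bool) (X : FG k → Bool) : FG k → Bool :=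
  fun h => if ∃ c ∈ P, h ∈ Out (x * lt c) x then !v else X h
def NX (p : ℤ → FG k) (a b : ℤ) (X : FG k → Bool) : Set (FG k) := {h | Loc X (h * p a) (h * p b)}
def MX (X : FG k → Bool) : Set (FG k) := {x | ∀ c, ¬ AC X (Out x 1) c}
lemma modX_out {x : FG k} {P : Finset (Letter k)} {v : Bool} {X : FG k → Bool} {c : Letter k}
    (hc : c ∉ P) {h : FG k} (hh : h ∈ Out (x * lt c) x) : modX x P v X h = X h := by
  rw [modX, if_neg]
  rintro ⟨c', h1, h2⟩
  exact hc (cone_disj h2 hh ▸ h1)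
lemma modX_P {x : FG k} {P Q : Finset (Letter k)} {v : Bool} {X : FG k → Bool}
    (hQ : ∀ c ∈ Q, AC X (Out (x * lt c) x) (!v)) {c : Letter k} (hc : c ∈ P ∨ c ∈ Q) :
    AC (modX x P v X) (Out (x * lt c) x) (!v) := by
  by_cases h : c ∈ P
  · refine Set.Finite.subset finite_empty ?_
    rintro y ⟨h1, h2⟩
    refine h2 ?_
    rw [modX, if_pos ⟨c, h, h1⟩]
  · exact (hQ c (hc.resolve_left h)).congr fun y hy => (modX_out h hy).symm
lemma Tn.mixed (T : Tn k n m u p e f a b lo hi) {X : FG k → Bool} {x : FG k} {d : Letter k} {v : Bool}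
    {P Q : Finset (Letter k)} (hP : ∀ c ∈ P, AC X (Out (x * lt c) x) v)
    (hQ : ∀ c ∈ Q, AC X (Out (x * lt c) x) (!v)) (hd : ∀ c, c ∈ P ∨ c ∈ Q ∨ c = d) (hdP : d ∉ P)
    (hdQ : d ∉ Q) (hPQ : Disjoint P Q) (hQ2 : 2 ≤ Q.card) (hN : (NX p a b X).Finite) :
    (NX p a b (modX x P v X)).Finite ∧ (NX p a b (modX x P v X)).ncard + 2 * (P.card * Q.card) * lo ≤
      (NX p a b X).ncard + 2 * P.card * hi + 2 * (m + 1) := by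
  classical
  have dne : ∀ {c d}, c ∈ P → d ∈ Q → c ≠ d := fun hc hd h =>
    (disjoint_left.1 hPQ hc) (h ▸ hd)
  set X' := modX x P v X with hX'
  set R := P ×ˢ Q ∪ Q ×ˢ P with hR
  set R1 := P ×ˢ {d} ∪ {d} ×ˢ P with hR1
  have cR : R.card = 2 * (P.card * Q.card) := by
    rw [hR, card_union_of_disjoint, card_product, card_product]; ring
    rw [disjoint_left]
    rintro ⟨r, s⟩ h1 h2
    rw [mem_product] at h1 h2
    exact dne h1.1 h2.1 rfl
  have cR1 : R1.card ≤ 2 * P.card := by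
    refine (card_union_le _ _).trans ?_
    rw [card_product, card_product]; simp; omega
  have gain := (T.trn_card x R (by
    rintro ⟨r, s⟩ h
    rcases mem_union.1 h with h | h <;> rw [mem_product] at h
    exacts [dne h.1 h.2, (dne h.2 h.1).symm])).1
  have l1 := (T.trn_card x R1 (by
    rintro ⟨r, s⟩ h
    rcases mem_union.1 h with h | h <;> rw [mem_product, mem_singleton] at h
    · intro hh; simp only at hh h; exact hdP (h.2 ▸ hh ▸ h.1)
    · intro hh; simp only at hh h; exact hdP (h.1 ▸ hh ▸ h.2))).2
  have gsub : (↑(trn p e f a b x R) : Set (FG k)) ⊆ NX p a b X := fun h hh => by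
    refine T.loc (R := R) ?_ (mem_coe.1 hh)
    rintro ⟨r, s⟩ h
    rcases mem_union.1 h with h | h <;> rw [mem_product] at h
    · exact ⟨v, hP _ h.1, hQ _ h.2⟩
    · exact ⟨!v, hQ _ h.1, by simpa using hP _ h.2⟩
  have endc : ∀ A B, Loc X' A B → bw x A B → AC X' (Out A B) (!v) ∧ AC X' (Out B A) v := by
    rintro A B ⟨c, h1, h2⟩ hb
    obtain ⟨β, hβ, hβ'⟩ : ∃ β ∈ Q, ¬ td (x * lt β) B + 1 = td x B := by
      by_contra hc
      push Not at hc
      have := card_le_one.2 fun r hr s hs => dir_unique (hc r hr) (hc s hs)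
      omega
    have hs : Out (x * lt β) x ⊆ Out A B := fun y hy => by
      have ht := td_lt x β
      have h3 : bw y x B := (bw_join hy (by
        have := dir x B β
        unfold bw; rw [td_comm _ x]; omega) (by
        intro h; rw [h, td_self] at ht; omega)).1
      exact bw_symm (bw_trans (bw_symm h3) (bw_symm hb))
    have hc := (h1.mono hs).not (modX_P hQ (Or.inr hβ)) (Out_inf T.k2 _ _)
    rw [hc] at h1 h2
    exact ⟨h1, by simpa using h2⟩
  obtain ⟨f2, n2⟩ := loss' T.k2 T.H (a := a) (b := b) (by have := T.hab; have := T.hbn; omega)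
    (X := X') (x := x) (v := v) {h | Loc X' (h * p a) (h * p b) ∧ bw x (h * p a) (h * p b)}
    fun h hh => ⟨hh.2, endc _ _ hh.1 hh.2⟩
  obtain ⟨f3, n3⟩ := loss' T.k2 T.H (a := b) (b := a) (by have := T.hab; have := T.hbn; omega)
    (X := X') (x := x) (v := v) {h | Loc X' (h * p a) (h * p b) ∧ bw x (h * p b) (h * p a)}
    fun h hh => ⟨hh.2, endc _ _ hh.1.symm hh.2⟩
  set L2 := {h | Loc X' (h * p a) (h * p b) ∧ bw x (h * p a) (h * p b)}
  set L3 := {h | Loc X' (h * p a) (h * p b) ∧ bw x (h * p b) (h * p a)}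
  have sub : NX p a b X' ⊆ ((NX p a b X \ ↑(trn p e f a b x R)) ∪ ↑(trn p e f a b x R1)) ∪ (L2 ∪ L3) := by
    intro h hh
    by_cases b1 : bw x (h * p a) (h * p b)
    · exact Or.inr (Or.inl ⟨hh, b1⟩)
    by_cases b2 : bw x (h * p b) (h * p a)
    · exact Or.inr (Or.inr ⟨hh, b2⟩)
    left
    have xa : x ≠ h * p a := fun hx => b1 (by rw [hx]; simp [bw, td_self])
    have xb : x ≠ h * p b := fun hx => b2 (by rw [hx]; simp [bw, td_self])
    obtain ⟨α, hα⟩ := dir_ex xa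
    obtain ⟨γ, hγ⟩ := dir_ex xb
    rw [← mem_cone] at hα hγ
    have sα := out_cone hα b1
    have sγ := out_cone hγ b2
    obtain ⟨c, h1, h2⟩ := hh
    by_cases hb : (α ∈ P ∨ α ∈ Q) ∧ (γ ∈ P ∨ γ ∈ Q)
    · have e1 := h1.not ((modX_P hQ hb.1).mono sα) (Out_inf T.k2 _ _)
      have e2 := h2.not ((modX_P hQ hb.2).mono sγ) (Out_inf T.k2 _ _)
      rw [e1] at e2; simp at e2
    have hαd := hd α
    have hγd := hd γ
    by_cases hp : α ∈ P ∨ γ ∈ P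
    · right
      have hne : α ≠ γ := fun hh => by
        subst hh
        exact hb ⟨Or.inl (hp.elim id id), Or.inl (hp.elim id id)⟩
      rw [mem_coe, T.turn hα hγ hne, hR1, mem_union, mem_product,
        mem_product, mem_singleton, mem_singleton]
      rcases hp with hp | hp
      · exact Or.inl ⟨hp, by_contra fun hc => hb ⟨Or.inl hp, or_assoc.2 hγd |>.resolve_right hc⟩⟩
      · exact Or.inr ⟨by_contra fun hc => hb ⟨or_assoc.2 hαd |>.resolve_right hc, Or.inl hp⟩, hp⟩
    · left
      push Not at hp
      refine ⟨⟨c, h1.congr fun y hy => modX_out hp.1 (sα hy),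
        h2.congr fun y hy => modX_out hp.2 (sγ hy)⟩, ?_⟩
      intro hm
      by_cases hne : α = γ
      · obtain ⟨i, hi, hi'⟩ := mem_image.1 (mem_coe.1 hm)
        obtain ⟨hi, hr⟩ := mem_filter.1 hi
        have ps := T.pass (x := x) hi
        rw [hi'] at ps
        have e1 : e i = α := cone_disj (ps.1 (by simp [Out, bw, td_self])) hα
        have e2 : f i = γ := cone_disj (ps.2 (by simp [Out, bw, td_self])) hγ
        rw [hR, e1, e2, mem_union, mem_product, mem_product] at hr
        exact hr.elim (fun h => hp.1 h.1) (fun h => hp.2 h.2)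
      · rw [mem_coe, T.turn hα hγ hne, hR, mem_union, mem_product,
          mem_product] at hm
        exact hm.elim (fun h => hp.1 h.1) (fun h => hp.2 h.2)
  have fin : (((NX p a b X \ ↑(trn p e f a b x R)) ∪ ↑(trn p e f a b x R1)) ∪ (L2 ∪ L3)).Finite :=
    ((hN.subset diff_subset).union (finite_toSet _)).union (f2.union f3)
  refine ⟨fin.subset sub, ?_⟩
  have c1 := ncard_le_ncard sub fin
  have c2 := ncard_union_le ((NX p a b X \ ↑(trn p e f a b x R)) ∪ ↑(trn p e f a b x R1)) (L2 ∪ L3)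
  have c3 := ncard_union_le (NX p a b X \ ↑(trn p e f a b x R)) ↑(trn p e f a b x R1)
  have c4 := ncard_union_le L2 L3
  have c5 := Set.ncard_diff_add_ncard_of_subset gsub hN
  rw [ncard_coe_finset] at c3 c5
  rw [cR] at gain
  have := l1.trans (Nat.mul_le_mul_right hi cR1)
  omega
lemma MX.const {X : FG k → Bool} {x : FG k} (hx : x ∈ MX X) (v : Bool)
    (h : ∀ c, td (x * lt c) 1 = td x 1 + 1 → AC X (Out (x * lt c) x) v) : False := by
  refine hx v (AC_star (fun c => td (x * lt c) 1 = td x 1 + 1) h fun h hh hne => ?_)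
  obtain ⟨c, hc⟩ := dir_ex (Ne.symm hne)
  refine ⟨c, ?_, mem_cone.2 hc⟩
  have h1 : bw h x 1 := hh
  have := dir x 1 c
  have := tr h (x * lt c) 1
  simp only [bw, td_comm h] at *
  omega
lemma MX_mod {X : FG k → Bool} {x : FG k} {v : Bool} {P Q : Finset (Letter k)} (hx : x ∈ MX X)
    (hQ : ∀ c ∈ Q, AC X (Out (x * lt c) x) (!v))
    (haw : ∀ c, td (x * lt c) 1 = td x 1 + 1 → c ∈ P ∨ c ∈ Q) :
    MX (modX x P v X) ⊆ MX X \ {x} := by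
  intro y hy
  have hyx : y ≠ x := by
    rintro rfl
    exact MX.const hy (!v) fun c hc => modX_P hQ (haw c hc)
  refine ⟨fun c hc => ?_, hyx⟩
  have hb : ¬ bw x y 1 := fun hb => hx c (hc.mono fun z hz =>
    bw_symm (bw_trans (bw_symm (hz : bw z x 1)) (bw_symm hb)))
  obtain ⟨β, hβ⟩ := dir_ex (Ne.symm hyx)
  have hs := out_cone (mem_cone.2 hβ) hb
  by_cases hp : β ∈ P
  · exact hy (!v) ((modX_P hQ (Or.inl hp)).mono hs)
  · exact hy c (hc.congr fun z hz => (modX_out hp (hs hz)).symm)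
lemma half {X : FG k → Bool} {x : FG k} {v : Bool} {c : Letter k} (h1 : AC X (Out (x * lt c) x) v)
    (h2 : ∀ d, d ≠ c → AC X (Out (x * lt d) x) (!v)) : Loc X x (x * lt c) := by
  refine ⟨!v, AC_star (fun d => d ≠ c) h2 fun h hh hne => ?_, by simpa using h1⟩
  obtain ⟨d, hd⟩ := dir_ex (Ne.symm hne)
  refine ⟨d, ?_, mem_cone.2 hd⟩
  rintro rfl
  have hh' : bw h x (x * lt d) := hh
  have := td_lt x d
  simp only [bw, td_comm h] at *
  omega
theorem Tn.mc (T : Tn k n m u p e f a b lo hi) {δ : ℕ} (hδ : 2 * hi + 2 * (m + 1) + δ ≤ 4 * lo)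
    (hδ2 : δ ≤ 2 * lo) : ∀ (N : ℕ) (X : FG k → Bool), (MX X).Finite → (MX X).ncard ≤ N → 1 ∈ MX X →
    (NX p a b X).Finite → 2 * (2 * k - 1) * lo + δ ≤ (NX p a b X).ncard ∨
      (2 * (2 * k - 1) * lo ≤ (NX p a b X).ncard ∧ ∃ x c, Loc X x (x * lt c)) := by
  classical
  intro N
  induction N with
  | zero =>
    intro X hf hN h1
    have := (Set.ncard_pos hf).2 ⟨1, h1⟩
    omega
  | succ N ih =>
  intro X hf hN h1 hNX
  have k2 := T.k2
  obtain ⟨x, hx, hmax⟩ := hf.toFinset.exists_max_image (fun x => td x 1) ⟨1, by simpa using h1⟩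
  rw [Set.Finite.mem_toFinset] at hx
  have aw : ∀ c, td (x * lt c) 1 = td x 1 + 1 → ∃ v, AC X (Out (x * lt c) x) v := by
    intro c hc
    have : x * lt c ∉ MX X := fun h => by
      have := hmax _ (by simpa using h)
      omega
    simp only [MX, mem_ofPred_eq, not_forall, not_not] at this
    obtain ⟨v, hv⟩ := this
    refine ⟨v, hv.mono fun y hy => (bw_join hy ?_ ?_).2⟩
    · have := td_lt x c
      unfold bw; rw [td_comm _ x]; omega
    · intro h; rw [h] at hc; omega
  let P : Bool → Finset (Letter k) := fun v => univ.filter fun c => AC X (Out (x * lt c) x) v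
  have mP : ∀ v c, c ∈ P v ↔ AC X (Out (x * lt c) x) v := fun v c => by simp [P]
  have dis : ∀ v, Disjoint (P v) (P (!v)) := fun v => by
    rw [disjoint_left]
    intro c h1 h2
    have := ((mP _ _).1 h1).not ((mP _ _).1 h2) (Out_inf k2 _ _)
    cases v <;> simp at this
  have dis' : Disjoint (P true) (P false) := dis true
  have awP : ∀ v c, td (x * lt c) 1 = td x 1 + 1 → c ∈ P v ∨ c ∈ P (!v) := fun v c hc => by
    obtain ⟨w, hw⟩ := aw c hc
    rw [mP, mP]
    cases v <;> cases w <;> simp [hw]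
  have neP : ∀ v, 1 ≤ (P v).card := fun v => card_pos.2 <| by
    by_contra hc
    rw [Finset.not_nonempty_iff_eq_empty] at hc
    refine MX.const hx (!v) fun c h => (mP _ _).1 ((awP v c h).resolve_left ?_)
    rw [hc]; simp
  have cu : (univ : Finset (Letter k)).card = 2 * k := by simp [mul_comm]
  by_cases hall : ∀ c, c ∈ P true ∨ c ∈ P false
  · have ct : (P true).card + (P false).card = 2 * k := by
      rw [← card_union_of_disjoint dis', ← cu]
      congr 1
      ext c; simpa using hall c
    set R := P true ×ˢ P false ∪ P false ×ˢ P true with hR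
    have cR : R.card = 2 * ((P true).card * (P false).card) := by
      rw [hR, card_union_of_disjoint, card_product, card_product]; ring
      rw [disjoint_left]
      rintro ⟨r, s⟩ h1 h2
      rw [mem_product] at h1 h2
      exact disjoint_left.1 dis' h1.1 h2.1
    have gain := (T.trn_card x R (by
      rintro ⟨r, s⟩ h
      rcases mem_union.1 h with h | h <;> rw [mem_product] at h
      · intro hh; simp only at hh; exact disjoint_left.1 dis' h.1 (hh ▸ h.2)
      · intro hh; simp only at hh; exact disjoint_left.1 dis' h.2 (hh ▸ h.1))).1
    have gsub : (↑(trn p e f a b x R) : Set (FG k)) ⊆ NX p a b X := fun h hh => by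
      refine T.loc (R := R) ?_ (mem_coe.1 hh)
      rintro ⟨r, s⟩ h
      rcases mem_union.1 h with h | h <;> rw [mem_product] at h
      · exact ⟨true, (mP _ _).1 h.1, (mP _ _).1 h.2⟩
      · exact ⟨false, (mP _ _).1 h.1, (mP _ _).1 h.2⟩
    have hle := ncard_le_ncard gsub hNX
    rw [ncard_coe_finset] at hle
    rw [cR] at gain
    have hf1 := neP true
    have hf2 := neP false
    have hal : ∀ v c, (P v).card = 1 → c ∈ P v → Loc X x (x * lt c) := by
      intro v c hv hc
      refine half ((mP _ _).1 hc) fun d hd => (mP _ _).1 ?_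
      have : d ∉ P v := fun h => hd (card_le_one.1 hv.le d h c hc)
      have := hall d
      cases v <;> simp_all
    generalize (P true).card = s at *
    by_cases hs : s = 1 ∨ (P false).card = 1
    · right
      constructor
      · refine le_trans ?_ (gain.trans hle)
        gcongr
        rcases hs with hs | hs <;> rw [hs] <;> omega
      · rcases hs with hs | hs
        · have : (P true).card = 1 := by
            have := card_union_of_disjoint dis'
            have e : P true ∪ P false = univ := by ext c; simpa using hall c
            rw [e, cu] at this
            omega
          obtain ⟨c, hc⟩ := card_pos.1 (this ▸ Nat.one_pos : 0 < (P true).card)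
          exact ⟨x, c, hal _ c this hc⟩
        · obtain ⟨c, hc⟩ := card_pos.1 (hs ▸ Nat.one_pos : 0 < (P false).card)
          exact ⟨x, c, hal _ c hs hc⟩
    · left
      refine le_trans ?_ (gain.trans hle)
      generalize (P false).card = t at *
      have : 2 * (2 * k - 1) + 2 ≤ 2 * (s * t) := by
        have : 2 * k ≤ s * t := by rw [← ct]; nlinarith [show 2 ≤ s by omega, show 2 ≤ t by omega]
        omega
      have := Nat.mul_le_mul_right lo this
      nlinarith
  · push Not at hall
    obtain ⟨d, hd1, hd2⟩ := hall
    have hdn : ∀ v, d ∉ P v := fun v => by cases v <;> assumption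
    have hcov : ∀ v c, c ∈ P v ∨ c ∈ P (!v) ∨ c = d := by
      intro v c
      by_cases hc : td (x * lt c) 1 = td x 1 + 1
      · rcases awP v c hc with h | h <;> simp [h]
      · have h1 := dir x 1 c
        have h2 := dir x 1 d
        have h3 : ¬ td (x * lt d) 1 = td x 1 + 1 := fun h => by
          rcases awP true d h with h | h
          · exact hdn _ h
          · exact hdn _ h
        exact Or.inr (Or.inr (dir_unique (x := x) (y := 1) OM OM))
    have ct : (P true).card + (P false).card + 1 = 2 * k := by
      rw [← card_union_of_disjoint dis', ← cu,
        ← card_insert_of_notMem (a := d) (by simp [hd1, hd2])]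
      congr 1
      ext c; have := hcov true c; simp at this ⊢; tauto
    obtain ⟨v, hv⟩ : ∃ v, 2 ≤ (P (!v)).card := by
      by_contra hc
      push Not at hc
      have := hc true
      have := hc false
      simp at *
      omega
    obtain ⟨fN, cN⟩ := T.mixed (v := v) (P := P v) (Q := P (!v)) (fun c => (mP _ _).1) (fun c => (mP _ _).1)
      (hcov v) (hdn _) (hdn _) (dis v) hv hNX
    have hsub := MX_mod (P := P v) (Q := P (!v)) hx (fun c => (mP _ _).1) (awP v)
    have hcard := ncard_le_ncard hsub (hf.subset diff_subset)
    rw [Set.ncard_diff_singleton_of_mem hx] at hcard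
    have hone : 1 ∈ MX (modX x (P v) v X) := by
      intro c hc
      have h2 : AC (modX x (P v) v X) (Out (x * lt d) x) c := hc.mono fun y _ => by
        simp [Out, bw, td_self]
      exact hdn c ((mP _ _).2 (h2.congr fun y hy => modX_out (hdn v) hy))
    have := ih _ ((hf.subset diff_subset).subset hsub) OM hone fN
    left
    have hL : 2 * (2 * k - 1) * lo ≤ (NX p a b (modX x (P v) v X)).ncard := OM
    have hp := neP v
    generalize (P v).card = s at *
    generalize (P (!v)).card = t at *
    have a1 : 2 * (s * 2) * lo ≤ 2 * (s * t) * lo := by gcongr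
    have a2 : s * (2 * hi + 2 * (m + 1) + δ) ≤ s * (4 * lo) := Nat.mul_le_mul_left s hδ
    have a3 : 1 * (2 * (m + 1) + δ) ≤ s * (2 * (m + 1) + δ) := Nat.mul_le_mul_right _ hp
    nlinarith
end
section

def SS (i : Fin k) (g : FG k) : Bool := decide (td (lt (i, true)) g + 1 = td 1 g)
def CB (z : FG k) : Set (Fin k × FG k) := {r | SS r.1 r.2 ≠ SS r.1 (r.2 * z)}
lemma SS_tr (i : Fin k) (g z : FG k) :
    (SS i (g * z) = true ↔ td (g⁻¹ * lt (i, true)) z + 1 = td g⁻¹ z) := by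
  have h1 := td_left g⁻¹ (lt (i, true)) (g * z)
  have h2 := td_left g⁻¹ 1 (g * z)
  rw [inv_mul_cancel_left] at h1 h2
  rw [mul_one] at h2
  simp only [SS, decide_eq_true_eq, h1, h2]
lemma mem_CB {r : Fin k × FG k} {z : FG k} : r ∈ CB z ↔
    (¬ td (r.2⁻¹ * lt (r.1, true)) 1 + 1 = td r.2⁻¹ 1 ∧
      td (r.2⁻¹ * lt (r.1, true)) z + 1 = td r.2⁻¹ z) ∨
    (td (r.2⁻¹ * lt (r.1, true)) 1 + 1 = td r.2⁻¹ 1 ∧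
      ¬ td (r.2⁻¹ * lt (r.1, true)) z + 1 = td r.2⁻¹ z) := by
  have h1 := SS_tr r.1 r.2 1
  rw [mul_one] at h1
  rw [← h1, ← SS_tr r.1 r.2 z, CB, mem_ofPred_eq]
  cases SS r.1 r.2 <;> cases SS r.1 (r.2 * z) <;> simp
lemma CB_le (z : FG k) : (CB z).Finite ∧ (CB z).ncard ≤ z.norm := by
  let F : Fin k × FG k → ℕ := fun r => min (td 1 r.2⁻¹) (td 1 (r.2⁻¹ * lt (r.1, true)))
  have key : ∀ r ∈ CB z, bw 1 r.2⁻¹ z ∧ bw 1 (r.2⁻¹ * lt (r.1, true)) z ∧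
      (td 1 r.2⁻¹ = F r ∧ td 1 (r.2⁻¹ * lt (r.1, true)) = F r + 1 ∨
       td 1 r.2⁻¹ = F r + 1 ∧ td 1 (r.2⁻¹ * lt (r.1, true)) = F r) := by
    intro r hr
    rw [mem_CB] at hr
    have d1 := dir r.2⁻¹ 1 (r.1, true)
    have d2 := dir r.2⁻¹ z (r.1, true)
    have d3 := td_lt r.2⁻¹ (r.1, true)
    have := fp 1 z r.2⁻¹ (r.2⁻¹ * lt (r.1, true))
    have := tr 1 z r.2⁻¹
    have := tr 1 z (r.2⁻¹ * lt (r.1, true))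
    simp only [F, bw, td_comm _ 1, td_comm z] at *
    omega
  have m : Set.MapsTo F (CB z) ↑(range z.norm) := fun r hr => by
    obtain ⟨h1, h2, h3⟩ := key r hr
    simp only [bw, td_one_left] at *
    simp only [coe_range, mem_Iio]
    omega
  have pos : ∀ i j : Fin k, lt (i, true) * lt (j, true) ≠ 1 := fun i j h => by
    have : lt (j, true) = lt (linv (i, true)) := by rw [← lt_inv]; exact eq_inv_of_mul_eq_one_right h
    have := lt_inj this
    simp [linv] at this
  have inj : InjOn F (CB z) := by
    rintro ⟨i, g⟩ hr ⟨j, g'⟩ hs h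
    obtain ⟨a1, a2, a3⟩ := key _ hr
    obtain ⟨b1, b2, b3⟩ := key _ hs
    simp only [← h] at a1 a2 a3 b1 b2 b3
    rcases a3 with a3 | a3 <;> rcases b3 with b3 | b3
    · have e1 := geo_unique a1 b1 OM
      have e2 := geo_unique a2 b2 OM
      rw [e1] at e2
      have := lt_inj (mul_left_cancel e2)
      simp at this e1; simp [this, e1]
    · have e1 := geo_unique a1 b2 OM
      have e2 := geo_unique a2 b1 OM
      refine (pos j i ?_).elim
      rw [e1, mul_assoc] at e2; simpa using e2
    · have e1 := geo_unique a1 b2 OM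
      have e2 := geo_unique a2 b1 OM
      refine (pos j i ?_).elim
      rw [e1, mul_assoc] at e2; simpa using e2
    · have e1 := geo_unique a1 b1 OM
      have e2 := geo_unique a2 b2 OM
      rw [e1] at e2
      have := lt_inj (mul_left_cancel e2)
      simp at this e1; simp [this, e1]
  have hf : (CB z).Finite := Set.Finite.of_injOn m inj (finite_toSet _)
  refine ⟨hf, ?_⟩
  have := ncard_le_ncard_of_injOn F m inj (finite_toSet _)
  rwa [ncard_coe_finset, card_range] at this
lemma le_CB (z : FG k) : z.norm ≤ (CB z).ncard := by
  choose! q q1 q2 using fun (t : ℕ) (ht : t ≤ td 1 z) => geo_exists 1 z t ht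
  have st : ∀ t, t < z.norm → ∃ r ∈ CB z, min (td 1 r.2⁻¹) (td 1 (r.2⁻¹ * lt (r.1, true))) = t := by
    intro t ht
    rw [← td_one_left] at ht
    have a1 := q1 t OM
    have a2 := q2 t OM
    have b1 := q1 (t + 1) OM
    have b2 := q2 (t + 1) OM
    have hd : td (q t) (q (t + 1)) = 1 := by
      have := fp 1 z (q t) (q (t + 1))
      have := tr 1 (q t) (q (t + 1))
      have := tr z (q t) (q (t + 1))
      simp only [td_comm z] at *
      omega
    obtain ⟨⟨i, s⟩, hc⟩ := td_one hd
    cases s with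
    | true =>
      refine ⟨(i, (q t)⁻¹), mem_CB.2 ?_, ?_⟩
      · simp only [inv_inv, ← hc, td_comm _ 1]; omega
      · simp only [inv_inv, ← hc, a1, b1]; omega
    | false =>
      have hc' : q t = q (t + 1) * lt (i, true) := by
        rw [hc, show lt ((i, false) : Letter k) = (lt (i, true))⁻¹ by rw [lt_inv]; rfl]; group
      refine ⟨(i, (q (t + 1))⁻¹), mem_CB.2 ?_, ?_⟩
      · simp only [inv_inv, ← hc', td_comm _ 1]; omega
      · simp only [inv_inv, ← hc', a1, b1]; omega
  have hs : (↑(range z.norm) : Set ℕ) ⊆ (fun r : Fin k × FG k =>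
      min (td 1 r.2⁻¹) (td 1 (r.2⁻¹ * lt (r.1, true)))) '' CB z := fun t ht =>
    st t (by simpa using ht)
  have := (ncard_le_ncard hs ((CB_le z).1.image _)).trans (Set.ncard_image_le (CB_le z).1)
  rwa [ncard_coe_finset, card_range] at this
def EB (β : FG k ≃* FG k) (x : FG k) : Set (Fin k × FG k) :=
  {r | SS r.1 (β r.2) ≠ SS r.1 (β (r.2 * x))}
lemma EB_card (β : FG k ≃* FG k) (x : FG k) : (EB β x).Finite ∧ (EB β x).ncard = (β x).norm := by
  have e : (fun r : Fin k × FG k => (r.1, β r.2)) '' EB β x = CB (β x) := by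
    ext ⟨i, g⟩
    simp only [EB, CB, Set.mem_image, mem_ofPred_eq, map_mul]
    constructor
    · rintro ⟨⟨j, h⟩, h1, h2⟩
      simp only [Prod.mk.injEq] at h2
      rw [← h2.1, ← h2.2]; exact h1
    · intro h
      exact ⟨(i, β.symm g), by simpa using h, by simp⟩
  have inj : Function.Injective (fun r : Fin k × FG k => (r.1, β r.2)) := by
    rintro ⟨i, g⟩ ⟨j, h⟩ e
    simpa using e
  have h1 := CB_le (β x)
  have h2 := le_CB (β x)
  rw [← e] at h1 h2
  rw [ncard_image_of_injective _ inj] at h1 h2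
  exact ⟨h1.1.of_finite_image inj.injOn, OM⟩
def XX (β : FG k ≃* FG k) (i : Fin k) (h : FG k) : Bool := SS i (β h)
lemma XX_fin (β : FG k ≃* FG k) (i : Fin k) (x : FG k) :
    {h | XX β i h ≠ XX β i (h * x)}.Finite :=
  Set.Finite.of_finite_image ((EB_card β x).1.subset (by
    rintro _ ⟨h, hh, rfl⟩; exact hh)) (f := fun h => (i, h)) (fun a _ b _ h => by simpa using h)
lemma MX_fin {X : FG k → Bool} (hX : ∀ c, {h | X h ≠ X (h * lt c)}.Finite) : (MX X).Finite := by
  have hU : (⋃ c, {h | X h ≠ X (h * lt c)}).Finite := finite_iUnion hX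
  have : (⋃ h ∈ (⋃ c, {h | X h ≠ X (h * lt c)}), {x : FG k | x.norm ≤ h.norm}).Finite :=
    hU.biUnion fun h _ => ball_finite h.norm
  refine this.subset fun x hx => ?_
  by_contra hc
  simp only [mem_iUnion, mem_ofPred_eq, not_exists] at hc
  have : ∀ N h, td h x ≤ N → bw h x 1 → X h = X x := by
    intro N
    induction N with
    | zero => intro h hN _; rw [td_zero.1 (le_zero.1 hN)]
    | succ N ih =>
      intro h hN hb
      by_cases hx : h = x
      · rw [hx]
      obtain ⟨c, hc'⟩ := dir_ex hx
      have t1 := td_lt h c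
      have hb' : bw (h * lt c) x 1 := by
        have := tr h (h * lt c) 1
        have := tr (h * lt c) x 1
        simp only [bw] at *
        omega
      rw [← ih (h * lt c) OM hb']
      by_contra hne
      refine hc h ⟨c, hne⟩ ?_
      unfold bw at hb
      rw [td_comm h 1, td_comm x 1, td_one_left, td_one_left] at hb
      omega
  refine hx (X x) (finite_empty.subset ?_)
  rintro h ⟨h1, h2⟩
  exact h2 (this _ h le_rfl h1)
lemma XX_MX (β : FG k ≃* FG k) (i : Fin k) : (MX (XX β i)).Finite :=
  MX_fin fun c => XX_fin β i (lt c)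
lemma XX_one (k2 : 2 ≤ k) (β : FG k ≃* FG k) (i : Fin k) : 1 ∈ MX (XX β i) := by
  intro c hc
  have hc' : {g | SS i g ≠ c}.Finite := by
    refine (Set.Finite.image β hc).subset fun g hg => ⟨β.symm g, ⟨by simp [Out, bw, td_self], ?_⟩, by simp⟩
    simpa [XX] using hg
  have t := td_lt (1 : FG k) (i, true)
  rw [one_mul] at t
  cases c with
  | false =>
    refine Out_inf k2 (lt (i, true)) 1 (hc'.subset fun g hg => ?_)
    have hg' : bw g (lt (i, true)) 1 := hg
    simp only [bw, td_comm g, td_comm _ (1 : FG k)] at hg'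
    simp only [SS, mem_ofPred_eq, ne_eq, decide_eq_false_iff_not, not_not]
    rw [t] at hg'; omega
  | true =>
    refine Out_inf k2 1 (lt (i, true)) (hc'.subset fun g hg => ?_)
    have hg' : bw g 1 (lt (i, true)) := hg
    simp only [bw, td_comm g] at hg'
    simp only [SS, mem_ofPred_eq, ne_eq, decide_eq_true_eq]
    rw [t] at hg'; omega
end
section

lemma ev_const {X : FG k → Bool} {S : Set (FG k)} {c : Bool} (h : AC X S c) {g : ℕ → FG k}
    (hg : Function.Injective g) (hs : ∀ j, g j ∈ S) : ∃ J, ∀ j, J ≤ j → X (g j) = c := by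
  have hf : {j | X (g j) ≠ c}.Finite :=
    (Set.Finite.preimage hg.injOn h).subset fun j hj => ⟨hs j, hj⟩
  obtain ⟨J, hJ⟩ := hf.bddAbove
  refine ⟨J + 1, fun j hj => ?_⟩
  by_contra hc
  have := hJ hc
  omega
lemma q_perz {W : FG k} {q : ℤ → FG k} {L : ℕ} (hper : ∀ i, q (i + L) = W * q i) (t i : ℤ) :
    q (i + L * t) = W ^ t * q i := by
  induction t using Int.induction_on with
  | zero => simp
  | succ t ih =>
    rw [show i + L * ((t : ℤ) + 1) = (i + L * t) + L by ring, hper, ih, zpow_add_one,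
      (Commute.zpow_self W t).eq, mul_assoc]
  | pred t ih =>
    have := hper (i + L * (-(t : ℤ) - 1))
    rw [show i + L * (-(t : ℤ) - 1) + L = i + L * (-t) by ring, ih] at this
    rw [eq_inv_mul_of_mul_eq this.symm, ← mul_assoc, zpow_sub_one,
      (Commute.zpow_self W (-(t : ℤ))).inv_right.eq]
lemma seg_count (k2 : 2 ≤ k) {β : FG k ≃* FG k} {W : FG k} {q : ℤ → FG k} {L : ℕ}
    (hq : ∀ i j, td (q i) (q j) = (i - j).natAbs) (hper : ∀ i, q (i + L) = W * q i) (q0 : q 0 = 1)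
    {ι : Type} (α ω : ι → ℤ) (h0 : ∀ s, 0 ≤ α s ∧ α s < ω s ∧ ω s ≤ L)
    (hord : ∀ s s', s ≠ s' → ω s ≤ α s' ∨ ω s' ≤ α s) {n C : ℕ}
    (hn : ∀ J : ℕ, (β (W ^ J)).norm ≤ J * n + C) (M : Finset (Fin k × ι × FG k))
    (hM : ∀ r ∈ M, Loc (XX β r.1) (r.2.2 * q (α r.2.1)) (r.2.2 * q (ω r.2.1))) : M.card ≤ n := by
  classical
  have pw : ∀ (h : FG k) (t : ℤ), h * W ^ t = h * q (L * t) := fun h t => by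
    have := q_perz hper t 0
    rw [zero_add, q0, mul_one] at this
    rw [this]
  have D : ∀ (g : FG k) i j, td (g * q i) (g * q j) = (i - j).natAbs := fun g i j => by
    rw [td_left, hq]
  have stp : ∀ r ∈ M, ∃ (N : ℕ) (c : Bool), AC (XX β r.1) (Out (r.2.2 * q (α r.2.1)) (r.2.2 * q (ω r.2.1))) c ∧
      AC (XX β r.1) (Out (r.2.2 * q (ω r.2.1)) (r.2.2 * q (α r.2.1))) (!c) ∧
      ∀ j : ℕ, N ≤ j → XX β r.1 (r.2.2 * W ^ (-(j : ℤ))) = c ∧ XX β r.1 (r.2.2 * W ^ ((j : ℤ) + 1)) = !c := by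
    rintro ⟨i, s, h⟩ hr
    obtain ⟨c, h1, h2⟩ := hM _ hr
    have hs := h0 s
    have hL : (0 : ℤ) < L := OM
    have inj : ∀ x y : ℤ, h * W ^ x = h * W ^ y → x = y := fun x y e => by
      rw [pw, pw] at e
      have := D h (L * x) (L * y)
      rw [e, td_self] at this
      have : (L : ℤ) * x = L * y := OM
      exact mul_left_cancel₀ hL.ne' this
    obtain ⟨N1, n1⟩ := ev_const h1 (g := fun j => h * W ^ (-(j : ℤ))) (fun x y e => by
      have := inj _ _ e; omega) (fun j => by
      have : 0 ≤ (L : ℤ) * j := by positivity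
      simp only [pw, Out, bw, mem_ofPred_eq, D, mul_neg]
      omega)
    obtain ⟨N2, n2⟩ := ev_const h2 (g := fun j => h * W ^ ((j : ℤ) + 1)) (fun x y e => by
      have := inj _ _ e; omega) (fun j => by
      have : 0 ≤ (L : ℤ) * j := by positivity
      simp only [pw, Out, bw, mem_ofPred_eq, D, mul_add, mul_one]
      omega)
    exact ⟨max N1 N2, c, h1, h2, fun j hj => ⟨n1 j OM, n2 j OM⟩⟩
  choose! N c a1 a2 a3 using stp
  set J0 := M.sup N
  have hJ0 : ∀ r ∈ M, N r ≤ J0 := fun r hr => Finset.le_sup hr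
  by_contra hc
  push Not at hc
  set J' := (2 * J0 + 1) * n + C + 1 with hJ'
  have sep : ∀ (X : FG k → Bool) (h : FG k) (c : Bool) (a b a' b' : ℤ), AC X (Out (h * q b) (h * q a)) (!c) →
      AC X (Out (h * q a') (h * q b')) c → b ≤ a' → a' < b' → False := by
    intro X h c a b a' b' h1 h2 h3 h4
    refine conf k2 (v := !c) h1 (by simpa using h2) ?_
    simp only [bw, D]; omega
  have card : (M ×ˢ Ico J0 (J0 + J')).card ≤ (EB β (W ^ (J' + 2 * J0 + 1))).ncard := by
    rw [← ncard_coe_finset]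
    refine ncard_le_ncard_of_injOn (fun r => (r.1.1, r.1.2.2 * W ^ (-(r.2 : ℤ)))) ?_ ?_ (EB_card _ _).1
    · rintro ⟨⟨i, s, h⟩, j⟩ hr
      simp only [coe_product, mem_prod, mem_coe, mem_Ico] at hr
      obtain ⟨hr, hj1, hj2⟩ := hr
      have e1 := (a3 _ hr j (by have := hJ0 _ hr; omega)).1
      have e2 := (a3 _ hr (J' + 2 * J0 - j) (by have := hJ0 _ hr; omega)).2
      simp only [XX] at e1 e2
      simp only [EB, mem_ofPred_eq]
      rw [e1, mul_assoc, ← zpow_natCast, ← zpow_add,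
        show -(j : ℤ) + ((J' + 2 * J0 + 1 : ℕ) : ℤ) = ((J' + 2 * J0 - j : ℕ) : ℤ) + 1 by omega, e2]
      cases c (i, s, h) <;> simp
    · rintro ⟨⟨i, s, h⟩, j⟩ hr ⟨⟨i', s', h'⟩, j'⟩ hr' e
      simp only [coe_product, mem_prod, mem_coe, mem_Ico] at hr hr'
      obtain ⟨hr, hj1, hj2⟩ := hr
      obtain ⟨hr', hj1', hj2'⟩ := hr'
      simp only [Prod.mk.injEq] at e
      obtain ⟨rfl, e⟩ := e
      have ec : c (i, s, h) = c (i, s', h') := by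
        rw [← (a3 _ hr j (by have := hJ0 _ hr; omega)).1, ← (a3 _ hr' j' (by have := hJ0 _ hr'; omega)).1]
        simp only [e]
      have eh : h' = h * W ^ ((j' : ℤ) - j) := by
        rw [sub_eq_add_neg, add_comm, zpow_add, ← mul_assoc, e]; group
      generalize ht : (j' : ℤ) - j = t at eh
      have b1 := a1 _ hr
      have b2 := a2 _ hr
      have b1' := a1 _ hr'
      have b2' := a2 _ hr'
      rw [← ec] at b1' b2'
      simp only [eh, mul_assoc, ← q_perz hper] at b1' b2' b1 b2
      have z1 := h0 s
      have z2 := h0 s'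
      by_cases hts : t = 0 ∧ s = s'
      · obtain ⟨rfl, rfl⟩ := hts
        have : j = j' := OM
        simp only [zpow_zero, mul_one] at eh
        rw [this, eh]
      exfalso
      have : ω s ≤ α s' + L * t ∨ ω s' + L * t ≤ α s := by
        rcases lt_trichotomy t 0 with h | h | h
        · have : (L : ℤ) * t ≤ L * (-1) := by gcongr; omega
          omega
        · rw [h]; have := hord s s' fun hh => hts ⟨h, hh⟩; omega
        · have : (L : ℤ) * 1 ≤ L * t := by gcongr; omega
          omega
      rcases this with h3 | h3
      · exact sep _ _ _ _ _ _ _ b2 b1' h3 OM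
      · exact sep _ _ _ _ _ _ _ b2' b1 h3 OM
  rw [(EB_card _ _).2, card_product, card_Ico] at card
  have h1 := card.trans (hn _)
  have h2 : (n + 1) * J' ≤ M.card * J' := Nat.mul_le_mul_right _ hc
  have h3 : J0 + J' - J0 = J' := OM
  rw [h3] at h1
  nlinarith
end
section
variable {n m : ℕ} {u : FG k} {p : ℤ → FG k}
lemma cyc_conj (x : FG k) (h : x ≠ 1) : ∃ (g : FG k) (w : LW k), w ≠ [] ∧
    CyclicallyReducedWord w ∧ x = g * mk w * g⁻¹ := by
  have h1 := reduceCyclically.isCyclicallyReduced (isReduced_toWord (x := x))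
  have h2 := congrArg mk (reduceCyclically.conj_conjugator_reduceCyclically x.toWord)
  rw [mk_toWord, ← mul_mk, ← mul_mk, ← inv_mk] at h2
  refine ⟨_, _, fun e => h ?_, ?_, h2.symm⟩
  · rw [e, ← one_eq_mk] at h2
    rw [← h2]; group
  · refine isReduced_iff_reduce_eq.1 (isReduced_append.2 ⟨h1.1, h1.1, fun a ha b hb e => ?_⟩)
    have := h1.2 a ha b hb (by rw [e]; rfl)
    rw [e] at this
    simp [linv] at this
lemma seg_sum (k2 : 2 ≤ k) {β : FG k ≃* FG k} {W : FG k} {q : ℤ → FG k} {L : ℕ}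
    (hq : ∀ i j, td (q i) (q j) = (i - j).natAbs) (hper : ∀ i, q (i + L) = W * q i) (q0 : q 0 = 1)
    {ι : Type} [Fintype ι] (α ω : ι → ℤ) (h0 : ∀ s, 0 ≤ α s ∧ α s < ω s ∧ ω s ≤ L)
    (hord : ∀ s s', s ≠ s' → ω s ≤ α s' ∨ ω s' ≤ α s) {C : ℕ}
    (hn : ∀ J : ℕ, (β (W ^ J)).norm ≤ J * n + C) (g : ι → FG k) (a b : ι → ℤ)
    (ha : ∀ s, q (α s) = g s * p (a s)) (hb : ∀ s, q (ω s) = g s * p (b s)) :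
    (∀ i s, (NX p (a s) (b s) (XX β i)).Finite) ∧
      ∑ i, ∑ s, (NX p (a s) (b s) (XX β i)).ncard ≤ n := by
  classical
  have key := seg_count k2 hq hper q0 α ω h0 hord hn
  have loc : ∀ i s h, h ∈ NX p (a s) (b s) (XX β i) →
      Loc (XX β i) (h * (g s)⁻¹ * q (α s)) (h * (g s)⁻¹ * q (ω s)) := fun i s h hh => by
    rw [ha, hb]; simp only [inv_mul_cancel_left, mul_assoc]; exact hh
  have fin : ∀ i s, (NX p (a s) (b s) (XX β i)).Finite := fun i s => by
    by_contra hc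
    obtain ⟨t, h1, h2⟩ := Set.Infinite.exists_subset_card_eq hc (n + 1)
    have := key (t.image fun h => (i, s, h * (g s)⁻¹)) (fun r hr => by
grind)
    rw [card_image_of_injective _ (fun x y e => by simpa using e)] at this
    omega
  refine ⟨fin, ?_⟩
  have := key (((univ : Finset (Fin k × ι)).sigma fun r => (fin r.1 r.2).toFinset).image
    fun r => (r.1.1, r.1.2, r.2 * (g r.1.2)⁻¹)) (fun r hr => by
      obtain ⟨⟨⟨i, s⟩, h⟩, hh, rfl⟩ := mem_image.1 hr
      simp only [mem_sigma, mem_univ, true_and, Set.Finite.mem_toFinset] at hh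
      exact loc i s h hh)
  rw [card_image_of_injective _ (by
    rintro ⟨⟨i, s⟩, h⟩ ⟨⟨i', s'⟩, h'⟩ e
    simp only [Prod.mk.injEq] at e
    obtain ⟨rfl, rfl, e⟩ := e
    simpa using e), card_sigma, Fintype.sum_prod_type] at this
  simpa only [ncard_eq_toFinset_card _ (fin _ _)] using this
lemma chk (H : Ln k n m u p) {x w y z h : FG k} {D : ℕ} (hy : Ax p h y) (hz : Ax p h z)
    (by' : bw x y w) (bz : bw x z w) (hD : D ≤ td y z) : ∃ i ε : ℤ, (ε = 1 ∨ ε = -1) ∧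
      td x (h * p i) + D + td (h * p (i + ε * D)) w = td x w := by
  wlog hl : td x y ≤ td x z generalizing y z
  · exact this hz hy bz by' (by rwa [td_comm]) OM
  obtain ⟨a, rfl⟩ := hy
  obtain ⟨b, rfl⟩ := hz
  have d1 : td (h * p a) (h * p b) = (a - b).natAbs := by rw [td_left, H.dist]
  have key : ∀ ε : ℤ, ε = 1 ∨ ε = -1 → b = a + ε * (a - b).natAbs → ∃ i ε : ℤ, (ε = 1 ∨ ε = -1) ∧
      td x (h * p i) + D + td (h * p (i + ε * D)) w = td x w := fun ε he hb => by
    refine ⟨a, ε, he, ?_⟩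
    have d2 : td (h * p a) (h * p (a + ε * D)) = (a - (a + ε * D)).natAbs := by rw [td_left, H.dist]
    have d3 : td (h * p b) (h * p (a + ε * D)) = (b - (a + ε * D)).natAbs := by rw [td_left, H.dist]
    have h1 := fp x (h * p a) (h * p b) w
    have h2 := tr x w (h * p (a + ε * D))
    have h3 := tr (h * p b) w (h * p (a + ε * D))
    have h4 := tr x (h * p a) (h * p (a + ε * D))
    simp only [bw, td_comm w] at *
    rcases he with rfl | rfl <;> omega
  rcases le_total a b with e | e
  · exact key 1 (Or.inl rfl) OM
  · exact key (-1) (Or.inr rfl) OM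
lemma tri3 {x a b w : FG k} (h : td x a + td a b + td b w = td x w) :
    bw x a w ∧ bw x b w ∧ td x b = td x a + td a b ∧ bw a b w := by
  have h1 := td_tri x a w
  have h2 := td_tri x b w
  have h3 := td_tri x a b
  have h4 := td_tri a b w
  unfold bw
  omega
lemma on_q {q : ℤ → FG k} (hq : ∀ i j, td (q i) (q j) = (i - j).natAbs) (q0 : q 0 = 1) {L : ℕ} {x : FG k}
    (h : bw 1 x (q L)) : x = q (td 1 x) ∧ td 1 x ≤ L := by
  have h1 : ∀ t : ℤ, td 1 (q t) = t.natAbs := fun t => by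
    have := hq 0 t; rw [q0] at this; omega
  have h2 := h1 L
  unfold bw at h
  have h3 : td 1 x ≤ L := OM
  exact ⟨geo_unique h (by grind) (by rw [h1]; omega), h3⟩
lemma Ln.de (H : Ln k n m u p) (g : FG k) (i : ℤ) {ε : ℤ} (he : ε = 1 ∨ ε = -1) (D E : ℕ) :
    td (g * p (i + ε * D)) (g * p (i + ε * E)) = ((D : ℤ) - E).natAbs := by
  rw [td_left, H.dist]; rcases he with rfl | rfl <;> omega
lemma NX_comm (a b : ℤ) (X : FG k → Bool) : NX p a b X = NX p b a X :=
  Set.ext fun _ => ⟨fun h => Loc.symm h, fun h => Loc.symm h⟩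
set_option maxHeartbeats 1000000 in
theorem C4 (k2 : 2 ≤ k) (H : Ln k n m u p) {e f : ℤ → Letter k} {lo hi δ : ℕ}
    (hT : ∀ a b : ℤ, (n : ℤ) - 16 * m ≤ b - a → b - a < n → Tn k n m u p e f a b lo hi)
    (hδ : 2 * hi + 2 * (m + 1) + δ ≤ 4 * lo) (hδ2 : δ ≤ 2 * lo)
    (hn1 : n < k * (2 * (2 * k - 1) * lo) + δ) (hn2 : n < k * (2 * (2 * (2 * k - 1) * lo)))
    {v : FG k} (hv : v.norm ≤ n) (hv1 : v ≠ 1) {β : FG k ≃* FG k}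
    (hβ : ∀ x, β x ∈ Subgroup.normalClosure ({v} : Set (FG k)) →
      x ∈ Subgroup.normalClosure ({u} : Set (FG k))) :
    (∃ g, v = g * β u * g⁻¹ ∨ v = g * (β u)⁻¹ * g⁻¹) ∧
      ∀ i, ∃ x c, Loc (XX β i) x (x * lt c) := by
  have hm := H.hm
  have hmn := H.hn
  have mc : ∀ (a b : ℤ) (i : Fin k), n ≤ (a - b).natAbs + 16 * m → (a - b).natAbs < n →
      (NX p a b (XX β i)).Finite → 2 * (2 * k - 1) * lo + δ ≤ (NX p a b (XX β i)).ncard ∨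
      (2 * (2 * k - 1) * lo ≤ (NX p a b (XX β i)).ncard ∧ ∃ x c, Loc (XX β i) x (x * lt c)) := by
    intro a b i h1 h2 hf
    rcases le_total a b with hl | hl
    · exact (hT a b OM OM).mc hδ hδ2 _ _ (XX_MX β i) le_rfl (XX_one k2 β i) hf
    · rw [NX_comm] at hf ⊢
      exact (hT b a OM OM).mc hδ hδ2 _ _ (XX_MX β i) le_rfl (XX_one k2 β i) hf
  obtain ⟨W, q, L, g0, h, i, ε, hWN, hW1, hvW, hq, hper, q0, hε, hx0, hz, hDL⟩ :
      ∃ (W : FG k) (q : ℤ → FG k) (L : ℕ) (g0 h : FG k) (i ε : ℤ),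
        W ∈ Subgroup.normalClosure ({u} : Set (FG k)) ∧ W ≠ 1 ∧ β W = g0 * v * g0⁻¹ ∧
        (∀ i j, td (q i) (q j) = (i - j).natAbs) ∧ (∀ i, q (i + L) = W * q i) ∧ q 0 = 1 ∧
        (ε = 1 ∨ ε = -1) ∧ h * p i = 1 ∧ h * p (i + ε * (n - 8 * m : ℕ)) = q (n - 8 * m : ℕ) ∧
        n - 8 * m ≤ L := by
    obtain ⟨g, w, w0, wc, hw⟩ := cyc_conj (β.symm v) (by simpa using hv1)
    have hN : mk w ∈ Subgroup.normalClosure ({u} : Set (FG k)) := by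
      have : mk w = g⁻¹ * β.symm v * g⁻¹⁻¹ := by rw [hw]; group
      rw [this]
      exact Subgroup.normalClosure_normal.conj_mem _
        (hβ _ (by rw [β.apply_symm_apply]; exact Subgroup.subset_normalClosure (Set.mem_singleton _))) _
    have h1 : mk w ≠ 1 := fun e => hv1 (by
      rw [e] at hw; simpa using hw)
    have pq := pp_dist w0 wc (by omega : 0 < k)
    have pW : pp w w.length = mk w := by
      have := pp_per w0 0
      simpa [pp_zero] using this
    obtain ⟨y, z, h, a1, a2, b1, b2, hd⟩ := greendlinger H hN h1
    obtain ⟨i, ε, he, hh⟩ := chk H (D := n - 8 * m) a1 a2 b1 b2 OM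
    have dd := H.de h i he 0 (n - 8 * m)
    simp only [cast_zero, mul_zero, add_zero, zero_sub, Int.natAbs_neg, Int.natAbs_natCast] at dd
    rw [← pW] at hh
    obtain ⟨c1, c2, c3, c4⟩ := tri3 (x := 1) (w := pp w w.length) (a := h * p i) (b := h * p (i + ε * (n - 8 * m : ℕ)))
      (by grind)
    obtain ⟨e1, f1⟩ := on_q pq pp_zero c1
    obtain ⟨e2, f2⟩ := on_q pq pp_zero c2
    rw [c3, dd] at f2
    rw [c3, dd, cast_add] at e2
    generalize td 1 (h * p i) = s at *
    refine ⟨(pp w s)⁻¹ * mk w * (pp w s)⁻¹⁻¹, fun t => (pp w s)⁻¹ * pp w (s + t), w.length,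
      (β (pp w s))⁻¹ * (β g)⁻¹, (pp w s)⁻¹ * h, i, ε, Subgroup.normalClosure_normal.conj_mem _ hN _,
      fun e => h1 (conj_eq_one_iff.1 e), ?_, fun a b => ?_, fun a => ?_, by simp, he,
      by rw [mul_assoc, e1]; simp, by grind, OM⟩
    · have : β (mk w) = (β g)⁻¹ * v * β g := by
        have : v = β (g * mk w * g⁻¹) := by rw [← hw]; simp
        rw [this]; simp [mul_assoc]
      simp [this, mul_assoc]
    · rw [td_left, pq]; omega
    · simp only [← add_assoc, pp_per w0, mul_assoc, inv_inv, mul_inv_cancel_left]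
  have hC : ∀ J : ℕ, (β (W ^ J)).norm ≤ J * n + 2 * g0.norm := fun J => by
    rw [map_pow, hvW, conj_pow]
    have h3 : (v ^ J).norm ≤ J * n := by
      induction J with
      | zero => simp
      | succ J ih =>
        have := FreeGroup.norm_mul_le (v ^ J) v
        rw [pow_succ]; nlinarith
    have h1 := FreeGroup.norm_mul_le (g0 * v ^ J) g0⁻¹
    have h2 := FreeGroup.norm_mul_le g0 (v ^ J)
    rw [norm_inv_eq] at h1
    omega
  have hqL : q L = W := by grind
  set κ := h * u ^ ε * h⁻¹ with hκ
  have κe : κ = h * p (i + n * ε) := by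
    rw [H.perz, hκ, eq_inv_of_mul_eq_one_right hx0, mul_assoc]
  by_cases hκW : W = κ
  · have := seg_sum (n := n) (p := p) k2 hq hper q0 (ι := Unit) (fun _ => 0) (fun _ => (n - 8 * m : ℕ))
      (fun _ => OM) (fun a b hab => by simp at hab) hC (fun _ => h) (fun _ => i)
      (fun _ => i + ε * (n - 8 * m : ℕ)) (fun _ => by rw [q0, hx0]) (fun _ => hz.symm)
    obtain ⟨hf, hs⟩ := this
    have M := fun j => mc i (i + ε * (n - 8 * m : ℕ)) j (by grind)
      (by grind) (hf j ())
    simp only [Finset.univ_unique, Finset.sum_singleton] at hs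
    constructor
    · refine ⟨g0⁻¹ * β h, ?_⟩
      have : v = g0⁻¹ * β W * g0 := by rw [hvW]; group
      rw [this, hκW, hκ]
      rcases hε with rfl | rfl
      · left; simp [mul_assoc]
      · right; simp [mul_assoc]
    · intro j
      by_contra hj
      have h1 := (M j).resolve_right fun hc => hj hc.2
      have h2 : ∀ j, 2 * (2 * k - 1) * lo ≤ (NX p i (i + ε * (n - 8 * m : ℕ)) (XX β j)).ncard :=
        fun j => (M j).elim (fun h => OM) (fun h => h.1)
      have h3 : ∑ j', (2 * (2 * k - 1) * lo + if j' = j then δ else 0) ≤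
          ∑ j', (NX p i (i + ε * (n - 8 * m : ℕ)) (XX β j')).ncard :=
        sum_le_sum fun j' _ => by
          split_ifs with hjj
          · grind
          · exact h2 j'
      simp only [sum_add_distrib, sum_const, card_univ, Fintype.card_fin,
        sum_ite_eq', mem_univ, if_true, smul_eq_mul] at h3
      omega
  · exfalso
    have hκN : κ⁻¹ * W ∈ Subgroup.normalClosure ({u} : Set (FG k)) :=
      mul_mem (inv_mem (Subgroup.normalClosure_normal.conj_mem _
        (zpow_mem (Subgroup.subset_normalClosure (Set.mem_singleton _)) _) _)) hWN
    obtain ⟨y, z, h2, a1, a2, b1, b2, hd⟩ := greendlinger H hκN fun e => hκW (inv_mul_eq_one.1 e).symm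
    rw [← bw_left (g := κ), mul_inv_cancel_left, mul_one] at b1 b2
    obtain ⟨i2, ε2, he2, hh⟩ := chk H (D := n - 8 * m) (h := κ * h2) (Ln.ax_left.2 a1)
      (Ln.ax_left.2 a2) b1 b2 (by rw [td_left]; omega)
    set Z := κ * h2 * p (i2 + ε2 * (n - 8 * m : ℕ)) with hZ
    set Y := κ * h2 * p (i2 + ε2 * (8 * m : ℕ)) with hY
    have s1 : td (κ * h2 * p i2) Y = 8 * m := by
      have := H.de (κ * h2) i2 he2 0 (8 * m)
      simpa only [cast_zero, mul_zero, add_zero, zero_sub, Int.natAbs_neg, Int.natAbs_natCast] using this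
    have s2 : td Y Z = n - 16 * m := by
      rw [hY, hZ, H.de _ _ he2]; clear * - hmn; omega
    have s4 : td κ (q (n - 8 * m : ℕ)) = 8 * m := by
      rw [κe, ← hz, mul_comm (n : ℤ), H.de _ _ hε]; clear * - hmn; omega
    have s5 : td (κ * h2 * p i2) Y + td Y Z = n - 8 * m := by grind
    rw [← s5, ← hqL] at hh
    have q1 := hq 0 (n - 8 * m : ℕ)
    have q2 := hq (n - 8 * m : ℕ) L
    have q3 := hq 0 L
    rw [q0] at q1 q3
    set z0 := q (n - 8 * m : ℕ) with hz0
    have bY : bw κ Y (q L) ∧ 8 * m ≤ td κ Y ∧ bw Y Z (q L) := by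
      have u1 := td_tri κ (κ * h2 * p i2) (q L)
      have u2 := td_tri (κ * h2 * p i2) Y (q L)
      have u3 := td_tri Y Z (q L)
      have u4 := td_tri κ Y (q L)
      have u5 := td_tri κ (κ * h2 * p i2) Y
      clear * - u1 u2 u3 u4 u5 s1 hh
      unfold bw
      omega
    have bY2 : bw z0 Y (q L) := by
      rcases bw_sub z0 bY.1 with hb | hb
      · have : td Y z0 = 0 := by unfold bw at hb; clear * - hb bY s4; omega
        rw [td_zero.1 this]; simp [bw, td_self]
      · exact hb
    have b1 : td 1 z0 + td z0 Y + td Y (q L) = td 1 (q L) := by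
      have := bY2
      unfold bw at this
      clear * - q1 q2 q3 this hDL; omega
    obtain ⟨-, c1, c2, -⟩ := tri3 b1
    have b2 : td 1 Y + td Y Z + td Z (q L) = td 1 (q L) := by
      have h1 := bY.2.2
      unfold bw at c1 h1
      clear * - c1 h1; omega
    obtain ⟨-, c3, c4, -⟩ := tri3 b2
    obtain ⟨e1, -⟩ := on_q hq q0 c1
    obtain ⟨e2, f2⟩ := on_q hq q0 c3
    have hs : n - 8 * m ≤ td 1 Y := by grind
    rw [c4, s2] at f2
    rw [c4, s2, cast_add] at e2
    generalize td 1 Y = s at *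
    have aux : n - 8 * m ≤ s ∧ s + (n - 16 * m) ≤ L ∧ 0 < n - 16 * m ∧ 0 < n - 8 * m :=
      ⟨hs, f2, by grind, by grind⟩
    obtain ⟨hf, hs⟩ := seg_sum (n := n) (p := p) k2 hq hper q0 (ι := Bool)
      (fun c => if c then 0 else (s : ℤ)) (fun c => if c then ((n - 8 * m : ℕ) : ℤ) else s + (n - 16 * m : ℕ))
      (fun c => by grind)
      (fun a b hab => by grind) hC
      (fun c => if c then h else κ * h2) (fun c => if c then i else i2 + ε2 * (8 * m : ℕ))
      (fun c => if c then i + ε * (n - 8 * m : ℕ) else i2 + ε2 * (n - 8 * m : ℕ))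
      (fun c => by grind)
      (fun c => by grind)
    have M : ∀ j, 2 * (2 * (2 * k - 1) * lo) ≤ ∑ c : Bool, (NX p (if c then i else i2 + ε2 * (8 * m : ℕ))
        (if c then i + ε * (n - 8 * m : ℕ) else i2 + ε2 * (n - 8 * m : ℕ)) (XX β j)).ncard := fun j => by
      have f1 := hf j true
      have f2 := hf j false
      simp only [if_true, Bool.false_eq_true, if_false, Fintype.sum_bool] at f1 f2 ⊢
      have m1 := mc _ _ j (by grind)
        (by grind) f1
      have m2 := mc _ _ j (by grind)
        (by grind) f2
      clear * - m1 m2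
      omega
    have := sum_le_sum fun j (_ : j ∈ univ) => M j
    simp only [sum_const, card_univ, Fintype.card_fin, smul_eq_mul] at this
    omega
end
section

lemma stepd {p z : FG k} (y : FG k) (h : td p z = 1) : td z y = td p y + 1 ∨ td z y + 1 = td p y := by
  obtain ⟨a, rfl⟩ := td_one h
  exact dir p y a
lemma sym6 (p p' z a b c : FG k) : td a p = td p a ∧ td a p' = td p' a ∧ td b p = td p b ∧
    td b p' = td p' b ∧ td a z = td z a ∧ td c p = td p c ∧ td b a = td a b ∧ td p' p = td p p' ∧
    td z p = td p z ∧ td c z = td z c ∧ td z p' = td p' z ∧ td c a = td a c ∧ td c b = td b c := by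
  refine ⟨?_, ?_, ?_, ?_, ?_, ?_, ?_, ?_, ?_, ?_, ?_, ?_, ?_⟩ <;> exact td_comm ..
lemma sh {h p p' z : FG k} (hz : td z (h * z) = 1) (hs : 2 ≤ td p (h * p)) (h1 : td p p' = 1)
    (hb : bw p p' z) : bw p p' (h * p) ∧ bw (h * p) (h * p') p ∧ td p' (h * p') + 2 ≤ td p (h * p) := by
  have e1 : td (h * p) (h * z) = td p z := td_left ..
  have e2 : td (h * p) (h * p') = 1 := by rw [td_left, h1]
  have e3 : td (h * p') (h * z) = td p' z := td_left ..
  have aux : ∀ A A' B z z' : FG k, td A A' = 1 → bw A A' z → td z z' = 1 → td z' B = td A z →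
      2 ≤ td A B → bw A A' B := fun A A' B z z' q1 q2 q3 q4 q5 => by
    rcases stepd B q1 with a | a
    · have q6 := (bw_join (bw_symm q2) (show bw A' A B by unfold bw; rw [td_comm A']; omega)
        fun e => by rw [e, td_self] at q1; omega).1
      have := td_tri z z' B
      unfold bw at q6
      rw [td_comm z A] at q6
      omega
    · unfold bw; omega
  have r1 := aux p p' (h * p) z (h * z) h1 hb hz (by rw [td_comm, e1]) hs
  have r2 := aux (h * p) (h * p') p (h * z) z e2 (bw_left.2 hb) (by rw [td_comm, hz])
    (by rw [td_comm, e1]) (by rwa [td_comm])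
  have f3 := fp p p' (h * p) (h * p')
  refine ⟨r1, r2, ?_⟩
  unfold bw at r1 r2
  rw [td_comm (h * p') p, td_comm (h * p) p] at r2
  omega
lemma flat {g p p' z : FG k} (hz : td z (g * z) = 1) (hp : td p (g * p) = 1) (h1 : td p p' = 1)
    (hb : bw p p' z) : td p' (g * p') = 1 := by
  have e1 : td (g * p) (g * z) = td p z := td_left ..
  have e2 : td (g * p) (g * p') = 1 := by rw [td_left, h1]
  have e3 : td (g * p') (g * z) = td p' z := td_left ..
  rcases stepd (g * p) h1 with a | a
  · rcases stepd p e2 with b | b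
    · exfalso
      have f1 := fp p p' z (g * p)
      have f2 := fp (g * p) (g * p') (g * z) p
      have f3 := fp p z (g * p) (g * z)
      have t1 := tr z (g * z) p
      have t2 := tr z (g * z) (g * p)
      unfold bw at *
      have cs := sym6 p p' z (g * p) (g * p') (g * z)
      omega
    · rw [td_comm p (g * p)] at hp
      have := td_zero.1 (show td (g * p') p = 0 by omega)
      rw [this, td_comm, h1]
  · have := td_zero.1 (show td p' (g * p) = 0 by omega)
    rw [this, td_left, hp]
lemma par (g p z : FG k) : ∃ c : ℤ, (td p (g * p) : ℤ) = td z (g * z) + 2 * c := by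
  obtain ⟨a, ha⟩ := td_even p (g * p) z
  obtain ⟨b, hb⟩ := td_even z (g * p) (g * z)
  rw [td_left] at hb
  rw [td_comm z (g * p)] at hb
  exact ⟨td p z - a - b, OM⟩
lemma loxo {f x : FG k} (h0 : x ≠ f * x) (h : bw x (f * x) (f * (f * x))) (J : ℕ) :
    td x (f ^ J * x) = J * td x (f * x) ∧ bw x (f ^ J * x) (f ^ (J + 1) * x) := by
  have e : ∀ J : ℕ, td (f ^ J * x) (f ^ (J + 1) * x) = td x (f * x) := fun J => by
    rw [pow_succ, mul_assoc, td_left]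
  induction J with
  | zero => simp [bw, td_self]
  | succ J ih =>
    have h1 : bw (f ^ J * x) (f ^ (J + 1) * x) (f ^ (J + 1 + 1) * x) := by
      simp only [pow_succ, mul_assoc, bw_left]; exact h
    have h2 := e J
    refine ⟨?_, (bw_join ih.2 h1 fun c => h0 ?_).1⟩
    · have := ih.2
      unfold bw at this
      rw [← this, ih.1, e]; ring
    · rw [c, td_self] at h2
      exact td_zero.1 h2.symm
lemma le_of_all {a b C : ℕ} (h : ∀ J : ℕ, J * a ≤ J * b + C) : a ≤ b := by
  by_contra hc
  have := h (C + 1)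
  have : (C + 1) * (b + 1) ≤ (C + 1) * a := Nat.mul_le_mul_left _ OM
  nlinarith
lemma norm_td (f x : FG k) : td x (f * x) ≤ f.norm + 2 * x.norm := by
  have h1 := FreeGroup.norm_mul_le (x⁻¹) (f * x)
  have h2 := FreeGroup.norm_mul_le f x
  rw [norm_inv_eq] at h1
  unfold td
  omega
lemma meet {g h : FG k} {Z : ℕ} (hN : ∀ J : ℕ, ((h * g) ^ J).norm ≤ J * 2 + Z) (y : FG k)
    (hy : td y (h * y) = 1) : ∀ (s : ℕ) (p : FG k), td p (g * p) = 1 → td p (h * p) = s →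
    ∃ z, td z (g * z) = 1 ∧ td z (h * z) = 1 := by
  intro s
  induction s using strong_induction_on with
  | _ s ih =>
  intro p hp hs
  obtain ⟨c, hc⟩ := par h p y
  by_cases h1 : td p (h * p) = 1
  · exact ⟨p, hp, h1⟩
  have hpy : p ≠ y := fun e => h1 (e ▸ hy)
  obtain ⟨p', p1, p2⟩ := geo_exists p y 1 (one_le_iff_ne_zero.2 fun e => hpy (td_zero.1 e))
  obtain ⟨s1, s2, s3⟩ := sh (p' := p') hy OM p1 (by unfold bw; omega)
  by_cases h2 : td p' (g * p') = 1
  · exact ih _ OM p' h2 rfl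
  exfalso
  have b1 : bw p (h * p) (h * (g * p)) := by
    have e : td (h * p) (h * (g * p)) = 1 := by rw [td_left, hp]
    rcases stepd p e with a | a
    · unfold bw; rw [td_comm p (h * (g * p)), td_comm p (h * p)]; omega
    · have := geo_unique (x := h * p) (y := p) (z := h * (g * p)) (w := h * p') OM s2
        (by rw [e, td_left, p1])
      rw [← mul_left_cancel this, td_left] at h2
      exact absurd hp h2
  have b2 : bw (h * p) (h * (g * p)) (h * (g * (h * p))) := by
    rw [bw_left]
    have e : td p (g⁻¹ * p) = 1 := by
      rw [← td_left g, mul_inv_cancel_left, td_comm, hp]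
    rw [← bw_left (g := g⁻¹), inv_mul_cancel_left, inv_mul_cancel_left]
    rcases stepd (h * p) e with a | a
    · unfold bw; rw [td_comm _ p]; omega
    · have := geo_unique (x := p) (y := h * p) (z := g⁻¹ * p) (w := p') OM s1 (by rw [e, p1])
      rw [← this, td_comm, mul_inv_cancel_left, td_comm] at h2
      exact absurd e (by rwa [td_comm] at h2)
  have ne1 : h * p ≠ h * (g * p) := fun e => by
    rw [← mul_left_cancel e, td_self] at hp; omega
  have ne2 : h * (g * p) ≠ h * (g * (h * p)) := fun e => by
    rw [← mul_left_cancel (mul_left_cancel e), td_self] at hs hc; omega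
  have b3 := (bw_join b1 b2 ne1).1
  have b4 : bw (h * (g * p)) (h * (g * (h * p))) (h * (g * (h * (g * p)))) := by
    rw [bw_left, bw_left]; exact b1
  have b5 := (bw_join b3 b4 ne2).2
  have ex := loxo (f := h * g) (x := p)
  simp only [mul_assoc] at ex
  have hr : td p (h * (g * p)) = s + 1 := by
    unfold bw at b1
    rw [td_left, hp, hs] at b1
    exact b1.symm
  have L := ex (fun e => by rw [← e, td_self] at hr; omega) b5
  have : s + 1 ≤ 2 := le_of_all (C := Z + 2 * p.norm) fun J => by
    have h1 := (L J).1
    have h2 := norm_td ((h * g) ^ J) p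
    have h3 := hN J
    rw [hr] at h1
    omega
  omega
lemma helly (g : Fin k → FG k) (hg : ∀ l, ∃ y, td y (g l * y) = 1)
    {Z : ℕ} (hN : ∀ l i (J : ℕ), ((g l * g i) ^ J).norm ≤ J * 2 + Z) :
    ∃ p, ∀ l, td p (g l * p) = 1 := by
  let F : FG k → ℕ := fun p => ∑ l, td p (g l * p)
  refine ⟨Function.argmin F, ?_⟩
  set p := Function.argmin F
  have hmin : ∀ x, F p ≤ F x := fun x => Function.argmin_le F x
  by_contra! hc
  obtain ⟨l, hl⟩ := hc
  obtain ⟨y, hy⟩ := hg l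
  obtain ⟨c, hc⟩ := par (g l) p y
  have h2 : 2 ≤ td p (g l * p) := OM
  obtain ⟨p', p1, p2⟩ := geo_exists p (g l * p) 1 OM
  have key : ∀ i, ∃ z, td z (g l * z) = 1 ∧ td z (g i * z) = 1 ∧ bw p p' z := fun i => by
    obtain ⟨x, hx⟩ := hg i
    obtain ⟨z, z1, z2⟩ := meet (hN l i) y hy _ x hx rfl
    refine ⟨z, z2, z1, ?_⟩
    have hpz : p ≠ z := fun e => by rw [e] at h2; omega
    obtain ⟨p'', q1, q2⟩ := geo_exists p z 1 (one_le_iff_ne_zero.2 fun e => hpz (td_zero.1 e))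
    have hb : bw p p'' z := by unfold bw; omega
    have := (sh z2 h2 q1 hb).1
    rwa [geo_unique (x := p) (y := g l * p) (z := p') (w := p'') OM this OM]
  refine absurd (hmin p') (not_le.2 (Finset.sum_lt_sum (fun i _ => ?_) ⟨l, mem_univ _, ?_⟩))
  · obtain ⟨z, z1, z2, z3⟩ := key i
    by_cases h3 : td p (g i * p) = 1
    · rw [h3, flat z2 h3 p1 z3]
    · obtain ⟨c, hc⟩ := par (g i) p z
      have := (sh z2 OM p1 z3).2.2
      omega
  · obtain ⟨z, z1, z2, z3⟩ := key l
    have := (sh z1 h2 p1 z3).2.2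
    omega
end
section

def sd (j : Fin k) (y : FG k) : Set (FG k) := {g | SS j g ≠ SS j (g * y)}
lemma sd_fin (j : Fin k) (y : FG k) : (sd j y).Finite :=
  Set.Finite.of_finite_image ((CB_le y).1.subset (by rintro _ ⟨h, hh, rfl⟩; exact hh))
    (f := fun h => (j, h)) (fun a _ b _ h => by simpa using h)
lemma sd_mul (j : Fin k) (y z : FG k) : (sd j (y * z)).ncard ≤ (sd j y).ncard + (sd j z).ncard := by
  have h1 : sd j (y * z) ⊆ sd j y ∪ (fun g => g * y⁻¹) '' sd j z := fun g hg => by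
    by_cases h : SS j g = SS j (g * y)
    · refine Or.inr ⟨g * y, fun h' => hg ?_, by simp⟩
      rw [h, h', mul_assoc]
    · exact Or.inl h
  have h2 := ncard_le_ncard h1 ((sd_fin j y).union ((sd_fin j z).image _))
  have h3 := ncard_union_le (sd j y) ((fun g => g * y⁻¹) '' sd j z)
  rw [ncard_image_of_injective _ (mul_left_injective _)] at h3
  omega
lemma sd_pow (j : Fin k) (y : FG k) (J : ℕ) : (sd j (y ^ J)).ncard ≤ J * (sd j y).ncard := by
  induction J with
  | zero => simp [sd]
  | succ J ih =>
    have := sd_mul j (y ^ J) y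
    rw [pow_succ]; nlinarith
lemma sd_lt (j l : Fin k) : (sd j (lt (l, true))).ncard ≤ if j = l then 1 else 0 := by
  have h1 := CB_le (lt (l, true))
  rw [lt_norm] at h1
  have h0 : (l, (1 : FG k)) ∈ CB (lt (l, true)) := by
    have e : td (lt (l, true)) (1 : FG k) = 1 := by rw [td_comm, td_one_left, lt_norm]
    simp only [CB, SS, mem_ofPred_eq, one_mul, td_self, e, td_one_left, lt_norm]
    simp
  have h2 : ∀ g ∈ sd j (lt (l, true)), j = l ∧ g = 1 := fun g hg => by
    have : (j, g) ∈ CB (lt (l, true)) := hg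
    simpa using ncard_le_one h1.1 |>.1 h1.2 _ this _ h0
  split_ifs with h
  · exact (ncard_le_one (sd_fin _ _)).2 fun a ha b hb => by rw [(h2 a ha).2, (h2 b hb).2]
  · rw [le_zero, Set.ncard_eq_zero (sd_fin _ _)]
    exact Set.eq_empty_of_forall_notMem fun g hg => h (h2 g hg).1
lemma XX_sd {β : FG k ≃* FG k} {i : Fin k} (h : ∃ x c, Loc (XX β i) x (x * lt c)) :
    ∃ (j : Fin k) (Z : ℕ), ∀ y, {h | XX β i h ≠ XX β i (h * y)}.ncard ≤ (sd j y).ncard + Z := by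
  obtain ⟨x, j, h⟩ : ∃ x j, Loc (XX β i) x (x * lt (j, true)) := by
    obtain ⟨x, ⟨j, c⟩, h⟩ := h
    cases c
    · refine ⟨x * lt (j, false), j, ?_⟩
      have : lt (j, false) * lt (j, true) = 1 := by
        rw [show (j, true) = linv (j, false) from rfl, ← lt_inv, mul_inv_cancel]
      rw [mul_assoc, this, mul_one]; exact h.symm
    · exact ⟨x, j, h⟩
  obtain ⟨c, h1, h2⟩ := h
  have hF := Set.Finite.union h1 h2
  set F := {h | h ∈ Out x (x * lt (j, true)) ∧ XX β i h ≠ c} ∪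
    {h | h ∈ Out (x * lt (j, true)) x ∧ XX β i h ≠ !c} with hFd
  have key : ∀ h, h ∉ F → XX β i h = xor c (SS j (x⁻¹ * h)) := fun h hh => by
    have e : SS j (x⁻¹ * h) = true ↔ h ∈ Out (x * lt (j, true)) x := by
      rw [mem_cone, SS_tr, inv_inv]
    simp only [hFd, Set.mem_union, mem_ofPred_eq, not_or, not_and, not_not] at hh
    by_cases hc : SS j (x⁻¹ * h) = true
    · rw [hh.2 (e.1 hc), hc]; simp
    · rw [hh.1 ?_, Bool.eq_false_iff.2 hc]
      · simp
      · have := mem_cone.not.1 (e.not.1 hc)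
        have := dir x h (j, true)
        have t := td_lt x (j, true)
        simp only [Out, bw, mem_ofPred_eq]
        rw [td_comm h x, td_comm h]
        omega
  refine ⟨j, 2 * F.ncard, fun y => ?_⟩
  have hs : {h | XX β i h ≠ XX β i (h * y)} ⊆ ((fun g => x * g) '' sd j y ∪ F) ∪ (fun g => g * y⁻¹) '' F := by
    intro h hh
    by_cases a : h ∈ F
    · exact Or.inl (Or.inr a)
    by_cases b : h * y ∈ F
    · exact Or.inr ⟨h * y, b, by simp⟩
    refine Or.inl (Or.inl ⟨x⁻¹ * h, fun e => hh ?_, by simp⟩)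
    rw [key _ a, key _ b, ← mul_assoc, ← e]
  have h3 := ncard_le_ncard hs (((((sd_fin j y).image _)).union hF).union (hF.image _))
  have h4 := ncard_union_le ((fun g => x * g) '' sd j y ∪ F) ((fun g => g * y⁻¹) '' F)
  have h5 := ncard_union_le ((fun g => x * g) '' sd j y) F
  rw [ncard_image_of_injective _ (mul_left_injective _)] at h4
  rw [ncard_image_of_injective _ (mul_right_injective _)] at h5
  omega
theorem C5 {β : FG k ≃* FG k} (h : ∀ i, ∃ x c, Loc (XX β i) x (x * lt c)) :
    ∃ (p : FG k) (σ : Fin k → Letter k), ∀ l, β (lt (l, true)) = p * lt (σ l) * p⁻¹ := by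
  classical
  choose j Z hj using fun i => XX_sd (h i)
  have nb : ∀ y, (β y).norm ≤ ∑ i, (sd (j i) y).ncard + ∑ i, Z i := fun y => by
    rw [← (EB_card β y).2, ← sum_add_distrib, ncard_eq_toFinset_card _ (EB_card β y).1]
    have : (EB_card β y).1.toFinset ⊆ univ.biUnion fun i =>
        (XX_fin β i y).toFinset.image fun g => (i, g) := by
      rintro ⟨i, g⟩ hg
      rw [Set.Finite.mem_toFinset] at hg
      simp only [mem_biUnion, mem_univ, true_and, mem_image]
      exact ⟨i, g, by rw [Set.Finite.mem_toFinset]; exact hg, rfl⟩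
    refine (card_le_card this).trans (card_biUnion_le.trans (sum_le_sum fun i _ => ?_))
    refine card_image_le.trans ?_
    rw [← ncard_eq_toFinset_card _ (XX_fin β i y)]
    exact hj i y
  have pw : ∀ (y : FG k) (J : ℕ), ((β y) ^ J).norm ≤ J * ∑ i, (sd (j i) y).ncard + ∑ i, Z i := fun y J => by
    rw [← map_pow, mul_sum]
    exact (nb _).trans (by gcongr; exact sd_pow ..)
  have s1 : ∀ l, ∑ i, (sd (j i) (lt (l, true))).ncard ≤ (univ.filter fun i => j i = l).card := fun l => by
    rw [card_filter]
    exact sum_le_sum fun i _ => sd_lt ..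
  have tl : ∀ l, ∃ (a : FG k) (w : LW k), w ≠ [] ∧ CyclicallyReducedWord w ∧
      β (lt (l, true)) = a * mk w * a⁻¹ ∧
      w.length ≤ ∑ i, (sd (j i) (lt (l, true))).ncard := fun l => by
    obtain ⟨a, w, w0, wc, hw⟩ := cyc_conj (β (lt (l, true))) (by
      rw [Ne, EmbeddingLike.map_eq_one_iff]
      intro e
      have := lt_norm (l, true)
      rw [e] at this; simp at this)
    refine ⟨a, w, w0, wc, hw, le_of_all (C := ∑ i, Z i + 2 * a.norm) fun J => ?_⟩
    have h1 := pp_dist w0 wc (by have := l.2; omega : 0 < k) 0 (0 + w.length * J)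
    rw [q_perz (pp_per w0), pp_zero, td_one_left, mul_one, zpow_natCast] at h1
    have h2 := norm_td (β (lt (l, true)) ^ J) a
    have h3 := pw (lt (l, true)) J
    rw [hw, conj_pow, inv_mul_cancel_right] at h2
    unfold td at h2
    rw [inv_mul_cancel_left, h1, ← conj_pow, ← hw] at h2
    have : ((0 : ℤ) - (0 + w.length * J)).natAbs = J * w.length := by
      rw [zero_add, zero_sub, Int.natAbs_neg, ← Nat.cast_mul, Int.natAbs_natCast, mul_comm]
    omega
  have sj : Function.Surjective j := fun l => by
    obtain ⟨a, w, w0, -, -, h1⟩ := tl l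
    have := length_pos_iff.2 w0
    have := s1 l
    obtain ⟨i, hi⟩ := card_pos.1 (show 0 < (univ.filter fun i => j i = l).card by omega)
    exact ⟨i, by simpa using hi⟩
  have ij := Finite.injective_iff_surjective.2 sj
  have s2 : ∀ l, ∑ i, (sd (j i) (lt (l, true))).ncard ≤ 1 := fun l => (s1 l).trans
    (card_le_one.2 fun a ha b hb => ij (by simp at ha hb; rw [ha, hb]))
  obtain ⟨p, hp⟩ := helly (Z := ∑ i, Z i) (fun l => β (lt (l, true))) (fun l => by
    obtain ⟨a, w, w0, wc, hw, h1⟩ := tl l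
    have h2 := length_pos_iff.2 w0
    refine ⟨a, ?_⟩
    unfold td
    rw [hw, inv_mul_cancel_right, inv_mul_cancel_left, norm_mk (isReduced_of_cyc wc)]
    have := s2 l
    omega) (fun l i J => by
    rw [← map_mul]
    refine (pw _ J).trans ?_
    gcongr
    refine (sum_le_sum fun i' _ => sd_mul ..).trans ?_
    rw [sum_add_distrib]
    have := s2 l
    have := s2 i
    omega)
  choose σ hσ using fun l => td_one (hp l)
  exact ⟨p, σ, fun l => by rw [← hσ]; simp⟩
end
section

lemma on_axis (hk : 0 < k) {v : LW k} (h : v ≠ []) (hu : CyclicallyReducedWord v) {x : FG k}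
    (hx : td x (mk v * x) = v.length) : ∃ i, x = pp v i := by
  have dd := pp_dist h hu hk
  have hn : 0 < v.length := length_pos_iff.2 h
  have hP : ∃ d, ∃ i, td x (pp v i) = d := ⟨_, 0, rfl⟩
  classical
  obtain ⟨s, hs⟩ := find_spec hP
  have hmin : ∀ i, td x (pp v s) ≤ td x (pp v i) := fun i => hs ▸ find_min' hP ⟨i, rfl⟩
  have key : ∀ t, td x (pp v t) = td x (pp v s) + (s - t).natAbs := fun t => by
    obtain ⟨c, h1, h2, h3⟩ := median x (pp v s) (pp v t)
    have d1 := dd s t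
    unfold bw at *
    have hle : td (pp v s) c ≤ (s - t).natAbs := OM
    obtain ⟨r, hr⟩ : ∃ r : ℤ, (s - r).natAbs = td (pp v s) c ∧
        (r - t).natAbs = (s - t).natAbs - td (pp v s) c := by
      rcases le_total s t with g | g
      · exact ⟨s + td (pp v s) c, OM, OM⟩
      · exact ⟨s - td (pp v s) c, OM, OM⟩
    have hc : c = pp v r := geo_unique h2 (by rw [dd, dd]; omega) (by rw [dd]; omega)
    have := hmin r
    rw [← hc] at this
    rw [td_comm c (pp v s)] at h1
    have hz : td (pp v s) c = 0 := OM
    rw [← td_zero.1 hz] at h3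
    omega
  have e1 := key (s + v.length)
  have e2 : td (mk v * x) (pp v s) = td x (pp v (s - v.length)) := by
    rw [show pp v s = mk v * pp v (s - v.length) by rw [← pp_per h]; congr 1; ring, td_left]
  have e3 : td (mk v * x) (pp v (s + v.length)) = td x (pp v s) := by
    rw [pp_per h, td_left]
  have e4 := key (s - v.length)
  have e5 := dd s (s + v.length)
  have := fp x (mk v * x) (pp v s) (pp v (s + v.length))
  exact ⟨s, td_zero.1 OM⟩
def Cy (k n : ℕ) : Set (FG k) := {g | g ∈ Cset k ∧ wordLength g = n}
lemma conj_card (hk : 0 < k) {n : ℕ} (hn : 1 ≤ n) (w : FG k) :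
    ∃ F : Finset (FG k), F.card ≤ n ∧ ∀ v ∈ Cy k n, (∃ g, v = g * w * g⁻¹) → v ∈ F := by
  classical
  by_cases hex : ∃ v ∈ Cy k n, ∃ g, v = g * w * g⁻¹
  swap
  · exact ⟨∅, by simp, fun v h1 h2 => (hex ⟨v, h1, h2⟩).elim⟩
  obtain ⟨v, ⟨hv1, hv2⟩, g, hg⟩ := hex
  have hl : v.toWord.length = n := hv2
  have hne : v.toWord ≠ [] := fun e => by rw [e] at hl; simp at hl; omega
  refine ⟨(range n).image fun i : ℕ => (pp v.toWord i)⁻¹ * v * pp v.toWord i,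
    card_image_le.trans (by simp), ?_⟩
  rintro v' ⟨h1, h2⟩ ⟨g', hg'⟩
  set x := g * g'⁻¹ with hx
  have e : v' = x⁻¹ * v * x := by rw [hg', hg, hx]; group
  obtain ⟨i, hi⟩ := on_axis hk hne hv1 (x := x) (by
    rw [mk_toWord, td, hl, ← h2, e, mul_assoc]; rfl)
  refine mem_image.2 ⟨(i % n).toNat, ?_, ?_⟩
  · have := Int.emod_lt_of_pos i (by omega : (0 : ℤ) < n)
    have := Int.emod_nonneg i (by omega : (n : ℤ) ≠ 0)
    simp; omega
  have h0 := Int.emod_nonneg i (by omega : (n : ℤ) ≠ 0)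
  have := q_perz (W := v) (q := pp v.toWord) (L := n) (fun i => by
    have := pp_per hne i; rwa [mk_toWord, hl] at this) (i / n) ((i % n).toNat : ℕ)
  rw [show (((i % n).toNat : ℕ) : ℤ) + n * (i / n) = i by
    rw [Int.toNat_of_nonneg h0]; exact Int.emod_add_mul_ediv i n, ← hi] at this
  rw [e, this, mul_inv_rev]
  have hc := (Commute.zpow_self v (i / n)).eq
  simp only [mul_assoc]
  rw [← mul_assoc v (v ^ (i/n)), ← hc, mul_assoc, inv_mul_cancel_left]
def P3 (hk : 0 < k) (m lo hi : ℕ) (u : LW k) : Prop :=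
  ∀ c d : Letter k, d ≠ linv c →
    lo + 16 * m + 2 ≤ ((range u.length).filter fun t : ℕ => win hk u t 2 = [c, d]).card ∧
    ((range u.length).filter fun t : ℕ => win hk u t 2 = [c, d]).card ≤ hi
lemma tn_of {hk : 0 < k} {m lo hi : ℕ} {u : LW k} (h : u ≠ []) (k2 : 2 ≤ k)
    (H : Ln k u.length m (mk u) (pp u)) (h3 : P3 hk m lo hi u) (a b : ℤ)
    (h1 : (u.length : ℤ) - 16 * m ≤ b - a) (h2 : b - a < u.length) :
    Tn k u.length m (mk u) (pp u) (fun i => linv (uu hk u (i - 1))) (fun i => uu hk u i)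
      a b lo hi where
  H := H
  k2 := k2
  he i := by
    have := pp_succ (hk := hk) h (i - 1)
    rw [sub_add_cancel] at this
    rw [this, ← lt_inv]; group
  hf i := pp_succ h i
  hab := by have := H.hn; have := H.hm; omega
  hbn := h2
  tc c d hcd := by
    have hn : (0 : ℤ) < u.length := by exact_mod_cast length_pos_iff.2 h
    obtain ⟨g1, g2⟩ := h3 (linv c) d (by rw [linv_linv]; exact hcd.symm)
    have hw : ∀ i : ℤ, (linv (uu hk u (i - 1)), uu hk u i) = (c, d) ↔ win hk u (i - 1) 2 = [linv c, d] := by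
      intro i
      have : win hk u (i - 1) 2 = [uu hk u (i - 1), uu hk u i] := by simp [win, range_succ]
      rw [this, Prod.mk.injEq]
      constructor
      · rintro ⟨h, h'⟩; rw [← h, ← h', linv_linv]
      · intro h
        rw [List.cons.injEq, List.cons.injEq] at h
        rw [h.1, h.2.1, linv_linv]; exact ⟨rfl, rfl⟩
    simp only [hw]
    set φ : ℤ → ℕ := fun i => ((i - 1) % u.length).toNat with hφ
    have f0 : ∀ i : ℤ, ((φ i : ℕ) : ℤ) = (i - 1) % u.length := fun i =>
      Int.toNat_of_nonneg (Int.emod_nonneg _ hn.ne')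
    have f1 : ∀ i, φ i < u.length := fun i => by
      have := f0 i; have := Int.emod_lt_of_pos (i - 1) hn; omega
    have f2 : ∀ i, win hk u (φ i) 2 = win hk u (i - 1) 2 := fun i => win_eq_of (by
      rw [f0]; exact ⟨-((i - 1) / u.length), by have := Int.emod_add_mul_ediv (i - 1) u.length; linarith⟩) 2
    have inj : ∀ i ∈ Ico a (a + u.length), ∀ j ∈ Ico a (a + u.length), φ i = φ j → i = j := by
      intro i hi j hj e
      rw [mem_Ico] at hi hj
      have e' : (i - 1) % u.length = (j - 1) % u.length := by rw [← f0, ← f0, e]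
      obtain ⟨t, ht⟩ := Int.ModEq.dvd e'
      have : t = 0 := by
        by_contra h0
        rcases Int.lt_or_gt_of_ne h0 with h0 | h0 <;> nlinarith
      subst this; omega
    constructor
    · have hsub : ((range u.length).filter fun t : ℕ => win hk u t 2 = [linv c, d]) ⊆
          (((Ioo a b).filter fun i => win hk u (i - 1) 2 = [linv c, d]) ∪
            ({a} ∪ Ico b (a + u.length))).image φ := by
        intro t ht
        rw [mem_filter, mem_range] at ht
        have r1 := Int.emod_nonneg ((t : ℤ) + 1 - a) hn.ne'
        have r2 := Int.emod_lt_of_pos ((t : ℤ) + 1 - a) hn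
        have r3 := Int.emod_add_mul_ediv ((t : ℤ) + 1 - a) u.length
        set i := a + ((t : ℤ) + 1 - a) % u.length with hi
        have hti : φ i = t := by
          have := f0 i
          have e : (i - 1) % u.length = t % u.length := by
            rw [show i - 1 = t + u.length * (-(((t : ℤ) + 1 - a) / u.length)) by linarith]; simp
          rw [e, Int.emod_eq_of_lt OM OM] at this
          omega
        refine mem_image.2 ⟨i, ?_, hti⟩
        have hwi := f2 i
        rw [hti, ht.2] at hwi
        simp only [mem_union, mem_filter, mem_Ioo, mem_singleton, mem_Ico,
          ← hwi, and_true]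
        omega
      have c1 := (card_le_card hsub).trans (card_image_le.trans (card_union_le _ _))
      have c2 := card_union_le {a} (Ico b (a + u.length))
      simp only [Finset.card_singleton, Int.card_Ico] at c2
      omega
    · refine le_trans (card_le_card_of_injOn φ ?_ ?_) g2
      · intro i hi
        simp only [coe_filter, mem_ofPred_eq, mem_Ioo, mem_range] at hi ⊢
        exact ⟨f1 i, (f2 i).trans hi.2⟩
      · intro i hi j hj
        simp only [coe_filter, mem_ofPred_eq, mem_Ioo] at hi hj
        exact inj i (by rw [mem_Ico]; omega) j (by rw [mem_Ico]; omega)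
end
section

theorem class_bound {hk : 0 < k} {m j B lo hi δ : ℕ} {u : LW k} (D : Gd hk m j B u)
    (h3 : P3 hk m lo hi u)
    (hδ : 2 * hi + 2 * (m + 1) + δ ≤ 4 * lo) (hδ2 : δ ≤ 2 * lo)
    (hn1 : u.length < k * (2 * (2 * k - 1) * lo) + δ)
    (hn2 : u.length < k * (2 * (2 * (2 * k - 1) * lo))) :
    ∃ F : Finset (FG k), F.card ≤ 2 * (2 * k) ^ k * u.length ∧ ∀ v ∈ Cy k u.length,
      Nonempty (OneRel k (mk u) ≃* OneRel k v) → v ∈ F := by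
  classical
  have hn : 1 ≤ u.length := length_pos_iff.2 D.ne
  choose F hF1 hF2 using conj_card hk hn
  let S : (Fin k → Letter k) → FG k →* FG k := fun σ => lift fun l => lt (σ l)
  refine ⟨(univ : Finset ((Fin k → Letter k) × Bool)).biUnion fun s =>
    F (if s.2 then S s.1 (mk u) else (S s.1 (mk u))⁻¹), ?_, ?_⟩
  · refine (card_biUnion_le_card_mul _ _ u.length fun s _ => hF1 _).trans (le_of_eq ?_)
    simp [Letter]; left; ring
  rintro v hv ⟨φ⟩
  have hv1 : v ≠ 1 := fun e => by
    have := hv.2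
    rw [e, wordLength, FreeGroup.toWord_one] at this; simp at this; omega
  let q : FG k →* OneRel k (mk u) := φ.symm.toMonoidHom.comp (QuotientGroup.mk' _)
  obtain ⟨β, hβ⟩ := D.thm2 (q := q) (φ.symm.surjective.comp (QuotientGroup.mk'_surjective _))
  obtain ⟨⟨g, hg⟩, hl⟩ := C4 D.k2 D.ln (tn_of D.ne D.k2 D.ln h3) hδ hδ2 hn1 hn2 (v := v) (le_of_eq hv.2) hv1
    (β := β) (fun x hx => by
      have h := hβ x
      have e : q (β x) = 1 := by
        change φ.symm (QuotientGroup.mk (β x)) = 1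
        rw [(QuotientGroup.eq_one_iff _).2 hx, map_one]
      rw [e] at h
      exact (QuotientGroup.eq_one_iff _).1 h.symm)
  obtain ⟨p, σ, hσ⟩ := C5 hl
  have hb : β.toMonoidHom = (MulAut.conj p).toMonoidHom.comp (S σ) := by
    refine ext_hom _ _ fun l => ?_
    have := hσ l
    change β (of l) = p * (S σ (of l)) * p⁻¹
    rw [lift_apply_of]; exact this
  have hb' : β (mk u) = p * S σ (mk u) * p⁻¹ := DFunLike.congr_fun hb _
  rw [hb'] at hg
  rw [mem_biUnion]
  rcases hg with hg | hg
  · exact ⟨(σ, true), mem_univ _, hF2 _ v hv ⟨g * p, by rw [hg]; simp; group⟩⟩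
  · exact ⟨(σ, false), mem_univ _, hF2 _ v hv ⟨g * p, by rw [hg]; simp; group⟩⟩
end
section

def Mt (F : LW k → ℝ) : LW k → LW k → ℝ
  | _, [] => 0
  | h, b :: w => F (b :: h) + Mt F (b :: h) w
lemma Mt_sum (F : LW k → ℝ) (h w : LW k) :
    Mt F h w = ∑ s ∈ range w.length, F ((w.take (s + 1)).reverse ++ h) := by
  induction w generalizing h with
  | nil => simp [Mt]
  | cons b w ih => simp [Mt, ih, sum_range_succ']; ring
lemma mart {F : LW k → ℝ} (h0 : ∀ c h, ∑ b ∈ univ.erase (linv c), F (b :: c :: h) = 0)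
    (h1 : ∀ l, |F l| ≤ 1) (N : ℕ) : ∀ c h, ∑ w ∈ Wd c N, Mt F (c :: h) w = 0 ∧
      ∑ w ∈ Wd c N, Mt F (c :: h) w ^ 2 ≤ N * ((2 * k - 1 : ℕ) : ℝ) ^ N := by
  have hc : ∀ c : Letter k, ((univ.erase (linv c)).card : ℝ) = ((2 * k - 1 : ℕ) : ℝ) := fun c => by
    rw [card_erase_of_mem (mem_univ _), card_univ]; simp [Letter, mul_comm]
  induction N with
  | zero => intro c h; simp [Wd, Mt]
  | succ N ih =>
    intro c h
    constructor
    · rw [sum_Wd]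
      simp only [Mt, sum_add_distrib, sum_const, card_Wd, (ih _ _).1, add_zero, ← Finset.smul_sum, h0,
        smul_zero]
    · rw [sum_Wd]
      have : ∀ b ∈ univ.erase (linv c), ∑ w ∈ Wd b N, Mt F (c :: h) (b :: w) ^ 2 ≤
          (N + 1) * ((2 * k - 1 : ℕ) : ℝ) ^ N := fun b _ => by
        simp only [Mt, add_sq, sum_add_distrib, sum_const, card_Wd, ← mul_sum, (ih _ _).1,
          mul_zero, add_zero, nsmul_eq_mul]
        have a1 := (ih b (c :: h)).2
        have a2 : F (b :: c :: h) ^ 2 ≤ 1 := (sq_le_one_iff_abs_le_one _).2 (h1 _)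
        have a3 : (0 : ℝ) ≤ ((2 * k - 1 : ℕ) : ℝ) ^ N := by positivity
        push_cast at a1 ⊢
        nlinarith
      refine (sum_le_sum this).trans (le_of_eq ?_)
      rw [sum_const, nsmul_eq_mul, hc]; push_cast; ring
lemma cheb {F : LW k → ℝ} (h0 : ∀ c h, ∑ b ∈ univ.erase (linv c), F (b :: c :: h) = 0)
    (h1 : ∀ l, |F l| ≤ 1) (N : ℕ) (c : Letter k) {K : ℝ} (hK : 0 < K) :
    (((Wd c N).filter fun w => K ≤ |Mt F [c] w|).card : ℝ) ≤ N * ((2 * k - 1 : ℕ) : ℝ) ^ N / K ^ 2 := by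
  rw [le_div_iff₀ (by positivity)]
  refine le_trans ?_ (mart h0 h1 N c []).2
  rw [← nsmul_eq_mul, ← sum_const]
  refine (sum_le_sum fun w hw => ?_).trans (Finset.sum_le_sum_of_subset_of_nonneg
    (filter_subset _ _) fun _ _ _ => sq_nonneg _)
  rw [← sq_abs (Mt F [c] w)]
  exact pow_le_pow_left₀ hK.le (mem_filter.1 hw).2 2
open Classical in
noncomputable def fz (z : LW k) (d : Letter k) (l : LW k) : ℝ :=
  if z <+: l.tail ∧ l.tail.head? ≠ some (linv d) then
    (if l.head? = some d then 1 else 0) - 1 / ((2 * k - 1 : ℕ) : ℝ) else 0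
lemma fz_zero (k2 : 2 ≤ k) (z : LW k) (d c : Letter k) (h : LW k) :
    ∑ b ∈ univ.erase (linv c), fz z d (b :: c :: h) = 0 := by
  have hq : ((2 * k - 1 : ℕ) : ℝ) ≠ 0 := by
    have : 2 * k - 1 ≠ 0 := OM
    exact_mod_cast this
  simp only [fz, List.tail_cons, List.head?_cons, Option.some.injEq]
  split_ifs with hh
  · have hd : d ∈ Finset.univ.erase (linv c) := by
      simp; rintro rfl; exact hh.2 (by rw [linv_linv])
    rw [Finset.sum_sub_distrib, Finset.sum_ite_eq' _ d, if_pos hd, Finset.sum_const,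
      Finset.card_erase_of_mem (Finset.mem_univ _), Finset.card_univ]
    have : Fintype.card (Letter k) = 2 * k := by simp [Letter, mul_comm]
    rw [this, nsmul_eq_mul, mul_one_div, div_self hq, sub_self]
  · simp
lemma fz_le (k2 : 2 ≤ k) (z : LW k) (d : Letter k) (l : LW k) : |fz z d l| ≤ 1 := by
  have hq : (1 : ℝ) ≤ ((2 * k - 1 : ℕ) : ℝ) := by
    have : 1 ≤ 2 * k - 1 := OM
    exact_mod_cast this
  have h1 : 1 / ((2 * k - 1 : ℕ) : ℝ) ≤ 1 := by rw [div_le_one (by linarith)]; exact hq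
  have h2 : 0 ≤ 1 / ((2 * k - 1 : ℕ) : ℝ) := by positivity
  unfold fz
  rw [abs_le]
  split_ifs <;> constructor <;> linarith
def Aw (k l : ℕ) : Finset (LW k) :=
  (range l).biUnion fun i => univ.image fun v : Fin i → Letter k => List.ofFn v
lemma mem_Aw {l : ℕ} {z : LW k} (h : z.length < l) : z ∈ Aw k l := by
  refine mem_biUnion.2 ⟨z.length, mem_range.2 h, mem_image.2 ⟨z.get, mem_univ _, ?_⟩⟩
  exact List.ofFn_get z
lemma card_Aw (k2 : 2 ≤ k) (l : ℕ) : (Aw k l).card ≤ (4 * k) ^ l := by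
  refine (card_biUnion_le_card_mul _ _ ((2 * k) ^ l) fun i hi => ?_).trans ?_
  · refine card_image_le.trans ?_
    rw [card_univ, Fintype.card_fun]
    simp only [Letter, Fintype.card_prod, Fintype.card_fin, Fintype.card_bool]
    rw [mul_comm k 2]
    exact pow_le_pow_right OM (mem_range.1 hi).le
  · rw [card_range, show 4 * k = 2 * (2 * k) by ring, mul_pow 2 (2 * k)]
    exact Nat.mul_le_mul_right _ lt_two_pow_self.le
def Dv (l : ℕ) (K : ℝ) (c : Letter k) (w : LW k) : Prop :=
  ∀ z : LW k, z.length < l → ∀ d, |Mt (fz z d) [c] w| < K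
open Classical in
lemma dv_card (k2 : 2 ≤ k) (l N : ℕ) {K : ℝ} (hK : 0 < K) (c : Letter k) :
    (((Wd c N).filter fun w => ¬ Dv l K c w).card : ℝ) ≤
      (4 * k : ℝ) ^ (l + 1) * N / K ^ 2 * ((2 * k - 1 : ℕ) : ℝ) ^ N := by
  have hsub : ((Wd c N).filter fun w => ¬ Dv l K c w) ⊆ (Aw k l ×ˢ (univ : Finset (Letter k))).biUnion
      fun x => (Wd c N).filter fun w => K ≤ |Mt (fz x.1 x.2) [c] w| := by
    intro w hw
    rw [mem_filter, Dv] at hw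
    push Not at hw
    obtain ⟨hw, z, hz, d, hd⟩ := hw
    exact mem_biUnion.2 ⟨(z, d), mem_product.2 ⟨mem_Aw hz, mem_univ _⟩,
      mem_filter.2 ⟨hw, hd⟩⟩
  have h1 := (card_le_card hsub).trans card_biUnion_le
  have h2 : (((Wd c N).filter fun w => ¬ Dv l K c w).card : ℝ) ≤
      ∑ x ∈ Aw k l ×ˢ (univ : Finset (Letter k)), N * ((2 * k - 1 : ℕ) : ℝ) ^ N / K ^ 2 := by
    refine le_trans (cast_le.2 h1) ?_
    push_cast
    exact sum_le_sum fun x _ => cheb (fz_zero k2 _ _) (fz_le k2 _ _) N c hK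
  refine h2.trans ?_
  rw [sum_const, nsmul_eq_mul, card_product, card_univ]
  have h3 : (((Aw k l).card * Fintype.card (Letter k) : ℕ) : ℝ) ≤ (4 * k : ℝ) ^ (l + 1) := by
    have : (Aw k l).card * Fintype.card (Letter k) ≤ (4 * k) ^ (l + 1) := by
      rw [pow_succ]
      refine Nat.mul_le_mul (card_Aw k2 l) ?_
      simp [Letter]; omega
    exact_mod_cast this
  rw [show (4 * k : ℝ) ^ (l + 1) * N / K ^ 2 * ((2 * k - 1 : ℕ) : ℝ) ^ N =
    (4 * k : ℝ) ^ (l + 1) * (N * ((2 * k - 1 : ℕ) : ℝ) ^ N / K ^ 2) by ring]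
  exact mul_le_mul_of_nonneg_right h3 (by positivity)
end
section

def hs (u : LW k) (s : ℕ) : LW k := (u.take (s + 1)).reverse
lemma hs_succ {u : LW k} (hu : FreeGroup.IsReduced u) {s : ℕ} (h : s + 1 < u.length) :
    ∃ a b r, hs u (s + 1) = b :: a :: r ∧ hs u s = a :: r ∧ b ≠ linv a := by
  have e1 : u.take (s + 1) = u.take s ++ [u[s]] := by rw [take_succ_eq_append_getElem]
  have e2 : u.take (s + 1 + 1) = u.take s ++ [u[s]] ++ [u[s + 1]] := by
    rw [take_succ_eq_append_getElem (i := s + 1) h, e1]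
  refine ⟨u[s], u[s + 1], (u.take s).reverse, by rw [hs, e2]; simp, by rw [hs, e1]; simp, ?_⟩
  rw [← take_append_drop (s + 2) u, e2, isReduced_append, append_assoc, isReduced_append] at hu
  exact (red_cons.1 hu.1.2.1).1
open Classical in
noncomputable def Oc (u : LW k) (N i : ℕ) (z : LW k) : ℝ :=
  ∑ s ∈ range N, if z <+: hs u (s + i) then 1 else 0
lemma Oc_shift (u : LW k) (N : ℕ) (z : LW k) :
    |Oc u N 1 z - Oc u N 0 z| ≤ 1 := by
  classical
  have h1 := Finset.sum_range_succ (fun s => if z <+: hs u s then (1 : ℝ) else 0) N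
  have h2 := sum_range_succ' (fun s => if z <+: hs u s then (1 : ℝ) else 0) N
  have e : Oc u N 1 z - Oc u N 0 z = (if z <+: hs u N then (1 : ℝ) else 0) - (if z <+: hs u 0 then (1 : ℝ) else 0) := by
    simp only [Oc, add_zero]; linarith
  rw [e, abs_le]
  split_ifs <;> norm_num
variable {c : Letter k} {w : LW k} {N l : ℕ} {K : ℝ}
lemma Mt_hs (F : LW k → ℝ) (hw : w.length = N) :
    Mt F [c] w = ∑ s ∈ range N, F (hs (c :: w) (s + 1)) := by
  rw [Mt_sum, hw]; simp [hs]
lemma Mt_cons (hw : w ∈ Wd c N) {d x : Letter k} {z : LW k} (hx : x ≠ linv d) :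
    Mt (fz (x :: z) d) [c] w = Oc (c :: w) N 1 (d :: x :: z) -
      Oc (c :: w) N 0 (x :: z) / ((2 * k - 1 : ℕ) : ℝ) := by
  classical
  obtain ⟨h1, h2⟩ := mem_Wd.1 hw
  rw [Mt_hs _ h1, Oc, Oc, sum_div, ← sum_sub_distrib]
  refine sum_congr rfl fun s hs' => ?_
  obtain ⟨a, b, r, e1, e2, e3⟩ := hs_succ h2 (s := s) (by simp [h1]; simpa using hs')
  rw [add_zero, e1, e2]
  simp only [fz, List.tail_cons, List.head?_cons, List.cons_prefix_cons, Option.some.injEq, ne_eq]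
  by_cases ha : x = a
  · subst ha
    by_cases hz : z <+: r <;> by_cases hb : d = b
    · subst hb; simp [hz, hx]
    · simp [hz, hx, hb, Ne.symm hb]
    · simp [hz]
    · simp [hz]
  · simp [ha]
lemma Mt_nil (hw : w ∈ Wd c N) (d : Letter k) :
    Mt (fz [] d) [c] w = Oc (c :: w) N 1 [d] -
      (N - Oc (c :: w) N 0 [linv d]) / ((2 * k - 1 : ℕ) : ℝ) := by
  classical
  obtain ⟨h1, h2⟩ := mem_Wd.1 hw
  have hN : (N : ℝ) = ∑ s ∈ range N, 1 := by simp
  rw [Mt_hs _ h1, Oc, Oc, hN, ← sum_sub_distrib, sum_div, ← sum_sub_distrib]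
  refine sum_congr rfl fun s hs' => ?_
  obtain ⟨a, b, r, e1, e2, e3⟩ := hs_succ h2 (s := s) (by simp [h1]; simpa using hs')
  rw [add_zero, e1, e2]
  simp only [fz, List.tail_cons, List.head?_cons, List.cons_prefix_cons, Option.some.injEq, ne_eq,
    List.nil_prefix, true_and, and_true]
  by_cases ha : a = linv d
  · subst ha
    rw [linv_linv] at e3
    simp [Ne.symm e3]
  · by_cases hb : b = d
    · subst hb; simp [ha, Ne.symm ha]
    · simp [ha, hb, Ne.symm ha, Ne.symm hb]
lemma two_abs {x y N q K : ℝ} (hq : 3 ≤ q) (h1 : |x - (N - y) / q| ≤ K) (h2 : |y - (N - x) / q| ≤ K) :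
    |x - N / (q + 1)| ≤ 2 * K := by
  have hq0 : q ≠ 0 := by linarith
  have hq1 : q + 1 ≠ 0 := by linarith
  have hK : 0 ≤ K := (abs_nonneg _).trans h1
  have e : (x - N / (q + 1)) * (q - 1) * (q + 1) = q * (q * (x - (N - y) / q)) - q * (y - (N - x) / q) := by
    field_simp; ring
  have hK2 : 0 ≤ K * (q * q - q - 2) := mul_nonneg hK (by nlinarith)
  rw [abs_le] at *
  constructor
  · have : -(2 * K) * ((q - 1) * (q + 1)) ≤ (x - N / (q + 1)) * ((q - 1) * (q + 1)) := by
      rw [← mul_assoc (x - _), e]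
      nlinarith [mul_le_mul_of_nonneg_left h1.1 (by positivity : 0 ≤ q * q), mul_le_mul_of_nonneg_left h2.2 (by linarith : 0 ≤ q)]
    exact le_of_mul_le_mul_right this (by nlinarith)
  · have : (x - N / (q + 1)) * ((q - 1) * (q + 1)) ≤ 2 * K * ((q - 1) * (q + 1)) := by
      rw [← mul_assoc (x - _), e]
      nlinarith [mul_le_mul_of_nonneg_left h1.2 (by positivity : 0 ≤ q * q), mul_le_mul_of_nonneg_left h2.1 (by linarith : 0 ≤ q)]
    exact le_of_mul_le_mul_right this (by nlinarith)
lemma Oc_est (k2 : 2 ≤ k) (hw : w ∈ Wd c N) (hD : Dv l K c w) (hK : 0 ≤ K) (z : LW k) :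
    ∀ d, FreeGroup.IsReduced (d :: z) → z.length < l →
    |Oc (c :: w) N 1 (d :: z) - N / (2 * k * ((2 * k - 1 : ℕ) : ℝ) ^ z.length)| ≤ 2 * (K + 1) := by
  have hq : (3 : ℝ) ≤ ((2 * k - 1 : ℕ) : ℝ) := by
    have : 3 ≤ 2 * k - 1 := OM
    exact_mod_cast this
  have hqk : (2 * k : ℝ) = ((2 * k - 1 : ℕ) : ℝ) + 1 := by
    have : 2 * k = (2 * k - 1) + 1 := OM
    exact_mod_cast this
  set q := ((2 * k - 1 : ℕ) : ℝ) with hqd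
  have dv : ∀ x y : ℝ, |x - y| ≤ 1 → |x / q - y / q| ≤ 1 := fun x y h => by
    rw [← sub_div, abs_div, abs_of_pos (by linarith : 0 < q), div_le_one (by linarith)]; linarith
  induction z with
  | nil =>
    intro d _ hl
    have st : ∀ d : Letter k, |Oc (c :: w) N 1 [d] - (N - Oc (c :: w) N 1 [linv d]) / q| ≤ K + 1 := fun d => by
      have a1 := hD [] hl d
      rw [Mt_nil hw] at a1
      have a2 := dv _ _ (Oc_shift (c :: w) N [linv d])
      rw [abs_lt] at a1
      rw [sub_div] at a1 ⊢
      rw [abs_le] at *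
      constructor <;> linarith [a1.1, a1.2, a2.1, a2.2]
    have s2 := st (linv d)
    rw [linv_linv] at s2
    have := two_abs hq (st d) s2
    simpa [hqk] using this
  | cons x z ih =>
    intro d hr hl
    have hr' := red_cons.1 hr
    have a1 := hD (x :: z) hl d
    rw [Mt_cons hw hr'.1] at a1
    have a2 := dv _ _ (Oc_shift (c :: w) N (x :: z))
    have a3 := ih x hr'.2 (by simp at hl; omega)
    have a4 : |Oc (c :: w) N 1 (x :: z) / q - N / (2 * k * q ^ (x :: z).length)| ≤ K + 1 := by
      have : (N : ℝ) / (2 * k * q ^ (x :: z).length) = N / (2 * k * q ^ z.length) / q := by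
        rw [length_cons, pow_succ, div_div]; ring_nf
      rw [this, ← sub_div, abs_div, abs_of_pos (by linarith : 0 < q), div_le_iff₀ (by linarith)]
      nlinarith
    rw [abs_lt] at a1
    rw [abs_le] at *
    constructor <;> linarith [a1.1, a1.2, a2.1, a2.2, a4.1, a4.2]
lemma red_rev {z : LW k} (h : FreeGroup.IsReduced z) : FreeGroup.IsReduced z.reverse := by
  unfold FreeGroup.IsReduced at *
  rw [List.isChain_reverse]
  exact h.imp fun a b hab e => (hab e.symm).symm
lemma win_getElem {hk : 0 < k} {u : LW k} {t L : ℕ} (h : t + L ≤ u.length) :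
    win hk u t L = (u.drop t).take L := by
  induction L with
  | zero => simp [win]
  | succ L ih =>
    have e := uu_nat (hk := hk) (u := u) (t := t + L) OM
    push_cast at e
    rw [win_succ, ih OM, take_succ_eq_append_getElem (by simp; omega), e, List.getElem_drop]
lemma prefix_hs {hk : 0 < k} {u z : LW k} {s : ℕ} (hs1 : s < u.length) (hz : z.length ≤ s + 1) :
    z.reverse <+: hs u s ↔ win hk u ((s + 1 - z.length : ℕ) : ℤ) z.length = z := by
  rw [hs, List.reverse_prefix, win_getElem OM, List.suffix_iff_eq_drop, length_take,
    min_eq_left (by omega : s + 1 ≤ u.length), List.drop_take]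
  rw [show s + 1 - (s + 1 - z.length) = z.length by omega]
  exact eq_comm
open Classical in
lemma Oc_card (z : LW k) :
    Oc (c :: w) N 1 z = (((range N).filter fun s => z <+: hs (c :: w) (s + 1)).card : ℝ) := by
  simp [Oc]
lemma Oc_le {hk : 0 < k} (hw : w ∈ Wd c N) {z : LW k} (hz : z ≠ []) :
    Oc (c :: w) N 1 z.reverse ≤
      (((range (c :: w).length).filter fun t : ℕ => win hk (c :: w) t z.length = z).card : ℝ) := by
  classical
  rw [Oc_card, cast_le]
  have hl := (mem_Wd.1 hw).1
  have hz0 : 0 < z.length := length_pos_iff.2 hz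
  have key : ∀ s, s < N → z.reverse <+: hs (c :: w) (s + 1) → z.length ≤ s + 2 := fun s h h' => by
    have := h'.length_le
    simp [hs, hl] at this; omega
  refine card_le_card_of_injOn (fun s => s + 2 - z.length) ?_ ?_
  · intro s h
    simp only [coe_filter, mem_ofPred_eq, mem_range, length_cons, hl] at h ⊢
    have h' := key s h.1 h.2
    exact ⟨by omega, (prefix_hs (by simp [hl]; omega) h').1 h.2⟩
  · intro s h s' h' e
    simp only [coe_filter, mem_ofPred_eq, mem_range] at h h'
    have a1 := key s h.1 h.2
    have a2 := key s' h'.1 h'.2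
    simp only at e; omega
lemma Oc_ge {hk : 0 < k} (hw : w ∈ Wd c N) (a b : Letter k) :
    (((range (c :: w).length).filter fun t : ℕ => win hk (c :: w) t 2 = [a, b]).card : ℝ) ≤
      Oc (c :: w) N 1 [b, a] + 1 := by
  classical
  have hl := (mem_Wd.1 hw).1
  rw [Oc_card]
  rw [length_cons, hl, Finset.range_add_one, Finset.filter_insert]
  have : ((range N).filter fun t : ℕ => win hk (c :: w) t 2 = [a, b]) ⊆
      ((range N).filter fun s => [b, a] <+: hs (c :: w) (s + 1)) := by
    intro s h
    simp only [mem_filter, mem_range] at h ⊢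
    exact ⟨h.1, (prefix_hs (hk := hk) (z := [a, b]) (by simp [hl]; omega) (by simp)).2 (by simpa using h.2)⟩
  have h2 := card_le_card this
  split_ifs
  · exact_mod_cast (card_insert_le _ _).trans (Nat.succ_le_succ h2)
  · have := (cast_le (α := ℝ)).2 h2; linarith
end
section
variable {hk : 0 < k}
def Rw (k n : ℕ) : Finset (LW k) :=
  (univ : Finset (Letter k)).biUnion fun c => (Wd c (n - 1)).image (List.cons c)
lemma mem_Rw {n : ℕ} (hn : 1 ≤ n) {z : LW k} (h1 : z.length = n) (h2 : FreeGroup.IsReduced z) :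
    z ∈ Rw k n := by
  cases z with
  | nil => simp at h1; omega
  | cons c z =>
    exact mem_biUnion.2 ⟨c, mem_univ _, mem_image.2 ⟨z, mem_Wd.2 ⟨by simp at h1; omega, h2⟩, rfl⟩⟩
lemma card_Rw (n : ℕ) : (Rw k n).card ≤ 2 * k * (2 * k - 1) ^ (n - 1) := by
  refine (card_biUnion_le_card_mul _ _ ((2 * k - 1) ^ (n - 1)) fun c _ => ?_).trans (le_of_eq ?_)
  · exact card_image_le.trans (card_Wd c _).le
  · simp [Letter, mul_comm]
lemma uu_mod {u : LW k} {i j : ℤ} (hd : (u.length : ℤ) ∣ i - j) : uu hk u i = uu hk u j := by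
  obtain ⟨t, ht⟩ := hd
  rw [show i = j + u.length * t by omega, uu_per]
lemma win_uu {u u' : LW k} {i : ℤ} {L : ℕ} (h : win hk u i L = win hk u' i L) :
    ∀ s : ℕ, s < L → uu hk u (i + s) = uu hk u' (i + s) := by
  induction L with
  | zero => intro s hs; omega
  | succ L ih =>
    rw [win_succ, win_succ] at h
    have := List.append_inj h (by simp [win_length])
    intro s hs
    rcases lt_succ_iff_lt_or_eq.1 hs with h' | rfl
    · exact ih this.1 s h'
    · simpa using this.2
def Rl (hk : 0 < k) (m n : ℕ) (u : LW k) (i : ℕ) (b : Bool) (e : ℕ) : Prop :=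
  if b then 1 ≤ e ∧ e ≤ n - m ∧ ∀ t : ℕ, t < m → uu hk u (i + (n - m : ℕ) + t) = uu hk u (i + (n - m : ℕ) + t - e)
  else m ≤ e + 1 ∧ e < n - m ∧ ∀ t : ℕ, t < m → uu hk u (i + (n - m : ℕ) + t) = linv (uu hk u (i + e - t))
lemma Rl_inj {m n : ℕ} (hmn : m ≤ n) (hn : 0 < n) {u u' : LW k} (h : u.length = n) (h' : u'.length = n) {i : ℕ} {b : Bool}
    {e : ℕ} (r : Rl hk m n u i b e) (r' : Rl hk m n u' i b e)
    (hw : win hk u i (n - m) = win hk u' i (n - m)) : u = u' := by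
  have key : ∀ s : ℕ, s < n → uu hk u (i + s) = uu hk u' (i + s) := by
    intro s
    induction s using strong_induction_on with
    | _ s ih =>
      intro hs
      rcases lt_or_ge s (n - m) with h1 | h1
      · exact win_uu hw s h1
      obtain ⟨t, rfl⟩ : ∃ t, s = (n - m) + t := ⟨s - (n - m), OM⟩
      unfold Rl at r r'
      cases b
      · simp only [Bool.false_eq_true, if_false] at r r'
        obtain ⟨a1, a2, a3⟩ := r
        have x1 := a3 t OM
        have x2 := r'.2.2 t OM
        have x3 := ih (e - t) OM OM
        rw [show (i : ℤ) + ((e - t : ℕ) : ℤ) = i + e - t by push_cast [show t ≤ e by omega]; ring] at x3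
        rw [cast_add, ← add_assoc, x1, x2, x3]
      · simp only [if_true] at r r'
        obtain ⟨a1, a2, a3⟩ := r
        have x1 := a3 t OM
        have x2 := r'.2.2 t OM
        have x3 := ih (n - m + t - e) OM OM
        rw [show (i : ℤ) + ((n - m + t - e : ℕ) : ℤ) = i + (n - m : ℕ) + t - e by omega] at x3
        rw [cast_add, ← add_assoc, x1, x2, x3]
  refine List.ext_getElem (h.trans h'.symm) fun t h1 h2 => ?_
  rw [← uu_nat (hk := hk) h1, ← uu_nat (hk := hk) h2]
  have r1 := Int.emod_nonneg ((t : ℤ) - i) (by omega : (n : ℤ) ≠ 0)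
  have r2 := Int.emod_lt_of_pos ((t : ℤ) - i) (by omega : (0 : ℤ) < n)
  have r3 := Int.emod_add_mul_ediv ((t : ℤ) - i) n
  have := key ((((t : ℤ) - i) % n).toNat) OM
  have d : (n : ℤ) ∣ t - (i + ((((t : ℤ) - i) % n).toNat : ℕ)) := ⟨((t : ℤ) - i) / n, OM⟩
  rw [uu_mod (u := u) (by rw [h]; exact d), uu_mod (u := u') (by rw [h']; exact d), this]
lemma Rl_ex {m n : ℕ} (hm : 1 ≤ m) (hmn : 2 * m ≤ n) {u : LW k} (h : u.length = n)
    (hc : CyclicallyReducedWord u) (hP : ¬ P1 hk m u) : ∃ i < n, ∃ b, ∃ e < n, Rl hk m n u i b e := by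
  have hne : u ≠ [] := fun e => by rw [e] at h; simp at h; omega
  have md : ∀ {i j : ℤ}, (n : ℤ) ∣ i - j → uu hk u i = uu hk u j := fun hd => uu_mod (by rw [h]; exact hd)
  have hn0 : (n : ℤ) ≠ 0 := OM
  have hn1 : (0 : ℤ) < n := OM
  unfold P1 at hP
  rw [not_and_or] at hP
  rcases hP with hP | hP
  · push Not at hP
    rw [h] at hP
    have : ∃ (i : ℤ) (d : ℕ), 1 ≤ d ∧ d ≤ n - m ∧ ∀ t : ℕ, t < m → uu hk u (i + t) = uu hk u (i + d + t) := by
      obtain ⟨i, j, h1, h2⟩ := hP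
      have r1 := Int.emod_nonneg (j - i) hn0
      have r2 := Int.emod_lt_of_pos (j - i) hn1
      have r3 := Int.emod_add_mul_ediv (j - i) n
      have r4 : (j - i) % n ≠ 0 := fun e => h2 ⟨-((j - i) / n), by rw [mul_neg]; omega⟩
      rcases le_or_gt ((j - i) % n) (n - m) with g | g
      · refine ⟨i, ((j - i) % n).toNat, OM, OM, fun t ht => ?_⟩
        rw [h1 t ht]
        exact md ⟨(j - i) / n, by rw [Int.toNat_of_nonneg r1]; omega⟩
      · refine ⟨j, (n - (j - i) % n).toNat, OM, OM, fun t ht => ?_⟩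
        rw [← h1 t ht]
        refine md ⟨-((j - i) / n) - 1, ?_⟩
        rw [Int.toNat_of_nonneg OM, mul_sub, mul_neg]; omega
    obtain ⟨i, d, d1, d2, hd⟩ := this
    have r1 := Int.emod_nonneg (i + d + m) hn0
    have r2 := Int.emod_lt_of_pos (i + d + m) hn1
    have r3 := Int.emod_add_mul_ediv (i + d + m) n
    refine ⟨((i + d + m) % n).toNat, OM, true, d, OM, ?_⟩
    simp only [Rl, if_true]
    refine ⟨d1, d2, fun t ht => ?_⟩
    rw [md (i := _ + t) (j := i + d + t) ⟨1 - (i + d + m) / n, ?_⟩, ← hd t ht]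
    · refine (md ⟨1 - (i + d + m) / n, ?_⟩).symm
      rw [mul_sub]; omega
    · rw [mul_sub]; omega
  · push Not at hP
    obtain ⟨i, j, h1⟩ := hP
    have r1 := Int.emod_nonneg (j - i) hn0
    have r2 := Int.emod_lt_of_pos (j - i) hn1
    have r3 := Int.emod_add_mul_ediv (j - i) n
    obtain ⟨D, hD⟩ : ∃ D : ℕ, (D : ℤ) = (j - i) % n := ⟨_, Int.toNat_of_nonneg r1⟩
    have h2 : ∀ t : ℕ, t < m → uu hk u (i + t) = linv (uu hk u (i + D - t)) := fun t ht => by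
      rw [h1 t ht]; congr 1
      exact md ⟨(j - i) / n, OM⟩
    have hD2 : 2 * m ≤ D + 1 := by
      by_contra hlt
      have := h2 (D / 2) OM
      rcases Nat.even_or_odd' D with ⟨a, ha | ha⟩
      · rw [show (i : ℤ) + D - (D / 2 : ℕ) = i + (D / 2 : ℕ) by omega] at this
        exact linv_ne _ this.symm
      · rw [show (i : ℤ) + D - (D / 2 : ℕ) = i + (D / 2 : ℕ) + 1 by omega] at this
        refine uu_succ_ne (hk := hk) hne hc (i + (D / 2 : ℕ)) ?_
        rw [this, linv_linv]
    have s1 := Int.emod_nonneg (i + m) hn0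
    have s2 := Int.emod_lt_of_pos (i + m) hn1
    have s3 := Int.emod_add_mul_ediv (i + m) n
    refine ⟨((i + m) % n).toNat, OM, false, D - m, OM, ?_⟩
    simp only [Rl, Bool.false_eq_true, if_false]
    refine ⟨OM, OM, fun t ht => ?_⟩
    rw [md (i := _ + t) (j := i + t) ⟨1 - (i + m) / n, by rw [mul_sub]; omega⟩, h2 t ht]
    congr 1
    exact md ⟨(i + m) / n, OM⟩
open Classical in
lemma p1_bad (hk : 0 < k) {m n : ℕ} (hm : 1 ≤ m) (hmn : 2 * m ≤ n) {S : Finset (LW k)}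
    (hS : ∀ u ∈ S, u.length = n ∧ CyclicallyReducedWord u ∧ ¬ P1 hk m u) :
    S.card ≤ n * (2 * (n * (2 * k * (2 * k - 1) ^ (n - m - 1)))) := by
  have ex : ∀ u ∈ S, ∃ x : ℕ × Bool × ℕ, x.1 < n ∧ x.2.2 < n ∧ Rl hk m n u x.1 x.2.1 x.2.2 := fun u hu => by
    obtain ⟨h1, h2, h3⟩ := hS u hu
    obtain ⟨i, hi, b, e, he, h⟩ := Rl_ex hm hmn h1 h2 h3
    exact ⟨(i, b, e), hi, he, h⟩
  choose! x hx1 hx2 hx3 using ex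
  have := card_le_card_of_injOn (s := S)
    (t := range n ×ˢ (univ : Finset Bool) ×ˢ range n ×ˢ Rw k (n - m))
    (fun u => ((x u).1, (x u).2.1, (x u).2.2, win hk u (x u).1 (n - m))) ?_ ?_
  · refine this.trans ?_
    simp only [card_product, card_range, card_univ, Fintype.card_bool]
    have := card_Rw (k := k) (n - m)
    gcongr
  · intro u hu
    obtain ⟨h1, h2, h3⟩ := hS u hu
    have hne : u ≠ [] := fun e => by rw [e] at h1; simp at h1; omega
    simp only [coe_product, mem_prod, mem_coe, mem_range, mem_univ, true_and]
    exact ⟨hx1 u hu, hx2 u hu, mem_Rw OM (win_length ..) (win_reduced hne h2 _ _)⟩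
  · intro u hu u' hu' e
    simp only [Prod.mk.injEq] at e
    obtain ⟨e1, e2, e3, e4⟩ := e
    have a := hx3 u hu
    have a' := hx3 u' hu'
    rw [← e1, ← e2, ← e3] at a'
    rw [← e1] at e4
    exact Rl_inj OM OM (hS u hu).1 (hS u' hu').1 a a' e4
end
section
variable {hk : 0 < k}
open Classical in
noncomputable def Cf (k n : ℕ) : Finset (FG k) :=
  ((Rw k n).filter fun w => CyclicallyReducedWord w ∧ w.length = n).image mk
lemma mem_Cf {n : ℕ} (hn : 1 ≤ n) {g : FG k} : g ∈ Cf k n ↔ g ∈ Cset k ∧ wordLength g = n := by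
  classical
  simp only [Cf, mem_image, mem_filter]
  constructor
  · rintro ⟨w, ⟨_, h2, h3⟩, rfl⟩
    have e : (mk w).toWord = w := by
      rw [toWord_mk]; exact isReduced_iff_reduce_eq.1 (isReduced_of_cyc h2)
    exact ⟨by rw [Cset, mem_ofPred_eq, IsCyclicallyReduced, e]; exact h2, by rw [wordLength, e]; exact h3⟩
  · rintro ⟨h1, h2⟩
    exact ⟨g.toWord, ⟨mem_Rw hn h2 (isReduced_of_cyc h1), h1, h2⟩, mk_toWord⟩
lemma card_Cf (n : ℕ) : (Cf k n).card ≤ 2 * k * (2 * k - 1) ^ (n - 1) := by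
  classical
  exact card_image_le.trans ((card_filter_le _ _).trans (card_Rw n))
def cls (n : ℕ) (u : FG k) : Set (FG k) :=
  {v | v ∈ Cset k ∧ wordLength v = n ∧ Nonempty (OneRel k u ≃* OneRel k v)}
open Classical in
lemma iso_card {n : ℕ} (hn : 1 ≤ n) : isoTypesCount k n = ((Cf k n).image (cls n)).card := by
  rw [← ncard_coe_finset, isoTypesCount]
  congr 1
  ext T
  simp only [Finset.coe_image, Set.mem_image, mem_coe, mem_Cf hn, mem_ofPred_eq]
  constructor
  · rintro ⟨u, h1, h2, rfl⟩; exact ⟨u, ⟨h1, h2⟩, rfl⟩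
  · rintro ⟨u, ⟨h1, h2⟩, rfl⟩; exact ⟨u, h1, h2, rfl⟩
lemma conj_iso {u v g : FG k} (h : v = g⁻¹ * u * g) : Nonempty (OneRel k u ≃* OneRel k v) := by
  refine ⟨QuotientGroup.quotientMulEquivOfEq (le_antisymm (Subgroup.normalClosure_le_normal ?_)
    (Subgroup.normalClosure_le_normal ?_))⟩
  · rintro _ rfl
    have := Subgroup.normalClosure_normal.conj_mem v (Subgroup.subset_normalClosure (Set.mem_singleton v)) g
    rw [h] at this ⊢
    simpa [mul_assoc] using this
  · rintro _ rfl
    have := Subgroup.normalClosure_normal.conj_mem u (Subgroup.subset_normalClosure (Set.mem_singleton u)) g⁻¹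
    rw [h]
    simpa [mul_assoc] using this
lemma cls_eq {n : ℕ} {u v : FG k} (h : Nonempty (OneRel k u ≃* OneRel k v)) : cls n u = cls n v := by
  obtain ⟨φ⟩ := h
  ext x
  simp only [cls, mem_ofPred_eq]
  exact ⟨fun ⟨a, b, ⟨ψ⟩⟩ => ⟨a, b, ⟨φ.symm.trans ψ⟩⟩, fun ⟨a, b, ⟨ψ⟩⟩ => ⟨a, b, ⟨φ.trans ψ⟩⟩⟩
open Classical in
lemma fiber_ge {m n : ℕ} (hn : 1 ≤ n) (hmn : m ≤ n) {u : FG k} (hu : u ∈ Cf k n)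
    (hP : P1 hk m u.toWord) : n ≤ ((Cf k n).filter fun v => cls n v = cls n u).card := by
  obtain ⟨h1, h2⟩ := (mem_Cf hn).1 hu
  have hl : u.toWord.length = n := h2
  have hne : u.toWord ≠ [] := fun e => by rw [e] at hl; simp at hl; omega
  have hcyc : CyclicallyReducedWord u.toWord := h1
  have e1 : ∀ i : ℤ, mk (win hk u.toWord i n) = (pp u.toWord i)⁻¹ * u * pp u.toWord i := fun i => by
    have a := pp_win (hk := hk) hne i n
    have b := pp_per hne i
    rw [hl, mk_toWord] at b
    rw [b] at a
    rw [mul_assoc, a, inv_mul_cancel_left]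
  have e2 : ∀ i : ℤ, (mk (win hk u.toWord i n)).toWord = win hk u.toWord i n := fun i => by
    rw [toWord_mk]; exact isReduced_iff_reduce_eq.1 (win_reduced hne hcyc i n)
  have := card_le_card_of_injOn (s := range n) (t := (Cf k n).filter fun v => cls n v = cls n u)
    (fun i : ℕ => mk (win hk u.toWord i n)) ?_ ?_
  · simpa using this
  · intro i _
    simp only [coe_filter, mem_ofPred_eq]
    refine ⟨(mem_Cf hn).2 ⟨?_, ?_⟩, (cls_eq (conj_iso (e1 i))).symm⟩
    · rw [Cset, mem_ofPred_eq, IsCyclicallyReduced, e2, CyclicallyReducedWord]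
      have a := win_reduced (hk := hk) hne hcyc i (n + n)
      rw [win_append, win_eq_of (i := i + n) (j := i) (by simp [hl])] at a
      exact isReduced_iff_reduce_eq.1 a
    · rw [wordLength, e2, win_length]
  · intro i hi j hj e
    have e3 : win hk u.toWord i n = win hk u.toWord j n := (e2 i).symm.trans ((congrArg toWord e).trans (e2 j))
    obtain ⟨t, ht⟩ := hP.1 i j fun t ht => by
      have a := congrArg (fun l => l[t]?) e3
      have b : ∀ i : ℤ, (win hk u.toWord i n)[t]? = some (uu hk u.toWord (i + t)) := fun i => by
        have : win hk u.toWord i n = win hk u.toWord i t ++ win hk u.toWord (i + t) (n - t) := by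
          rw [← win_append]; congr 1; omega
        rw [this, List.getElem?_append_right (by simp [win_length]), win_length, Nat.sub_self,
          show n - t = 1 + (n - t - 1) by omega, win_append]
        simp [win]
      simpa [b] using a
    rw [hl] at ht
    simp only [coe_range, mem_Iio] at hi hj
    have : t = 0 := by
      by_contra h0
      rcases Int.lt_or_gt_of_ne h0 with h0 | h0 <;> nlinarith
    subst this; omega
lemma upper1 (hk : 0 < k) {m n : ℕ} (hm : 1 ≤ m) (hmn : 2 * m ≤ n) :
    n * isoTypesCount k n ≤ 2 * k * (2 * k - 1) ^ (n - 1) +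
      n * (n * (2 * (n * (2 * k * (2 * k - 1) ^ (n - m - 1))))) := by
  classical
  have hn : 1 ≤ n := OM
  rw [iso_card hn]
  set G := (Cf k n).filter fun u => P1 hk m u.toWord
  set Bd := (Cf k n).filter fun u => ¬ P1 hk m u.toWord
  have h1 : ((Cf k n).image (cls n)).card ≤ (G.image (cls n)).card + Bd.card := by
    rw [← Finset.filter_union_filter_not_eq (fun u => P1 hk m u.toWord) (Cf k n), Finset.image_union]
    exact (card_union_le _ _).trans (Nat.add_le_add_left card_image_le _)
  have h2 : Bd.card ≤ n * (2 * (n * (2 * k * (2 * k - 1) ^ (n - m - 1)))) := by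
    rw [← card_image_of_injective Bd toWord_injective]
    refine p1_bad hk hm hmn fun w hw => ?_
    obtain ⟨u, hu, rfl⟩ := mem_image.1 hw
    rw [mem_filter, mem_Cf hn] at hu
    exact ⟨hu.1.2, hu.1.1, hu.2⟩
  have h3 : n * (G.image (cls n)).card ≤ (Cf k n).card := by
    have : ∑ T ∈ G.image (cls n), n ≤ ∑ T ∈ G.image (cls n), ((Cf k n).filter fun v => cls n v = T).card := by
      refine sum_le_sum fun T hT => ?_
      obtain ⟨u, hu, rfl⟩ := mem_image.1 hT
      rw [mem_filter] at hu
      exact fiber_ge hn OM hu.1 hu.2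
    rw [sum_const, smul_eq_mul, mul_comm] at this
    refine this.trans ?_
    rw [← Finset.card_biUnion]
    · exact card_le_card (Finset.biUnion_subset.2 fun T _ => filter_subset _ _)
    · intro a _ b _ hab
      exact Finset.disjoint_filter.2 fun v _ h h' => hab (h.symm.trans h')
  have h4 := card_Cf (k := k) n
  calc n * ((Cf k n).image (cls n)).card ≤ n * ((G.image (cls n)).card + Bd.card) := Nat.mul_le_mul_left _ h1
    _ = n * (G.image (cls n)).card + n * Bd.card := by ring
    _ ≤ _ := Nat.add_le_add (h3.trans h4) (Nat.mul_le_mul_left _ h2)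
end
lemma bern (R n : ℕ) : R ^ n * R + n * R ^ n ≤ R * (R + 1) ^ n := by
  induction n with
  | zero => simp
  | succ n ih =>
    have := Nat.mul_le_mul_right (R + 1) ih
    rw [pow_succ, pow_succ]
    nlinarith [Nat.zero_le (n * R ^ n), Nat.zero_le (R ^ n)]
lemma bern2 {Q : ℕ} (hQ : 2 ≤ Q) : 2 * (Q - 1) ^ Q ≤ Q ^ Q := by
  obtain ⟨R, rfl⟩ : ∃ R, Q = R + 1 := ⟨Q - 1, OM⟩
  have h := bern R (R + 1)
  simp only [Nat.add_sub_cancel]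
  have : R * (2 * R ^ (R + 1)) ≤ R * (R + 1) ^ (R + 1) := by nlinarith [Nat.zero_le (R ^ (R + 1))]
  exact Nat.le_of_mul_le_mul_left this OM
lemma log_small (C E : ℕ) : ∃ n0, ∀ n ≥ n0, C * (log 2 n + 1) ^ E ≤ n := by
  have h1 : Filter.Tendsto (fun r : ℕ => ((r + 1 : ℕ) : ℝ) ^ E / (2 : ℝ) ^ (r + 1)) Filter.atTop (nhds 0) :=
    (tendsto_pow_const_div_const_pow_of_one_lt E (by norm_num : (1 : ℝ) < 2)).comp (Filter.tendsto_add_atTop_nat 1)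
  have h2 := h1.eventually (gt_mem_nhds (show (0 : ℝ) < 1 / (2 * (C + 1) : ℝ) by positivity))
  obtain ⟨r0, hr⟩ := Filter.eventually_atTop.1 h2
  refine ⟨2 ^ r0, fun n hn => ?_⟩
  have hr0 : r0 ≤ log 2 n := Nat.le_log_of_pow_le (by norm_num) hn
  have h0 : n ≠ 0 := by
                                have : 0 < 2 ^ r0 := by positivity
                                omega
  have h3 := hr _ hr0
  have h4 : 2 ^ log 2 n ≤ n := pow_log_le_self 2 h0
  rw [div_lt_div_iff₀ (by positivity) (by positivity), pow_succ] at h3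
  have h5 : C * (log 2 n + 1) ^ E ≤ 2 ^ log 2 n := by
    have : (C : ℝ) * ((log 2 n + 1 : ℕ) : ℝ) ^ E ≤ 2 ^ log 2 n := by
      have : (0 : ℝ) ≤ ((log 2 n + 1 : ℕ) : ℝ) ^ E := by positivity
      nlinarith
    exact_mod_cast this
  omega
lemma params (k2 : 2 ≤ k) (C : ℕ) : ∃ n0, ∀ n ≥ n0, ∃ m j : ℕ, 1 ≤ m ∧ 1 ≤ j ∧ n ^ 4 ≤ 2 ^ m ∧
    (2 * k - 2) * (2 * k * (10 * m + 3)) * ((2 * k - 1) ^ (4 * k) - 1) ^ j < (2 * k - 1) ^ (j * (4 * k)) ∧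
    10 * m + 3 ≤ (4 * k) ^ (j * (4 * k) + 1) ∧ C * ((4 * k) ^ (j * (4 * k) + 1)) ^ 3 ≤ n := by
  obtain ⟨Q, hQ⟩ : ∃ Q, Q = (2 * k - 1) ^ (4 * k) := ⟨_, rfl⟩
  have hQ2 : 2 ≤ Q := by
    rw [hQ]
    calc 2 ≤ 2 * k - 1 := OM
      _ = (2 * k - 1) ^ 1 := (pow_one _).symm
      _ ≤ _ := pow_le_pow_right OM OM
  obtain ⟨E, hE⟩ : ∃ E, E = 4 * k * (Q * (4 * k)) := ⟨_, rfl⟩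
  obtain ⟨n0, hn0⟩ := log_small (C * (4 * k * (8 * k ^ 2 * 43) ^ E) ^ 3) (E * 3)
  refine ⟨max n0 1, fun n hn => ?_⟩
  obtain ⟨Λ, hΛ⟩ : ∃ Λ, Λ = log 2 n + 1 := ⟨_, rfl⟩
  have hL := hn0 n (le_trans (le_max_left _ _) hn)
  rw [← hΛ] at hL
  have hΛ1 : 1 ≤ Λ := OM
  have hnL : n < 2 ^ Λ := by rw [hΛ]; exact lt_pow_succ_log_self (by norm_num) n
  obtain ⟨Y, hY⟩ : ∃ Y, Y = 4 * k ^ 2 * (10 * (4 * Λ) + 3) := ⟨_, rfl⟩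
  have hY0 : Y ≠ 0 := by rw [hY]; positivity
  obtain ⟨s, hs⟩ : ∃ s, s = log 2 Y + 1 := ⟨_, rfl⟩
  have hs1 : Y < 2 ^ s := by rw [hs]; exact lt_pow_succ_log_self (by norm_num) Y
  have hs2 : 2 ^ s ≤ 2 * Y := by rw [hs, pow_succ, mul_comm]; exact Nat.mul_le_mul_left 2 (pow_log_le_self 2 hY0)
  have h4k : 4 * k ≤ 2 ^ (4 * k) := lt_two_pow_self.le
  have hj : 1 ≤ Q * s := Nat.mul_pos OM OM
  refine ⟨4 * Λ, Q * s, OM, hj, ?_, ?_, ?_, ?_⟩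
  · rw [mul_comm, pow_mul]; exact pow_le_pow_left hnL.le 4
  · rw [mul_comm (Q * s), pow_mul (2 * k - 1) (4 * k), ← hQ]
    have h1 : 2 ^ s * (Q - 1) ^ (Q * s) ≤ Q ^ (Q * s) := by
      rw [pow_mul, pow_mul, ← mul_pow]; exact pow_le_pow_left (bern2 hQ2) s
    have h2 : (2 * k - 2) * (2 * k * (10 * (4 * Λ) + 3)) ≤ Y := by
      rw [hY, ← mul_assoc]
      refine Nat.mul_le_mul_right _ ?_
      calc (2 * k - 2) * (2 * k) ≤ (2 * k) * (2 * k) := Nat.mul_le_mul_right _ OM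
        _ = _ := by ring
    refine lt_of_lt_of_le ?_ h1
    exact Nat.mul_lt_mul_of_pos_right (lt_of_le_of_lt h2 hs1) (Nat.pow_pos OM)
  · have h1 : 10 * (4 * Λ) + 3 ≤ Y := by rw [hY]; exact le_mul_of_pos_left _ (by positivity)
    calc _ ≤ 2 ^ s := h1.trans hs1.le
      _ ≤ (4 * k) ^ s := pow_le_pow_left OM _
      _ ≤ _ := pow_le_pow_right OM (by
        have : s ≤ Q * s * (4 * k) := by
          rw [mul_right_comm]; exact le_mul_of_pos_left _ (by positivity)
        omega)
  · refine le_trans ?_ hL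
    have h1 : (4 * k) ^ (Q * s * (4 * k) + 1) ≤ 4 * k * (8 * k ^ 2 * 43) ^ E * Λ ^ E := by
      rw [pow_succ, mul_comm, mul_assoc (4 * k)]
      refine Nat.mul_le_mul_left _ ?_
      calc (4 * k) ^ (Q * s * (4 * k)) ≤ (2 ^ (4 * k)) ^ (Q * s * (4 * k)) := pow_le_pow_left h4k _
        _ = (2 ^ s) ^ E := by rw [← pow_mul, ← pow_mul, hE]; congr 1; ring
        _ ≤ (8 * k ^ 2 * 43 * Λ) ^ E := pow_le_pow_left (hs2.trans (by rw [hY]; nlinarith [Nat.zero_le (k^2)])) _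
        _ = _ := mul_pow _ _ _
    calc _ ≤ C * (4 * k * (8 * k ^ 2 * 43) ^ E * Λ ^ E) ^ 3 := Nat.mul_le_mul_left _ (pow_le_pow_left h1 3)
      _ = _ := by rw [mul_pow _ (Λ ^ E), ← pow_mul, mul_assoc C]
section
variable {hk : 0 < k}
lemma p3_of (k2 : 2 ≤ k) {m l K N : ℕ} {c : Letter k} {w : LW k} (hm : 1 ≤ m) (hl : 2 ≤ l)
    (hw : w ∈ Wd c N) (hD : Dv l (K : ℝ) c w) (h : 2 * K + 16 * m + 4 ≤ N / (2 * k * (2 * k - 1))) :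
    P3 hk m (N / (2 * k * (2 * k - 1)) - (2 * K + 16 * m + 4)) (N / (2 * k * (2 * k - 1)) + (2 * K + 16 * m + 4))
      (c :: w) := by
  classical
  intro a b hab
  have hr : FreeGroup.IsReduced [b, a] := by
    rw [red_cons]; exact ⟨fun e => hab (by rw [e, linv_linv]), by simp⟩
  have h1 := Oc_est k2 hw hD (cast_nonneg K) [a] b hr (by simp; omega)
  have h2 := Oc_le (hk := hk) hw (z := [a, b]) (by simp)
  have h3 := Oc_ge (hk := hk) hw a b
  obtain ⟨M, hM⟩ : ∃ M, M = 2 * k * (2 * k - 1) := ⟨_, rfl⟩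
  have hM0 : 0 < M := by rw [hM]; exact Nat.mul_pos OM OM
  rw [← hM] at h ⊢
  have hMr : (2 * k * ((2 * k - 1 : ℕ) : ℝ) ^ [a].length) = (M : ℝ) := by rw [hM]; push_cast; simp
  rw [hMr] at h1
  simp only [List.reverse_cons, List.reverse_nil, List.nil_append, cons_append] at h2
  obtain ⟨W, hW⟩ : ∃ W, W = N / M := ⟨_, rfl⟩
  rw [← hW] at h ⊢
  have hW1 : (W : ℝ) ≤ N / M := by rw [hW]; exact Nat.cast_div_le
  have hW2 : (N : ℝ) / M ≤ W + 1 := by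
    rw [div_le_iff₀ (by exact_mod_cast hM0)]
    have : N < M * (W + 1) := by rw [hW]; exact lt_mul_div_succ N hM0
    have : (N : ℝ) < M * (W + 1) := by exact_mod_cast this
    linarith
  rw [abs_le] at h1
  have hz : ([a, b] : LW k).length = 2 := rfl
  rw [hz] at h2
  generalize ((range (c :: w).length).filter fun t : ℕ => win hk (c :: w) t 2 = [a, b]).card = x at h2 h3 ⊢
  have e1 : (W : ℝ) ≤ x + 2 * K + 2 := by linarith [h1.1]
  have e2 : (x : ℝ) ≤ W + 2 * K + 4 := by linarith [h1.2]
  have e1' : W ≤ x + 2 * K + 2 := by exact_mod_cast e1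
  have e2' : x ≤ W + 2 * K + 4 := by exact_mod_cast e2
  omega
lemma p2_of (k2 : 2 ≤ k) {l B K N : ℕ} {c : Letter k} {w : LW k}
    (hw : w ∈ Wd c N) (hD : Dv (l + 1) (K : ℝ) c w) (h : 2 * k * (2 * k - 1) ^ l * (B + 2 * K + 3) ≤ N) :
    P2 hk B (l + 1) (c :: w) := by
  classical
  intro z hz hr
  have hne : z ≠ [] := by rintro rfl; simp at hz
  have h2 := Oc_le (hk := hk) hw hne
  obtain ⟨d, y, hy⟩ : ∃ d y, z.reverse = d :: y := by
    cases e : z.reverse with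
    | nil => simp at e; exact absurd e hne
    | cons d y => exact ⟨d, y, rfl⟩
  have hr' := red_rev hr
  have hyl : y.length = l := by
    have := congrArg List.length hy
    simp at this; omega
  rw [hy] at hr' h2
  have h1 := Oc_est k2 hw hD (cast_nonneg K) y d hr' OM
  rw [hyl, abs_le] at h1
  rw [hz] at h2
  obtain ⟨M, hM⟩ : ∃ M, M = 2 * k * (2 * k - 1) ^ l := ⟨_, rfl⟩
  have hM0 : 0 < M := by rw [hM]; exact Nat.mul_pos OM (Nat.pow_pos OM)
  rw [← hM] at h
  have hMr : (2 * k * ((2 * k - 1 : ℕ) : ℝ) ^ l) = (M : ℝ) := by rw [hM]; push_cast; simp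
  rw [hMr] at h1
  have h3 : ((B + 2 * K + 3 : ℕ) : ℝ) ≤ N / M := by
    rw [le_div_iff₀ (by exact_mod_cast hM0)]
    have : (B + 2 * K + 3) * M ≤ N := by rw [mul_comm]; exact h
    exact_mod_cast this
  push_cast at h3
  generalize ((range (c :: w).length).filter fun t : ℕ => win hk (c :: w) t (l + 1) = z).card = x at h2 ⊢
  have : (B : ℝ) < x := by linarith [h1.1]
  exact_mod_cast this
lemma good_bound (k2 : 2 ≤ k) {m j K N : ℕ} {c : Letter k} {w : LW k} (hm : 1 ≤ m) (hj : 1 ≤ j)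
    (hw : w ∈ Wd c N) (hD : Dv (j * (4 * k) + 1) (K : ℝ) c w) (hcyc : CyclicallyReducedWord (c :: w))
    (hP : P1 hk m (c :: w))
    (hK : (2 * k - 2) * (2 * k * (10 * m + 3)) * ((2 * k - 1) ^ (4 * k) - 1) ^ j < (2 * k - 1) ^ (j * (4 * k)))
    (h1 : 2 * k * (2 * k - 1) ^ (j * (4 * k)) * ((18 * m + 4 + (j * (4 * k) + 1)) + 2 * K + 3) ≤ N)
    (h2 : 2 * k * (2 * k - 1) * (2 * K + 16 * m + 5) < N / (2 * k * (2 * k - 1))) :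
    ∃ F : Finset (FG k), F.card ≤ 2 * (2 * k) ^ k * (N + 1) ∧ ∀ v ∈ Cy k (N + 1),
      Nonempty (OneRel k (mk (c :: w)) ≃* OneRel k v) → v ∈ F := by
  classical
  have hlen : (c :: w).length = N + 1 := by simp [(mem_Wd.1 hw).1]
  have hl : 2 ≤ j * (4 * k) + 1 := by nlinarith
  have p2 := p2_of (hk := hk) k2 hw hD h1
  obtain ⟨q, hq⟩ : ∃ q, q = 2 * k - 1 := ⟨_, rfl⟩
  have h12 : 12 ≤ 2 * k * (2 * k - 1) := by rw [← hq]; nlinarith [show 3 ≤ q by omega]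
  have p3 := p3_of (hk := hk) k2 hm hl hw hD (by nlinarith)
  rw [← hq] at h12 h2 p3
  have hdiv := Nat.div_mul_le_self N (2 * k * q)
  have hdiv2 := lt_mul_div_succ N (show 0 < 2 * k * q by omega)
  obtain ⟨M, hM⟩ : ∃ M, M = 2 * k * q := ⟨_, rfl⟩
  have hM2 : ∀ x, k * (2 * q * x) = M * x := fun x => by rw [hM]; ring
  have hM3 : ∀ x, k * (2 * (2 * q * x)) = 2 * (M * x) := fun x => by rw [hM]; ring
  rw [← hM] at h12 h2 p3 hdiv hdiv2
  obtain ⟨W, hW⟩ : ∃ W, W = N / M := ⟨_, rfl⟩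
  rw [← hW] at h2 p3 hdiv hdiv2
  obtain ⟨T, hT⟩ : ∃ T, T = 2 * K + 16 * m + 4 := ⟨_, rfl⟩
  rw [← hT] at p3
  rw [show 2 * K + 16 * m + 5 = T + 1 by omega] at h2
  have hMT : 12 * (T + 1) ≤ M * (T + 1) := Nat.mul_le_mul_right _ h12
  have hMW : M * (W - T) + M * T = M * W := by rw [← mul_add]; congr 1; omega
  have hWM : 12 * W ≤ M * W := Nat.mul_le_mul_right _ h12
  have e0 : W * M = M * W := mul_comm _ _
  have e1 : M * (W + 1) = M * W + M := by ring
  have e2 : M * (T + 1) = M * T + M := by ring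
  have e3 : M * T + M * T + M * T ≤ M * W := by
    have := Nat.mul_le_mul_left M (show 3 * T ≤ W by omega)
    nlinarith
  have e4 : 3 * M ≤ M * W := by
    have := Nat.mul_le_mul_left M (show 3 ≤ W by omega)
    nlinarith
  have D : Gd hk m j (18 * m + 4 + (j * (4 * k) + 1)) (c :: w) :=
    ⟨by simp, hcyc, hP, hm, ln_of (by simp) hcyc hP hm (by rw [hlen]; omega) (fun a => by
      have hp := (p3 a a (fun e => linv_ne a e.symm)).1
      obtain ⟨t, ht⟩ := card_pos.1 (lt_of_lt_of_le OM hp)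
      have := (mem_filter.1 ht).2
      rw [win_succ, win_succ] at this
      refine ⟨t, Or.inl ?_⟩
      simp [win] at this
      exact this.1), p2, le_rfl, hK, k2⟩
  have := class_bound D p3 (δ := W) OM OM (by rw [hlen, ← hq, hM2]; omega)
    (by rw [hlen, ← hq, hM3]; omega)
  rwa [hlen] at this
end
section
variable {hk : 0 < k}
lemma lst_append (c x : Letter k) (z : LW k) : lst c (z ++ [x]) = x := by
  induction z generalizing c with
  | nil => rfl
  | cons b z ih => exact ih b
open Classical in
lemma noncyc_card {N : ℕ} (hN : 1 ≤ N) (c : Letter k) :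
    ((Wd c N).filter fun w => ¬ CyclicallyReducedWord (c :: w)).card ≤ (2 * k - 1) ^ (N - 1) := by
  rw [← card_Wd c (N - 1)]
  refine (card_le_card ?_).trans (card_image_le (f := fun w => w ++ [linv c]))
  intro w hw
  obtain ⟨h1, h2⟩ := mem_filter.1 hw
  obtain ⟨h3, h4⟩ := mem_Wd.1 h1
  have hne : w ≠ [] := by rintro rfl; simp at h3; omega
  obtain ⟨z, x, rfl⟩ : ∃ z x, w = z ++ [x] := ⟨w.dropLast, w.getLast hne, (List.dropLast_append_getLast hne).symm⟩
  have hx : x = linv c := by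
    by_contra hx
    apply h2
    refine isReduced_iff_reduce_eq.1 ?_
    rw [cons_append, red_split, lst_append, red_cons]
    exact ⟨h4, fun e => hx (by rw [e, linv_linv]), h4⟩
  refine mem_image.2 ⟨z, mem_Wd.2 ⟨by simp at h3; omega, (red_split.1 h4).1⟩, by rw [hx]⟩
lemma numer {X N m l : ℕ} (k2 : 2 ≤ k) (hX : 10 * m + 3 ≤ X) (hl : l ≤ X)
    (hN : 6144 * k * (4 * k ^ 2) ^ 4 * X ^ 3 ≤ N) : ∃ K : ℕ, 0 < K ∧
    X * ((18 * m + 4 + l) + 2 * K + 3) ≤ N ∧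
    2 * k * (2 * k - 1) * (2 * K + 16 * m + 5) < N / (2 * k * (2 * k - 1)) ∧
    24 * k * X * N ≤ K ^ 2 := by
  obtain ⟨Z, hZ⟩ : ∃ Z, Z = 4 * k ^ 2 := ⟨_, rfl⟩
  obtain ⟨q, hq⟩ : ∃ q, q = 2 * k - 1 := ⟨_, rfl⟩
  obtain ⟨M, hM⟩ : ∃ M, M = 2 * k * q := ⟨_, rfl⟩
  have hMZ : M ≤ Z := by rw [hM, hZ]; nlinarith [show q ≤ 2 * k by omega]
  have hM0 : 0 < M := by rw [hM]; exact Nat.mul_pos OM OM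
  rw [← hq, ← hM]
  rw [← hZ] at hN
  have hX0 : 3 ≤ X := OM
  have hZ0 : 16 ≤ Z := by rw [hZ]; nlinarith
  obtain ⟨Y, hY⟩ : ∃ Y, Y = Z ^ 2 * X := ⟨_, rfl⟩
  have a0 : Z ^ 4 * X ^ 3 = Y ^ 2 * X := by rw [hY]; ring
  have hYX : X ≤ Y := by rw [hY]; exact le_mul_of_pos_left _ (by positivity)
  have a1 : 6144 * (k * (Y ^ 2 * X)) ≤ N := by rw [← a0]; refine le_trans (le_of_eq ?_) hN; ring
  have a2 : Y ^ 2 ≤ k * (Y ^ 2 * X) := by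
    calc Y ^ 2 ≤ k * Y ^ 2 := le_mul_of_pos_left _ OM
      _ ≤ _ := Nat.mul_le_mul_left _ (le_mul_of_pos_right _ OM)
  have a3 : Y ≤ Y ^ 2 := by nlinarith
  have a4 : X ^ 2 ≤ Y ^ 2 := pow_le_pow_left hYX 2
  have hY1 : 0 < Y := OM
  have hY0 : 0 < 8 * Y := OM
  obtain ⟨K, hK⟩ : ∃ K, K = N / (8 * Y) := ⟨_, rfl⟩
  have b1 : 8 * Y * K ≤ N := by rw [hK]; exact Nat.mul_div_le _ _
  have b2 : N < 8 * Y * (K + 1) := by rw [hK]; exact lt_mul_div_succ N hY0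
  have b3 : N ≤ 16 * Y * K := by nlinarith
  have hK0 : 0 < K := by
    rcases Nat.eq_zero_or_pos K with h | h
    · rw [h] at b3; omega
    · exact h
  refine ⟨K, hK0, ?_, ?_, ?_⟩
  · have : X * (18 * m + 4 + l + 2 * K + 3) ≤ X * (4 * X + 2 * K) := Nat.mul_le_mul_left _ OM
    have : X * K ≤ Y * K := Nat.mul_le_mul_right _ hYX
    nlinarith
  · rw [Nat.lt_iff_add_one_le, Nat.le_div_iff_mul_le hM0]
    have c1 : M * (2 * K + 16 * m + 5) + 1 ≤ Z * (2 * K + 2 * X + 1) := by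
      calc M * (2 * K + 16 * m + 5) + 1 ≤ Z * (2 * K + 16 * m + 5) + Z := by
            have := Nat.mul_le_mul_right (2 * K + 16 * m + 5) hMZ
            omega
        _ = Z * (2 * K + 16 * m + 6) := by ring
        _ ≤ _ := Nat.mul_le_mul_left _ OM
    have c2 : (M * (2 * K + 16 * m + 5) + 1) * M ≤ Z * (2 * K + 2 * X + 1) * Z := Nat.mul_le_mul c1 hMZ
    have c3 : Z * (2 * K + 2 * X + 1) * Z = 2 * (Z ^ 2 * K) + 2 * Y + Z ^ 2 := by rw [hY]; ring
    have c4 : Z ^ 2 ≤ Y := by rw [hY]; exact le_mul_of_pos_right _ OM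
    have c5 : Z ^ 2 * K ≤ Y * K := Nat.mul_le_mul_right _ c4
    nlinarith
  · have d1 : N * N ≤ (16 * Y * K) * (16 * Y * K) := Nat.mul_le_mul b3 b3
    have d2 : 6144 * (k * (Y ^ 2 * X)) * N ≤ N * N := Nat.mul_le_mul_right _ a1
    have d3 : (256 * Y ^ 2) * (24 * k * X * N) ≤ (256 * Y ^ 2) * K ^ 2 := by
      calc _ = 6144 * (k * (Y ^ 2 * X)) * N := by ring
        _ ≤ _ := d2.trans d1
        _ = _ := by ring
    exact Nat.le_of_mul_le_mul_left d3 (by positivity)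
open Classical in
lemma fib_bound {D N : ℕ} {c : Letter k} {G : Finset (LW k)}
    (hG : ∀ w ∈ G, w.length = N ∧ CyclicallyReducedWord (c :: w) ∧
      ∃ F : Finset (FG k), F.card ≤ D ∧ ∀ v ∈ Cy k (N + 1),
      Nonempty (OneRel k (mk (c :: w)) ≃* OneRel k v) → v ∈ F) :
    G.card ≤ D * isoTypesCount k (N + 1) := by
  have e : ∀ w ∈ G, (mk (c :: w)).toWord = c :: w := fun w hw => by
    rw [toWord_mk]; exact isReduced_iff_reduce_eq.1 (isReduced_of_cyc (hG w hw).2.1)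
  have hC : ∀ w ∈ G, mk (c :: w) ∈ Cset k ∧ wordLength (mk (c :: w)) = N + 1 := fun w hw => by
    refine ⟨?_, ?_⟩
    · rw [Cset, mem_ofPred_eq, IsCyclicallyReduced, e w hw]; exact (hG w hw).2.1
    · rw [wordLength, e w hw]; simp [(hG w hw).1]
  have h1 := card_le_mul_card_image (f := fun w => cls (N + 1) (mk (c :: w))) G D ?_
  · rw [iso_card OM]
    refine h1.trans (Nat.mul_le_mul_left _ (card_le_card ?_))
    intro T hT
    obtain ⟨w, hw, rfl⟩ := mem_image.1 hT
    exact mem_image_of_mem _ ((mem_Cf OM).2 (hC w hw))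
  · intro T hT
    obtain ⟨w, hw, rfl⟩ := mem_image.1 hT
    obtain ⟨F, hF1, hF2⟩ := (hG w hw).2.2
    refine le_trans (card_le_card_of_injOn (fun w => mk (c :: w)) ?_ ?_) hF1
    · intro w' hw'
      obtain ⟨a, b⟩ := mem_filter.1 hw'
      have : mk (c :: w') ∈ cls (N + 1) (mk (c :: w')) :=
        ⟨(hC w' a).1, (hC w' a).2, ⟨MulEquiv.refl _⟩⟩
      rw [b] at this
      exact hF2 _ ⟨(hC w' a).1, (hC w' a).2⟩ this.2.2
    · intro w1 h1 w2 h2 h12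
      have a := congrArg toWord h12
      simp only at a
      rw [e _ (mem_filter.1 h1).1, e _ (mem_filter.1 h2).1] at a
      exact (List.cons.inj a).2
lemma lower1 (k2 : 2 ≤ k) : ∃ n0, ∀ n ≥ n0, (2 * k - 1) ^ (n - 1) ≤ 3 * (2 * (2 * k) ^ k * n * isoTypesCount k n) := by
  classical
  have hk : 0 < k := OM
  obtain ⟨n0, h0⟩ := params k2 (6144 * k * (4 * k ^ 2) ^ 4 + 1)
  refine ⟨n0, fun n hn => ?_⟩
  obtain ⟨m, j, hm, hj, hnm, hK, hX1, hX2⟩ := h0 n hn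
  obtain ⟨X, hX⟩ : ∃ X, X = (4 * k) ^ (j * (4 * k) + 1) := ⟨_, rfl⟩
  rw [← hX] at hX1 hX2
  have hX3 : 1 ≤ X ^ 3 := Nat.pow_pos OM
  obtain ⟨N, rfl⟩ : ∃ N, n = N + 1 := ⟨n - 1, by
    have : 1 ≤ (6144 * k * (4 * k ^ 2) ^ 4 + 1) * X ^ 3 := Nat.mul_pos OM hX3
    omega⟩
  have hN : 6144 * k * (4 * k ^ 2) ^ 4 * X ^ 3 ≤ N := by
    rw [add_mul] at hX2; omega
  obtain ⟨K, K0, h1, h2, h3⟩ := numer k2 hX1 (l := j * (4 * k) + 1)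
    (by rw [hX]; exact (Nat.lt_pow_self OM).le) hN
  have hXq : 2 * k * (2 * k - 1) ^ (j * (4 * k)) ≤ X := by
    rw [hX, pow_succ, mul_comm]
    exact Nat.mul_le_mul (pow_le_pow_left OM _) OM
  have hNX : 24 * k * X ≤ N := by
    refine le_trans ?_ hN
    have a1 : 1 ≤ (4 * k ^ 2) ^ 4 := Nat.pow_pos (by positivity)
    have a2 : X ≤ X ^ 3 := Nat.le_self_pow (by norm_num) X
    have a3 : k ≤ k * (4 * k ^ 2) ^ 4 := le_mul_of_pos_right _ a1
    calc 24 * k * X ≤ 6144 * (k * (4 * k ^ 2) ^ 4) * X ^ 3 := Nat.mul_le_mul OM a2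
      _ = _ := by ring
  have h24 : 24 * k ≤ N := le_trans (le_mul_of_pos_right _ OM) hNX
  have hXN : X ≤ N := le_trans (le_mul_of_pos_left _ OM) hNX
  let c : Letter k := (⟨0, hk⟩, true)
  let l := j * (4 * k) + 1
  obtain ⟨q, hq⟩ : ∃ q, q = 2 * k - 1 := ⟨_, rfl⟩
  let S1 := (Wd c N).filter fun w => ¬ CyclicallyReducedWord (c :: w)
  let S2 := (Wd c N).filter fun w => ¬ Dv l (K : ℝ) c w
  let S3 := (Wd c N).filter fun w => CyclicallyReducedWord (c :: w) ∧ ¬ P1 hk m (c :: w)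
  let G := (Wd c N).filter fun w => CyclicallyReducedWord (c :: w) ∧ P1 hk m (c :: w) ∧ Dv l (K : ℝ) c w
  have hG : G.card ≤ 2 * (2 * k) ^ k * (N + 1) * isoTypesCount k (N + 1) := fib_bound (c := c) fun w hw => by
    obtain ⟨b1, b2, b3, b4⟩ := mem_filter.1 hw
    exact ⟨(mem_Wd.1 b1).1, b2, good_bound (hk := hk) k2 hm hj b1 b4 b2 b3 hK
      ((Nat.mul_le_mul_right _ hXq).trans h1) h2⟩
  have hU : Wd c N ⊆ G ∪ (S1 ∪ (S2 ∪ S3)) := by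
    intro w hw
    simp only [G, S1, S2, S3, mem_union, mem_filter, hw, true_and]
    by_cases x1 : CyclicallyReducedWord (c :: w) <;> by_cases x2 : P1 hk m (c :: w) <;>
      by_cases x3 : Dv l (K : ℝ) c w <;> simp [x1, x2, x3]
  have hT : q ^ N ≤ G.card + (S1.card + (S2.card + S3.card)) := by
    rw [hq, ← card_Wd c N]
    refine (card_le_card hU).trans ((card_union_le _ _).trans (Nat.add_le_add_left ?_ _))
    refine (card_union_le _ _).trans (Nat.add_le_add_left (card_union_le _ _) _)
  have s1 : 3 * S1.card ≤ q ^ N := by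
    have a : S1.card ≤ q ^ (N - 1) := by rw [hq]; exact noncyc_card OM c
    calc 3 * S1.card ≤ q * q ^ (N - 1) := Nat.mul_le_mul OM a
      _ = q ^ N := by rw [← pow_succ']; congr 1; omega
  have s2 : 6 * S2.card ≤ q ^ N := by
    have a := dv_card k2 l N (K := (K : ℝ)) (by exact_mod_cast K0) c
    rw [← hq] at a
    have b : (4 * k : ℝ) ^ (l + 1) * N / (K : ℝ) ^ 2 ≤ 1 / 6 := by
      rw [div_le_div_iff₀ (by positivity) (by norm_num)]
      have : (4 * k) ^ (l + 1) * N * 6 ≤ 1 * K ^ 2 := by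
        rw [pow_succ]; simp only [l]; rw [← hX]
        calc _ = 24 * k * X * N := by ring
          _ ≤ _ := OM
      exact_mod_cast this
    have d : (S2.card : ℝ) ≤ 1 / 6 * (q : ℝ) ^ N := a.trans (mul_le_mul_of_nonneg_right b (by positivity))
    have : (6 : ℝ) * S2.card ≤ (q : ℝ) ^ N := by linarith
    exact_mod_cast this
  have s3 : 6 * S3.card ≤ q ^ N := by
    have a := p1_bad (k := k) hk hm (show 2 * m ≤ N + 1 by omega) (S := S3.image (List.cons c)) (by
      intro u hu
      obtain ⟨w, hw, rfl⟩ := mem_image.1 hu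
      obtain ⟨b1, b2, b3⟩ := mem_filter.1 hw
      exact ⟨by simp [(mem_Wd.1 b1).1], b2, b3⟩)
    rw [card_image_of_injective _ (fun _ _ h => (List.cons.inj h).2), ← hq,
      show N + 1 - m - 1 = N - m by omega] at a
    have b : 24 * k * (N + 1) ^ 2 ≤ q ^ m := by
      calc _ ≤ (N + 1) ^ 2 * (N + 1) ^ 2 := Nat.mul_le_mul_right _ (by nlinarith)
        _ = (N + 1) ^ 4 := by ring
        _ ≤ 2 ^ m := hnm
        _ ≤ _ := pow_le_pow_left OM _
    calc 6 * S3.card ≤ 6 * ((N + 1) * (2 * ((N + 1) * (2 * k * q ^ (N - m))))) := Nat.mul_le_mul_left _ a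
      _ = 24 * k * (N + 1) ^ 2 * q ^ (N - m) := by ring
      _ ≤ q ^ m * q ^ (N - m) := Nat.mul_le_mul_right _ b
      _ = q ^ N := by rw [← pow_add]; congr 1; omega
  rw [← hq, Nat.add_sub_cancel]
  omega
end

lemma upper2 (k2 : 2 ≤ k) : ∃ A : ℕ, 0 < A ∧ ∀ n, 1 ≤ n → n * isoTypesCount k n ≤ A * (2 * k - 1) ^ n := by
  classical
  obtain ⟨n0, h0⟩ := params k2 1
  refine ⟨6 * k + n0 * (2 * k), OM, fun n hn => ?_⟩
  obtain ⟨q, hq⟩ : ∃ q, q = 2 * k - 1 := ⟨_, rfl⟩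
  have hqn : q ^ (n - 1) ≤ q ^ n := pow_le_pow_right OM OM
  rcases lt_or_ge n n0 with h | h
  · have a : isoTypesCount k n ≤ 2 * k * q ^ (n - 1) := by
      rw [iso_card hn, hq]; exact card_image_le.trans (card_Cf n)
    rw [← hq]
    calc _ ≤ n0 * (2 * k * q ^ n) := Nat.mul_le_mul h.le (a.trans (Nat.mul_le_mul_left _ hqn))
      _ = n0 * (2 * k) * q ^ n := by ring
      _ ≤ _ := Nat.mul_le_mul_right _ OM
  · obtain ⟨m, j, hm, -, hnm, -, h1, h2⟩ := h0 n h
    have h3 := Nat.le_self_pow (show 3 ≠ 0 by norm_num) ((4 * k) ^ (j * (4 * k) + 1))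
    have a := upper1 (k := k) OM hm (show 2 * m ≤ n by omega)
    rw [← hq] at a ⊢
    have b : n ^ 3 ≤ q ^ m := by
      calc n ^ 3 ≤ n ^ 4 := pow_le_pow_right OM (by norm_num)
        _ ≤ 2 ^ m := hnm
        _ ≤ _ := pow_le_pow_left OM _
    have d : n ^ 3 * q ^ (n - m - 1) ≤ q ^ n := by
      calc _ ≤ q ^ m * q ^ (n - m - 1) := Nat.mul_le_mul_right _ b
        _ = q ^ (n - 1) := by rw [← pow_add]; congr 1; omega
        _ ≤ _ := hqn
    calc _ ≤ _ := a
      _ = 2 * k * q ^ (n - 1) + 4 * k * (n ^ 3 * q ^ (n - m - 1)) := by ring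
      _ ≤ 2 * k * q ^ n + 4 * k * q ^ n := Nat.add_le_add (Nat.mul_le_mul_left _ hqn) (Nat.mul_le_mul_left _ d)
      _ = 6 * k * q ^ n := by ring
      _ ≤ _ := Nat.mul_le_mul_right _ OM

lemma iso_pos {n : ℕ} (hk : 0 < k) (hn : 1 ≤ n) : 1 ≤ isoTypesCount k n := by
  classical
  rw [iso_card hn]
  refine card_pos.2 (Finset.Nonempty.image ?_ _)
  have hr : ∀ n, FreeGroup.IsReduced (replicate n ((⟨0, hk⟩, true) : Letter k)) := fun n =>
    List.isChain_replicate_of_rel n (fun _ => rfl)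
  have e : (mk (replicate n ((⟨0, hk⟩, true) : Letter k))).toWord = replicate n (⟨0, hk⟩, true) := by
    rw [toWord_mk]; exact isReduced_iff_reduce_eq.1 (hr n)
  refine ⟨mk (replicate n (⟨0, hk⟩, true)), (mem_Cf hn).2 ⟨?_, ?_⟩⟩
  · rw [Cset, mem_ofPred_eq, IsCyclicallyReduced, e, CyclicallyReducedWord, List.replicate_append_replicate]
    exact isReduced_iff_reduce_eq.1 (hr _)
  · rw [wordLength, e, List.length_replicate]

lemma lower2 (k2 : 2 ≤ k) : ∃ D : ℕ, 0 < D ∧ ∀ n, 1 ≤ n → (2 * k - 1) ^ n ≤ D * (n * isoTypesCount k n) := by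
  obtain ⟨n0, h0⟩ := lower1 k2
  obtain ⟨q, hq⟩ : ∃ q, q = 2 * k - 1 := ⟨_, rfl⟩
  rw [← hq]; simp only [← hq] at h0
  have h1 : 0 < q ^ n0 := Nat.pow_pos OM
  refine ⟨q * (3 * (2 * (2 * k) ^ k)) + q ^ n0, OM, fun n hn => ?_⟩
  rcases lt_or_ge n n0 with h | h
  · have a := Nat.mul_le_mul hn (iso_pos (k := k) OM hn)
    calc q ^ n ≤ q ^ n0 * 1 := by rw [mul_one]; exact pow_le_pow_right OM h.le
      _ ≤ _ := Nat.mul_le_mul OM a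
  · calc q ^ n = q * q ^ (n - 1) := by rw [← pow_succ']; congr 1; omega
      _ ≤ q * (3 * (2 * (2 * k) ^ k * n * isoTypesCount k n)) := Nat.mul_le_mul_left _ (h0 n h)
      _ = q * (3 * (2 * (2 * k) ^ k)) * (n * isoTypesCount k n) := by ring
      _ ≤ _ := Nat.mul_le_mul_right _ OM

/-- `(B/n)(2k−1)^n ≤ I_k(n) ≤ (A/n)(2k−1)^n` for all `n ≥ 1`, for some
constants `A, B > 0` depending only on `k`. -/
theorem isoTypesCount_bounds (k : ℕ) (hk : 2 ≤ k) :
    ∃ A B : ℝ, 0 < A ∧ 0 < B ∧ ∀ n : ℕ, 1 ≤ n →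
      (B / n) * (2 * (k : ℝ) - 1) ^ n ≤ (isoTypesCount k n : ℝ) ∧
      (isoTypesCount k n : ℝ) ≤ (A / n) * (2 * (k : ℝ) - 1) ^ n := by
  obtain ⟨A, hA, h1⟩ := upper2 hk
  obtain ⟨D, hD, h2⟩ := lower2 hk
  have hD' : (0 : ℝ) < D := by exact_mod_cast hD
  refine ⟨A, 1 / D, by exact_mod_cast hA, by positivity, fun n hn => ?_⟩
  have e : (2 * (k : ℝ) - 1) = ((2 * k - 1 : ℕ) : ℝ) := by
    rw [Nat.cast_sub OM]; push_cast; ring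
  have hn' : (0 : ℝ) < n := by exact_mod_cast hn
  have a : (n : ℝ) * isoTypesCount k n ≤ A * ((2 * k - 1 : ℕ) : ℝ) ^ n := by exact_mod_cast h1 n hn
  have b : ((2 * k - 1 : ℕ) : ℝ) ^ n ≤ D * (n * isoTypesCount k n) := by exact_mod_cast h2 n hn
  rw [e]
  constructor
  · rw [div_div, one_div_mul_eq_div, div_le_iff₀ (by positivity)]
    linarith
  · rw [div_mul_eq_mul_div, le_div_iff₀ hn']
    linarith
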